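/- The inferior limit, as n → ∞, of f^(3)(n; 10, 8)/n² is at least 3/16. -/

import Mathlib

/-- An `(s,k)`-configuration in `G`: `k` distinct edges whose union has at most `s` vertices. -/
def HasConfig {n : ℕ} (G : Finset (Finset (Fin n))) (s k : ℕ) : Prop :=
  ∃ S ⊆ G, S.card = k ∧ (S.sup id).card ≤ s

/-- `fBES r n s k` is the maximum number of edges in an `r`-uniform hypergraph on `n`
vertices containing no `(s,k)`-configuration. -/
noncomputable def fBES (r n s k : ℕ) : ℕ :=
  sSup {m : ℕ | ∃ G : Finset (Finset (Fin n)),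
    (∀ e ∈ G, e.card = r) ∧ ¬ HasConfig G s k ∧ G.card = m}


namespace BES

section Prob
variable {I S : Type*} [Fintype I] [DecidableEq I] [Fintype S]

/-- Expectation over a finite product space with weights `w`. -/
noncomputable def Ex (w : I → S → ℝ) (f : (I → S) → ℝ) : ℝ :=
  ∑ ω : I → S, (∏ i, w i (ω i)) * f ω

variable {w : I → S → ℝ}

lemma Ex_add (f g : (I → S) → ℝ) : Ex w (fun ω => f ω + g ω) = Ex w f + Ex w g := by
  simp [Ex, mul_add, Finset.sum_add_distrib]

lemma Ex_sub (f g : (I → S) → ℝ) : Ex w (fun ω => f ω - g ω) = Ex w f - Ex w g := by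
  simp [Ex, mul_sub, Finset.sum_sub_distrib]

lemma Ex_sum {J : Type*} (s : Finset J) (F : J → (I → S) → ℝ) :
    Ex w (fun ω => ∑ j ∈ s, F j ω) = ∑ j ∈ s, Ex w (F j) := by
  simp only [Ex, Finset.mul_sum]
  rw [Finset.sum_comm]

lemma Ex_weight (hw : ∀ i, ∑ s, w i s = 1) : ∑ ω : I → S, (∏ i, w i (ω i)) = 1 := by
  rw [← Fintype.prod_sum]
  simp [hw]

lemma Ex_const (hw : ∀ i, ∑ s, w i s = 1) (c : ℝ) : Ex w (fun _ => c) = c := by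
  simp only [Ex, ← Finset.sum_mul, Ex_weight hw, one_mul]

lemma Ex_mono (hw : ∀ i s, 0 ≤ w i s) {f g : (I → S) → ℝ} (h : ∀ ω, f ω ≤ g ω) :
    Ex w f ≤ Ex w g := by
  apply Finset.sum_le_sum
  intro ω _
  exact mul_le_mul_of_nonneg_left (h ω) (Finset.prod_nonneg fun i _ => hw i _)

lemma exists_ge_Ex (hw0 : ∀ i s, 0 ≤ w i s) (hw : ∀ i, ∑ s, w i s = 1) (f : (I → S) → ℝ) :
    ∃ ω, Ex w f ≤ f ω := by
  by_contra h
  push Not at h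
  have hex : ∃ ω : I → S, 0 < ∏ i, w i (ω i) := by
    by_contra h2
    push Not at h2
    have := Ex_weight hw
    have h3 : ∑ ω : I → S, (∏ i, w i (ω i)) ≤ 0 := Finset.sum_nonpos fun ω _ => h2 ω
    linarith
  obtain ⟨ω0, h0⟩ := hex
  have : Ex w f < Ex w (fun _ => Ex w f) := by
    apply Finset.sum_lt_sum
    · intro ω _
      exact mul_le_mul_of_nonneg_left (h ω).le (Finset.prod_nonneg fun i _ => hw0 i _)
    · exact ⟨ω0, Finset.mem_univ _, mul_lt_mul_of_pos_left (h ω0) h0⟩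
  rw [Ex_const hw] at this
  exact lt_irrefl _ this

open Classical in
/-- Swap the coordinates outside `A`. -/
noncomputable def swapEquiv (A : Set I) : ((I → S) × (I → S)) ≃ ((I → S) × (I → S)) where
  toFun p := (fun i => if i ∈ A then p.1 i else p.2 i, fun i => if i ∈ A then p.2 i else p.1 i)
  invFun p := (fun i => if i ∈ A then p.1 i else p.2 i, fun i => if i ∈ A then p.2 i else p.1 i)
  left_inv p := by
    ext i <;> by_cases h : i ∈ A <;> simp [h]
  right_inv p := by
    ext i <;> by_cases h : i ∈ A <;> simp [h]

lemma Ex_mul (hw : ∀ i, ∑ s, w i s = 1) (A : Set I) {f g : (I → S) → ℝ}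
    (hf : DependsOn f A) (hg : DependsOn g Aᶜ) :
    Ex w (fun ω => f ω * g ω) = Ex w f * Ex w g := by
  classical
  have h1 : Ex w f * Ex w g = ∑ p : (I → S) × (I → S),
      ((∏ i, w i (p.1 i)) * (∏ i, w i (p.2 i))) * (f p.1 * g p.2) := by
    rw [Fintype.sum_prod_type]
    simp only [Ex, Finset.sum_mul_sum]
    refine Finset.sum_congr rfl fun a _ => Finset.sum_congr rfl fun b _ => ?_
    ring
  have h2 : Ex w (fun ω => f ω * g ω) = ∑ p : (I → S) × (I → S),
      ((∏ i, w i (p.1 i)) * (∏ i, w i (p.2 i))) * (f p.1 * g p.1) := by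
    rw [Fintype.sum_prod_type]
    simp only [Ex]
    refine Finset.sum_congr rfl fun a _ => ?_
    have : ∀ b : I → S, (∏ i, w i (a i)) * (∏ i, w i (b i)) * (f a * g a)
      = (∏ i, w i (b i)) * ((∏ i, w i (a i)) * (f a * g a)) := fun b => by ring
    simp only [this, ← Finset.sum_mul, Ex_weight hw, one_mul]
  rw [h1, h2]
  refine (Fintype.sum_equiv (swapEquiv A) _ _ ?_).symm
  rintro ⟨a, b⟩
  have e1 : f a = f (swapEquiv A (a, b)).1 := by
    apply hf
    intro i hi
    simp [swapEquiv, hi]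
  have e2 : g b = g (swapEquiv A (a, b)).1 := by
    apply hg
    intro i hi
    have : i ∉ A := hi
    simp [swapEquiv, this]
  rw [← e1, ← e2]
  congr 1
  rw [← Finset.prod_mul_distrib, ← Finset.prod_mul_distrib]
  refine Finset.prod_congr rfl fun i _ => ?_
  by_cases h : i ∈ A <;> simp [swapEquiv, h, mul_comm]

lemma DependsOn.prod' {J : Type*} {s : Finset J} {F : J → (I → S) → ℝ} {B : Set I}
    (h : ∀ j ∈ s, DependsOn (F j) B) : DependsOn (fun ω => ∏ j ∈ s, F j ω) B := by
  intro x y hxy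
  exact Finset.prod_congr rfl fun j hj => h j hj hxy

lemma DependsOn.sum' {J : Type*} {s : Finset J} {F : J → (I → S) → ℝ} {B : Set I}
    (h : ∀ j ∈ s, DependsOn (F j) B) : DependsOn (fun ω => ∑ j ∈ s, F j ω) B := by
  intro x y hxy
  exact Finset.sum_congr rfl fun j hj => h j hj hxy

lemma DependsOn.mul' {f g : (I → S) → ℝ} {B : Set I}
    (hf : DependsOn f B) (hg : DependsOn g B) : DependsOn (fun ω => f ω * g ω) B := by
  intro x y hxy
  show f x * g x = f y * g y
  rw [hf hxy, hg hxy]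

lemma DependsOn.add' {f g : (I → S) → ℝ} {B : Set I}
    (hf : DependsOn f B) (hg : DependsOn g B) : DependsOn (fun ω => f ω + g ω) B := by
  intro x y hxy
  show f x + g x = f y + g y
  rw [hf hxy, hg hxy]

lemma DependsOn.one_sub' {f : (I → S) → ℝ} {B : Set I}
    (hf : DependsOn f B) : DependsOn (fun ω => 1 - f ω) B := by
  intro x y hxy
  show 1 - f x = 1 - f y
  rw [hf hxy]

lemma DependsOn.mono' {f : (I → S) → ℝ} {A B : Set I} (h : A ⊆ B)
    (hf : DependsOn f A) : DependsOn f B := by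
  intro x y hxy
  exact hf fun i hi => hxy i (h hi)

lemma Ex_prod (hw : ∀ i, ∑ s, w i s = 1) {J : Type*} (s : Finset J)
    (F : J → (I → S) → ℝ) (A : J → Set I) (hdep : ∀ j ∈ s, DependsOn (F j) (A j))
    (hdisj : ∀ j ∈ s, ∀ j' ∈ s, j ≠ j' → Disjoint (A j) (A j')) :
    Ex w (fun ω => ∏ j ∈ s, F j ω) = ∏ j ∈ s, Ex w (F j) := by
  classical
  induction s using Finset.induction_on with
  | empty => simp [Ex_const hw]
  | insert a s ha ih =>
    simp only [Finset.prod_insert ha]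
    rw [Ex_mul hw (A a) (hdep a (Finset.mem_insert_self _ _)), ih]
    · exact fun j hj => hdep j (Finset.mem_insert_of_mem hj)
    · exact fun j hj j' hj' => hdisj j (Finset.mem_insert_of_mem hj) j' (Finset.mem_insert_of_mem hj')
    · apply DependsOn.prod'
      intro j hj
      refine DependsOn.mono' ?_ (hdep j (Finset.mem_insert_of_mem hj))
      rw [Set.subset_compl_iff_disjoint_left]
      exact hdisj a (Finset.mem_insert_self _ _) j (Finset.mem_insert_of_mem hj)
        (by rintro rfl; exact ha hj)

end Prob
end BES

set_option linter.unusedSectionVars false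
namespace BES
section Core
variable {E C : Type*} [Fintype E] [DecidableEq E] [Fintype C] [DecidableEq C]

/-- constraints containing `e` -/
def cons (mem : C → Finset E) (e : E) : Finset C := Finset.univ.filter fun c => e ∈ mem c

lemma mem_cons {mem : C → Finset E} {e : E} {c : C} : c ∈ cons mem e ↔ e ∈ mem c := by
  simp [cons]

/-- probability that constraint `c` does not block `e` -/
noncomputable def NB (mem : C → Finset E) (isP : C → Bool) (c : C) (e : E) (bl : E → ℝ) : ℝ :=
  if isP c then ∏ e' ∈ (mem c).erase e, (1 - bl e') else 1 - ∏ e' ∈ (mem c).erase e, bl e'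

noncomputable def step (mem : C → Finset E) (isP : C → Bool) (β : E → Option C → ℝ) (l : E → ℝ)
    (X : E → C → ℝ) (s : Finset C) (e : E) : ℝ :=
  β e none * ∏ c ∈ s, (β e (some c) * NB mem isP c e (fun e' => l e' + X e' c))

noncomputable def BL (mem : C → Finset E) (isP : C → Bool) (β : ℕ → E → Option C → ℝ)
    (l : ℕ → E → ℝ) : ℕ → E → C → ℝ
  | 0 => fun _ _ => 0
  | k + 1 => fun e c => BL mem isP β l k e c +
      l k e * step mem isP (β k) (l k) (BL mem isP β l k) ((cons mem e).erase c) e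

noncomputable def full (mem : C → Finset E) (isP : C → Bool) (β : ℕ → E → Option C → ℝ)
    (l : ℕ → E → ℝ) (k : ℕ) (e : E) : ℝ :=
  step mem isP (β k) (l k) (BL mem isP β l k) (cons mem e) e

/-- locality structure -/
structure TreeLike (mem : C → Finset E) (K : ℕ) (T : ℕ → E → C → Set E) : Prop where
  self : ∀ n e c, e ∈ T n e c
  mono : ∀ n e c, T n e c ⊆ T (n + 1) e c
  sub : ∀ n e c c' e', n < K → e ∈ mem c → e ∈ mem c' → c ≠ c' → e' ∈ mem c' → e' ≠ e →
    T n e' c' ⊆ T (n + 1) e c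
  notMem : ∀ n e c' e', n < K → e ∈ mem c' → e' ∈ mem c' → e' ≠ e → e ∉ T n e' c'
  disj : ∀ n e c' c'' e' e'', n < K → e ∈ mem c' → e ∈ mem c'' → e' ∈ mem c' → e'' ∈ mem c'' →
    e' ≠ e → e'' ≠ e → (c' ≠ c'' ∨ e' ≠ e'') → Disjoint (T n e' c') (T n e'' c'')

variable (K : ℕ)

abbrev II (E C : Type*) (K : ℕ) := E ⊕ (E × Option C × Fin K)
abbrev SS (K : ℕ) := Fin K × Bool

def blk : II E C K → E
  | .inl e => e
  | .inr x => x.1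

noncomputable def ww (pad : ℕ → E → Option C → ℝ) : II E C K → SS K → ℝ
  | .inl _, _ => (1 / K) * (1 / 2)
  | .inr x, s => (1 / K) * (if s.2 then pad x.2.2 x.1 x.2.1 else 1 - pad x.2.2 x.1 x.2.1)

noncomputable def lab (ω : II E C K → SS K) (k : ℕ) (e : E) : ℝ :=
  if ((ω (.inl e)).1 : ℕ) = k then 1 else 0

noncomputable def bit (ω : II E C K → SS K) (k : ℕ) (e : E) (o : Option C) : ℝ :=
  if h : k < K then (if (ω (.inr (e, o, ⟨k, h⟩))).2 then 1 else 0) else 0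

variable {K}
lemma ww_sum (hK : 0 < K) (pad : ℕ → E → Option C → ℝ) (i : II E C K) :
    ∑ s, ww K pad i s = 1 := by
  have : (K : ℝ) ≠ 0 := by positivity
  rw [Fintype.sum_prod_type]
  rcases i with e | x <;> simp [ww] <;> field_simp <;> ring

lemma ww_nonneg (pad : ℕ → E → Option C → ℝ) (hp : ∀ k < K, ∀ e o, 0 ≤ pad k e o ∧ pad k e o ≤ 1)
    (i : II E C K) (s) : 0 ≤ ww K pad i s := by
  rcases i with e | x
  · simp only [ww]; positivity
  · simp only [ww]
    have := hp x.2.2 x.2.2.2 x.1 x.2.1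
    split_ifs <;> apply mul_nonneg <;> first | positivity | linarith

lemma Ex_single {I S : Type*} [Fintype I] [DecidableEq I] [Fintype S] {w : I → S → ℝ}
    (hw : ∀ i, ∑ s, w i s = 1) (i : I) (f : S → ℝ) :
    Ex w (fun ω => f (ω i)) = ∑ s, w i s * f s := by
  classical
  have h1 : ∀ ω : I → S, (∏ j, w j (ω j)) * f (ω i) =
      ∏ j, (w j (ω j) * (if j = i then f (ω j) else 1)) := by
    intro ω
    rw [Finset.prod_mul_distrib]
    simp
  simp only [Ex, h1]
  rw [← Fintype.prod_sum (fun j s => w j s * (if j = i then f s else 1))]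
  rw [Finset.prod_eq_single i]
  · simp
  · intro b _ hb; simp [hb, hw]
  · simp

lemma Ex_lab (hK : 0 < K) (pad : ℕ → E → Option C → ℝ) (k : ℕ) (hk : k < K) (e : E) :
    Ex (ww K pad) (fun ω => lab K ω k e) = 1 / K := by
  have := Ex_single (ww_sum hK pad) (.inl e) (fun s => if (s.1 : ℕ) = k then (1 : ℝ) else 0)
  simp only [lab]
  rw [this, Fintype.sum_prod_type]
  rw [Finset.sum_eq_single ⟨k, hk⟩]
  · simp [ww]; field_simp
  · intro b _ hb
    have : (b : ℕ) ≠ k := fun h => hb (Fin.ext h)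
    simp [this]
  · simp

lemma Ex_bit (hK : 0 < K) (pad : ℕ → E → Option C → ℝ) (k : ℕ) (hk : k < K) (e : E)
    (o : Option C) : Ex (ww K pad) (fun ω => bit K ω k e o) = pad k e o := by
  have hK' : (K : ℝ) ≠ 0 := by positivity
  have := Ex_single (ww_sum hK pad) (.inr (e, o, ⟨k, hk⟩)) (fun s => if s.2 then (1 : ℝ) else 0)
  simp only [bit, hk, dite_true]
  rw [this, Fintype.sum_prod_type]
  simp [ww]; field_simp

lemma lab_dep (k : ℕ) (e : E) :
    DependsOn (fun ω : II E C K → SS K => lab K ω k e) {i | i = .inl e} := by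
  intro x y h
  simp only [lab]
  rw [h (.inl e) rfl]

lemma bit_dep (k : ℕ) (e : E) (o : Option C) :
    DependsOn (fun ω : II E C K → SS K => bit K ω k e o)
      {i | ∃ h, i = .inr (e, o, ⟨k, h⟩)} := by
  intro x y h
  simp only [bit]
  split_ifs with h1 <;> first | rfl | skip
  all_goals
    have := h (.inr (e, o, ⟨k, h1⟩)) ⟨h1, rfl⟩
    simp_all

variable {mem : C → Finset E} {isP : C → Bool} {T : ℕ → E → C → Set E}

/-- dependency and expectation of the product over a constraint -/
lemma NB_dep (e : E) (c : C) (l : (II E C K → SS K) → E → ℝ)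
    (A : E → Set (II E C K))
    (hd : ∀ e' ∈ (mem c).erase e, DependsOn (fun ω => l ω e') (A e')) :
    DependsOn (fun ω => NB mem isP c e (l ω)) (⋃ e' ∈ (mem c).erase e, A e') := by
  have hd' : ∀ e' ∈ (mem c).erase e, DependsOn (fun ω => l ω e') (⋃ e' ∈ (mem c).erase e, A e') :=
    fun e' he' => DependsOn.mono' (Set.subset_biUnion_of_mem (u := A)
      (Finset.mem_coe.2 he')) (hd e' he')
  unfold NB
  split_ifs
  · exact DependsOn.prod' fun e' he' => DependsOn.one_sub' (hd' e' he')
  · exact DependsOn.one_sub' (DependsOn.prod' fun e' he' => hd' e' he')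

lemma NB_Ex {w : II E C K → SS K → ℝ} (hw : ∀ i, ∑ s, w i s = 1) (e : E) (c : C)
    (l : (II E C K → SS K) → E → ℝ) (A : E → Set (II E C K))
    (hd : ∀ e' ∈ (mem c).erase e, DependsOn (fun ω => l ω e') (A e'))
    (hA : ∀ e' ∈ (mem c).erase e, ∀ e'' ∈ (mem c).erase e, e' ≠ e'' → Disjoint (A e') (A e'')) :
    Ex w (fun ω => NB mem isP c e (l ω)) = NB mem isP c e (fun e' => Ex w (fun ω => l ω e')) := by
  unfold NB
  split_ifs
  · rw [Ex_prod hw _ (fun e' ω => 1 - l ω e') A (fun e' he' => DependsOn.one_sub' (hd e' he')) hA]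
    refine Finset.prod_congr rfl fun e' _ => ?_
    rw [Ex_sub, Ex_const hw]
  · rw [Ex_sub, Ex_const hw, Ex_prod hw _ (fun e' ω => l ω e') A hd hA]

/-- one step -/
lemma step_facts (hK : 0 < K) (pad : ℕ → E → Option C → ℝ) (hT : TreeLike mem K T) {k : ℕ}
    (hk : k < K) (X : (II E C K → SS K) → E → C → ℝ) (e : E) (s : Finset C) (hs : s ⊆ cons mem e)
    (hX : ∀ e' c', e' ∈ mem c' → DependsOn (fun ω => X ω e' c') {i | blk K i ∈ T k e' c'}) :
    DependsOn (fun ω => step mem isP (bit K ω k) (lab K ω k) (X ω) s e)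
      ({i | ∃ x, i = .inr x ∧ x.1 = e} ∪
        ⋃ c ∈ s, ⋃ e' ∈ (mem c).erase e, {i | blk K i ∈ T k e' c}) ∧
    Ex (ww K pad) (fun ω => step mem isP (bit K ω k) (lab K ω k) (X ω) s e) =
      step mem isP (pad k) (fun _ => 1 / K) (fun e' c' => Ex (ww K pad) (fun ω => X ω e' c')) s e := by
  have hw := ww_sum hK pad
  have hl : ∀ e' c', e' ∈ mem c' → DependsOn (fun ω => lab K ω k e' + X ω e' c')
      {i : II E C K | blk K i ∈ T k e' c'} := by
    intro e' c' h
    apply DependsOn.add' _ (hX e' c' h)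
    refine DependsOn.mono' ?_ (lab_dep k e')
    rintro i rfl
    exact hT.self _ _ _
  have hNBd : ∀ c ∈ s, DependsOn
      (fun ω => NB mem isP c e (fun e' => lab K ω k e' + X ω e' c))
      (⋃ e' ∈ (mem c).erase e, {i : II E C K | blk K i ∈ T k e' c}) := by
    intro c hc
    apply NB_dep e c (fun ω e' => lab K ω k e' + X ω e' c)
    intro e' he'
    exact hl e' c (Finset.mem_of_mem_erase he')
  let A : C → Set (II E C K) := fun c => {i | ∃ h, i = .inr (e, some c, ⟨k, h⟩)} ∪
      (⋃ e' ∈ (mem c).erase e, {i : II E C K | blk K i ∈ T k e' c})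
  have hnot : ∀ c ∈ s, ∀ i : II E C K, i ∈ (⋃ e' ∈ (mem c).erase e,
      {i : II E C K | blk K i ∈ T k e' c}) → blk K i ≠ e := by
    intro c hc i hi h
    simp only [Set.mem_iUnion] at hi
    obtain ⟨e', he', hi⟩ := hi
    rw [Finset.mem_erase] at he'
    have : blk K i ∈ T k e' c := hi
    rw [h] at this
    exact hT.notMem k e c e' hk (mem_cons.1 (hs hc)) he'.2 he'.1 this
  have hF : ∀ c ∈ s, DependsOn (fun ω => bit K ω k e (some c) *
      NB mem isP c e (fun e' => lab K ω k e' + X ω e' c)) (A c) := by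
    intro c hc
    exact DependsOn.mul' (DependsOn.mono' Set.subset_union_left (bit_dep k e (some c)))
      (DependsOn.mono' Set.subset_union_right (hNBd c hc))
  have hAd : ∀ c ∈ s, ∀ c' ∈ s, c ≠ c' → Disjoint (A c) (A c') := by
    intro c hc c' hc' hne
    rw [Set.disjoint_left]
    rintro i (⟨h, rfl⟩ | hi) (⟨h', hi'⟩ | hi')
    · simp at hi'; exact hne hi'
    · exact hnot c' hc' _ hi' rfl
    · subst hi'
      exact hnot c hc _ hi rfl
    · simp only [Set.mem_iUnion, Finset.mem_erase] at hi hi'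
      obtain ⟨e1, h1, hi⟩ := hi
      obtain ⟨e2, h2, hi'⟩ := hi'
      exact Set.disjoint_left.1 (hT.disj k e c c' e1 e2 hk (mem_cons.1 (hs hc))
        (mem_cons.1 (hs hc')) h1.2 h2.2 h1.1 h2.1 (Or.inl hne)) hi hi'
  constructor
  · unfold step
    apply DependsOn.mul'
    · refine DependsOn.mono' ?_ (bit_dep k e none)
      rintro i ⟨h, rfl⟩
      exact Or.inl ⟨_, rfl, rfl⟩
    · apply DependsOn.prod'
      intro c hc
      refine DependsOn.mono' ?_ (hF c hc)
      rintro i (⟨h, rfl⟩ | hi)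
      · exact Or.inl ⟨_, rfl, rfl⟩
      · exact Or.inr (Set.mem_biUnion (show c ∈ (s : Set C) from hc) hi)
  · unfold step
    rw [Ex_mul hw {i | ∃ h, i = .inr (e, none, ⟨k, h⟩)} (bit_dep k e none), Ex_bit hK pad k hk,
      Ex_prod hw s _ A hF hAd]
    · congr 1
      refine Finset.prod_congr rfl fun c hc => ?_
      rw [Ex_mul hw {i | ∃ h, i = .inr (e, some c, ⟨k, h⟩)} (bit_dep k e (some c)),
        Ex_bit hK pad k hk]
      · congr 1
        rw [NB_Ex hw e c (fun ω e' => lab K ω k e' + X ω e' c)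
          (fun e' => {i | blk K i ∈ T k e' c})]
        · congr 1
          funext e'
          rw [Ex_add, Ex_lab hK pad k hk]
        · intro e' he'
          exact hl e' c (Finset.mem_of_mem_erase he')
        · intro e1 h1 e2 h2 hne
          rw [Finset.mem_erase] at h1 h2
          have := hT.disj k e c c e1 e2 hk (mem_cons.1 (hs hc)) (mem_cons.1 (hs hc)) h1.2 h2.2
            h1.1 h2.1 (Or.inr hne)
          rw [Set.disjoint_left] at this ⊢
          intro i hi hi'
          exact this hi hi'
      · refine DependsOn.mono' ?_ (hNBd c hc)
        intro i hi
        rintro ⟨h, rfl⟩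
        exact hnot c hc _ hi rfl
    · apply DependsOn.prod'
      intro c hc
      refine DependsOn.mono' ?_ (hF c hc)
      rintro i hi ⟨h, rfl⟩
      rcases hi with ⟨h', hi⟩ | hi
      · simp at hi
      · exact hnot c hc _ hi rfl

lemma lab_step_Ex (hK : 0 < K) (pad : ℕ → E → Option C → ℝ) (hT : TreeLike mem K T) {k : ℕ}
    (hk : k < K) (X : (II E C K → SS K) → E → C → ℝ) (e : E) (s : Finset C) (hs : s ⊆ cons mem e)
    (hX : ∀ e' c', e' ∈ mem c' → DependsOn (fun ω => X ω e' c') {i | blk K i ∈ T k e' c'}) :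
    Ex (ww K pad) (fun ω => lab K ω k e * step mem isP (bit K ω k) (lab K ω k) (X ω) s e) =
      1 / K * step mem isP (pad k) (fun _ => 1 / K)
        (fun e' c' => Ex (ww K pad) (fun ω => X ω e' c')) s e := by
  obtain ⟨h1, h2⟩ := step_facts (isP := isP) hK pad hT hk X e s hs hX
  rw [← h2, Ex_mul (ww_sum hK pad) _ (lab_dep k e), Ex_lab hK pad k hk]
  refine DependsOn.mono' ?_ h1
  rintro i hi hi'
  rcases hi with ⟨x, rfl, _⟩ | hi
  · simp at hi'
  · simp only [Set.mem_iUnion, Finset.mem_erase] at hi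
    obtain ⟨c, hc, e', he', hi⟩ := hi
    have hi' : i = .inl e := hi'
    subst hi'
    exact hT.notMem k e c e' hk (mem_cons.1 (hs hc)) he'.2 he'.1 hi

lemma BL_facts (hK : 0 < K) (pad : ℕ → E → Option C → ℝ) (hT : TreeLike mem K T) (k : ℕ)
    (hk : k ≤ K) : (∀ e c, e ∈ mem c →
      DependsOn (fun ω => BL mem isP (bit K ω) (lab K ω) k e c) {i | blk K i ∈ T k e c}) ∧
    ∀ e c, Ex (ww K pad) (fun ω => BL mem isP (bit K ω) (lab K ω) k e c) =
      BL mem isP pad (fun _ _ => 1 / K) k e c := by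
  induction k with
  | zero =>
    constructor
    · intro e c _ x y _
      rfl
    · intro e c
      simp only [BL]
      exact Ex_const (ww_sum hK pad) 0
  | succ k ih =>
    obtain ⟨ih1, ih2⟩ := ih (by omega)
    have hk' : k < K := by omega
    constructor
    · intro e c hec
      simp only [BL]
      apply DependsOn.add'
      · exact DependsOn.mono' (fun i hi => hT.mono _ _ _ hi) (ih1 e c hec)
      · apply DependsOn.mul'
        · refine DependsOn.mono' ?_ (lab_dep k e)
          rintro i rfl
          exact hT.self _ _ _
        · refine DependsOn.mono' ?_ (step_facts hK pad hT hk'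
            (fun ω => BL mem isP (bit K ω) (lab K ω) k) e _ (Finset.erase_subset _ _) ih1).1
          rintro i (⟨x, rfl, rfl⟩ | hi)
          · exact hT.self _ _ _
          · simp only [Set.mem_iUnion, Finset.mem_erase] at hi
            obtain ⟨c', hc', e', he', hi⟩ := hi
            exact hT.sub k e c c' e' hk' hec (mem_cons.1 hc'.2) (Ne.symm hc'.1) he'.2 he'.1 hi
    · intro e c
      simp only [BL]
      rw [Ex_add, ih2, lab_step_Ex hK pad hT hk' _ e _ (Finset.erase_subset _ _) ih1]
      simp only [ih2]

/-- pointwise description of blocking indicators -/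
lemma BL_eq (ω : II E C K → SS K) (k : ℕ) (e : E) (c : C) :
    BL mem isP (bit K ω) (lab K ω) k e c = if ((ω (.inl e)).1 : ℕ) < k then
      step mem isP (bit K ω (ω (.inl e)).1) (lab K ω (ω (.inl e)).1)
        (BL mem isP (bit K ω) (lab K ω) (ω (.inl e)).1) ((cons mem e).erase c) e else 0 := by
  induction k with
  | zero => simp [BL]
  | succ k ih =>
    simp only [BL]
    rw [ih]
    rcases lt_trichotomy ((ω (.inl e)).1 : ℕ) k with h | h | h
    · have : ((ω (.inl e)).1 : ℕ) < k + 1 := by omega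
      simp [h, this, lab, h.ne]
    · simp [h, lab]
    · have h1 : ¬ ((ω (.inl e)).1 : ℕ) < k := by omega
      have h2 : ¬ ((ω (.inl e)).1 : ℕ) < k + 1 := by omega
      simp [h1, h2, lab, h.ne']

def is01 (x : ℝ) : Prop := x = 0 ∨ x = 1
lemma is01.mul {x y : ℝ} (hx : is01 x) (hy : is01 y) : is01 (x * y) := by
  rcases hx with rfl | rfl <;> rcases hy with rfl | rfl <;> simp [is01]
lemma is01.one_sub {x : ℝ} (hx : is01 x) : is01 (1 - x) := by
  rcases hx with rfl | rfl <;> simp [is01]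
lemma is01.prod {J : Type*} (s : Finset J) (f : J → ℝ) (h : ∀ j ∈ s, is01 (f j)) :
    is01 (∏ j ∈ s, f j) := by
  classical
  induction s using Finset.induction_on with
  | empty => simp [is01]
  | insert a s ha ih =>
    rw [Finset.prod_insert ha]
    exact is01.mul (h a (Finset.mem_insert_self _ _))
      (ih fun j hj => h j (Finset.mem_insert_of_mem hj))

lemma bit01 (ω : II E C K → SS K) (k e o) : is01 (bit K ω k e o) := by
  unfold bit is01; split_ifs <;> simp

lemma step01 (ω : II E C K → SS K) (k : ℕ) (X : E → C → ℝ)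
    (hX : ∀ e c, is01 (lab K ω k e + X e c)) (s e) :
    is01 (step mem isP (bit K ω k) (lab K ω k) X s e) := by
  unfold step
  refine (bit01 ω k e none).mul (is01.prod _ _ fun c _ => (bit01 ω k e _).mul ?_)
  unfold NB
  split_ifs
  · exact is01.prod _ _ fun e' _ => (hX e' c).one_sub
  · exact (is01.prod _ _ fun e' _ => hX e' c).one_sub

lemma BL01 (ω : II E C K → SS K) (k : ℕ) :
    ∀ e c, is01 (lab K ω k e + BL mem isP (bit K ω) (lab K ω) k e c) := by
  induction k using Nat.strong_induction_on with
  | _ k ih =>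
    intro e c
    rw [BL_eq]
    split_ifs with h
    · have : lab K ω k e = 0 := by simp [lab, h.ne]
      rw [this, zero_add]
      exact step01 ω _ _ (ih _ h) _ _
    · unfold lab is01; split_ifs <;> simp

/-- an accepted block with label at most `k` blocks at time `k` -/
lemma accepted_blocks (ω : II E C K → SS K) (k : ℕ) (e : E) (c : C)
    (h : full mem isP (bit K ω) (lab K ω) (ω (.inl e)).1 e ≠ 0) (hk : ((ω (.inl e)).1 : ℕ) ≤ k) :
    lab K ω k e + BL mem isP (bit K ω) (lab K ω) k e c = 1 := by
  rw [BL_eq]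
  rcases hk.lt_or_eq with h1 | h1
  · simp only [h1, if_true, lab, h1.ne, if_false, zero_add]
    have := step01 (mem := mem) (isP := isP) ω _ _ (BL01 (mem := mem) (isP := isP) ω (ω (.inl e)).1)
      ((cons mem e).erase c) e
    refine this.resolve_left ?_
    intro h0
    apply h
    unfold full
    unfold step at h0 ⊢
    rcases mul_eq_zero.1 h0 with h0 | h0
    · rw [h0, zero_mul]
    · obtain ⟨c', hc', h0⟩ := Finset.prod_eq_zero_iff.1 h0
      rw [Finset.prod_eq_zero (Finset.mem_of_mem_erase hc') h0, mul_zero]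
  · simp [h1, lab]

lemma full_NB {β : ℕ → E → Option C → ℝ} {l : ℕ → E → ℝ} {k : ℕ} {e : E} {c : C}
    (h : full mem isP β l k e ≠ 0) (hc : e ∈ mem c) :
    NB mem isP c e (fun e' => l k e' + BL mem isP β l k e' c) ≠ 0 := by
  intro h0
  apply h
  unfold full step
  rw [Finset.prod_eq_zero (mem_cons.2 hc), mul_zero]
  rw [h0, mul_zero]

/-- Probabilistic reduction. -/
theorem exists_matching (hK : 0 < K) (pad : ℕ → E → Option C → ℝ)
    (hp : ∀ k < K, ∀ e o, 0 ≤ pad k e o ∧ pad k e o ≤ 1) (hT : TreeLike mem K T) :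
    ∃ M : Finset E, (∀ c, isP c = true → ∀ e ∈ M, ∀ e' ∈ M, e ∈ mem c → e' ∈ mem c → e = e') ∧
      (∀ c, isP c = false → (mem c).Nonempty → ¬ mem c ⊆ M) ∧
      ∑ e : E, ∑ k ∈ Finset.range K, 1 / K * full mem isP pad (fun _ _ => 1 / K) k e ≤ M.card := by
  classical
  let F : (II E C K → SS K) → ℝ := fun ω => ∑ e : E, ∑ k ∈ Finset.range K,
    lab K ω k e * full mem isP (bit K ω) (lab K ω) k e
  have hF : Ex (ww K pad) F =
      ∑ e : E, ∑ k ∈ Finset.range K, 1 / K * full mem isP pad (fun _ _ => 1 / K) k e := by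
    simp only [F]
    rw [Ex_sum]
    refine Finset.sum_congr rfl fun e _ => ?_
    rw [Ex_sum]
    refine Finset.sum_congr rfl fun k hk => ?_
    have hk := Finset.mem_range.1 hk
    obtain ⟨h1, h2⟩ := BL_facts (isP := isP) hK pad hT k hk.le
    have := lab_step_Ex (isP := isP) hK pad hT hk
      (fun ω => BL mem isP (bit K ω) (lab K ω) k) e (cons mem e) subset_rfl h1
    simp only [h2] at this
    exact this
  obtain ⟨ω, hω⟩ := exists_ge_Ex (ww_nonneg pad hp) (ww_sum hK pad) F
  refine ⟨Finset.univ.filter fun e => full mem isP (bit K ω) (lab K ω) (ω (.inl e)).1 e ≠ 0,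
    ?_, ?_, ?_⟩
  · have key : ∀ c, isP c = true → ∀ e e', full mem isP (bit K ω) (lab K ω) (ω (.inl e)).1 e ≠ 0 →
        full mem isP (bit K ω) (lab K ω) (ω (.inl e')).1 e' ≠ 0 → e ∈ mem c → e' ∈ mem c →
        ((ω (.inl e)).1 : ℕ) ≤ (ω (.inl e')).1 → e = e' := by
      intro c hc e e' h h' hm hm' hle
      by_contra hne
      apply full_NB h' hm'
      simp only [NB, hc, if_true]
      apply Finset.prod_eq_zero (Finset.mem_erase.2 ⟨hne, hm⟩)
      rw [accepted_blocks ω _ e c h hle, sub_self]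
    intro c hc e he e' he' hm hm'
    simp only [Finset.mem_filter, Finset.mem_univ, true_and] at he he'
    rcases le_total ((ω (.inl e)).1 : ℕ) (ω (.inl e')).1 with h | h
    · exact key c hc e e' he he' hm hm' h
    · exact (key c hc e' e he' he hm' hm h).symm
  · intro c hc hne hsub
    obtain ⟨e, he, hmax⟩ := Finset.exists_max_image (mem c) (fun e => ((ω (.inl e)).1 : ℕ)) hne
    have h1 := hsub he
    simp only [Finset.mem_filter, Finset.mem_univ, true_and] at h1
    apply full_NB h1 he
    simp only [NB, hc, Bool.false_eq_true, if_false]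
    rw [Finset.prod_eq_one]
    · simp
    · intro e' he'
      have he' := Finset.mem_of_mem_erase he'
      have h2 := hsub he'
      simp only [Finset.mem_filter, Finset.mem_univ, true_and] at h2
      exact accepted_blocks ω _ e' c h2 (hmax e' he')
  · rw [← hF]
    refine hω.trans (le_of_eq ?_)
    rw [Finset.card_filter]
    push_cast
    refine Finset.sum_congr rfl fun e _ => ?_
    rw [Finset.sum_eq_single ((ω (.inl e)).1 : ℕ)]
    · simp only [lab, if_true, one_mul]
      have := step01 (mem := mem) (isP := isP) ω _ _ (BL01 (mem := mem) (isP := isP) ω (ω (.inl e)).1) (cons mem e) e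
      change is01 (full mem isP (bit K ω) (lab K ω) (ω (.inl e)).1 e) at this
      rcases this with h | h <;> simp [h]
    · intro b _ hb
      simp [lab, hb.symm]
    · intro h
      exact absurd (Finset.mem_range.2 (ω (.inl e)).1.2) h

end Core
end BES

set_option linter.unusedSectionVars false
namespace BES
section Seq
/-- the deterministic blocking sequence -/
noncomputable def bs (κ : ℝ) (n r K : ℕ) : ℕ → ℝ
  | 0 => 1 / K
  | k + 1 => bs κ n r K k + κ * ((1 - bs κ n r K k) ^ n) ^ (r - 1) / K

noncomputable def qs (κ : ℝ) (n r K : ℕ) (k : ℕ) : ℝ := (1 - bs κ n r K k) ^ n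

variable {κ : ℝ} {n r K : ℕ}

lemma bs_succ (k : ℕ) : bs κ n r K (k + 1) = bs κ n r K k + κ * (qs κ n r K k) ^ (r - 1) / K := rfl

lemma bs_bound (h0 : 0 ≤ κ) (h1 : κ ≤ 1 / 4) (hK : 4 ≤ K) (k : ℕ) (hk : k ≤ K) :
    0 ≤ bs κ n r K k ∧ bs κ n r K k ≤ 1 / K + κ * k / K ∧ bs κ n r K k ≤ 1 / 2 := by
  have hK' : (4 : ℝ) ≤ K := by exact_mod_cast hK
  have key : ∀ k ≤ K, (1 : ℝ) / K + κ * k / K ≤ 1 / 2 := by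
    intro k hk
    have hk' : (k : ℝ) ≤ K := by exact_mod_cast hk
    have : (1 : ℝ) / K ≤ 1 / 4 := one_div_le_one_div_of_le (by norm_num) hK'
    have : κ * k / K ≤ 1 / 4 := by
      rw [div_le_iff₀ (by linarith)]
      nlinarith
    linarith
  induction k with
  | zero => simpa [bs] using (by simpa using key 0 (by omega) : (K : ℝ)⁻¹ ≤ 2⁻¹)
  | succ k ih =>
    obtain ⟨a1, a2, a3⟩ := ih (by omega)
    have hq : 0 ≤ qs κ n r K k ∧ qs κ n r K k ≤ 1 :=
      ⟨pow_nonneg (by linarith) _, pow_le_one₀ (by linarith) (by linarith)⟩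
    have hq2 : (qs κ n r K k) ^ (r - 1) ≤ 1 := pow_le_one₀ hq.1 hq.2
    have hq3 : 0 ≤ (qs κ n r K k) ^ (r - 1) := pow_nonneg hq.1 _
    have h2 : bs κ n r K (k + 1) ≤ 1 / K + κ * (k + 1 : ℕ) / K := by
      rw [bs_succ]
      have : κ * (qs κ n r K k) ^ (r - 1) / K ≤ κ / K := by
        apply div_le_div_of_nonneg_right _ (by linarith)
        nlinarith
      have e : κ * ((k + 1 : ℕ) : ℝ) / K = κ * k / K + κ / K := by push_cast; ring
      linarith
    refine ⟨?_, h2, h2.trans (key _ hk)⟩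
    rw [bs_succ]
    have : 0 ≤ κ * (qs κ n r K k) ^ (r - 1) / K := by positivity
    linarith

lemma qs_bound (h0 : 0 ≤ κ) (h1 : κ ≤ 1 / 4) (hK : 4 ≤ K) (k : ℕ) (hk : k ≤ K) :
    0 < qs κ n r K k ∧ qs κ n r K k ≤ 1 := by
  have := bs_bound (n := n) (r := r) h0 h1 hK k hk
  exact ⟨pow_pos (by linarith) _, pow_le_one₀ (by linarith) (by linarith)⟩

lemma qs_step (h0 : 0 ≤ κ) (h1 : κ ≤ 1 / 4) (hK : 4 ≤ K) (hr : 1 ≤ r) (k : ℕ) (hk : k < K) :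
    n * (κ * qs κ n r K k ^ (r - 1) / K) * qs κ n r K (k + 1)
      ≤ qs κ n r K k - qs κ n r K (k + 1) ∧
    qs κ n r K k - qs κ n r K (k + 1) ≤
      n * (κ * qs κ n r K k ^ r / K) / (1 - bs κ n r K k) := by
  have hb := bs_bound (n := n) (r := r) h0 h1 hK k hk.le
  have hb' := bs_bound (n := n) (r := r) h0 h1 hK (k + 1) hk
  have hq := qs_bound (n := n) (r := r) h0 h1 hK k hk.le
  have hq' := qs_bound (n := n) (r := r) h0 h1 hK (k + 1) hk
  have hx0 : 0 ≤ κ * qs κ n r K k ^ (r - 1) / K := by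
    have := hq.1.le
    positivity
  have hxr : κ * qs κ n r K k ^ r / K = κ * qs κ n r K k ^ (r - 1) / K * qs κ n r K k := by
    have : qs κ n r K k ^ r = qs κ n r K k ^ (r - 1) * qs κ n r K k := by
      rw [← pow_succ]; congr 1; omega
    rw [this]; ring
  have hsucc := bs_succ (κ := κ) (n := n) (r := r) (K := K) k
  rw [hxr]
  set x := κ * qs κ n r K k ^ (r - 1) / K with hx
  set b := bs κ n r K k with hbdef
  have e1 : qs κ n r K k = (1 - b) ^ n := rfl
  have e2 : qs κ n r K (k + 1) = (1 - b - x) ^ n := by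
    unfold qs; rw [hsucc]; ring
  constructor
  · have h2 : (1 + n * x) ≤ (1 + x) ^ n := one_add_mul_le_pow (by linarith) n
    have h3 : (1 - b - x) ^ n * (1 + x) ^ n ≤ (1 - b) ^ n := by
      rw [← mul_pow]
      apply pow_le_pow_left₀
      · apply mul_nonneg <;> linarith
      · nlinarith
    have h4 : (1 - b - x) ^ n * (1 + n * x) ≤ (1 - b - x) ^ n * (1 + x) ^ n :=
      mul_le_mul_of_nonneg_left h2 (pow_nonneg (by linarith) _)
    rw [e1, e2]; nlinarith
  · have hpos : 0 < 1 - b := by linarith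
    have h2 : 1 + n * (-(x / (1 - b))) ≤ (1 + -(x / (1 - b))) ^ n := by
      apply one_add_mul_le_pow
      have : x / (1 - b) ≤ 1 := by rw [div_le_one hpos]; linarith
      linarith
    have h3 : (1 - b - x) ^ n = (1 - b) ^ n * (1 + -(x / (1 - b))) ^ n := by
      rw [← mul_pow]; congr 1; field_simp; ring
    have h4 := mul_le_mul_of_nonneg_left h2 hq.1.le
    rw [e1] at h4
    rw [e1, e2, h3]
    have : n * (x * (1 - b) ^ n) / (1 - b) = (1 - b) ^ n * (n * (x / (1 - b))) := by
      field_simp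
    rw [this]; linarith

lemma qs_half (h0 : 0 ≤ κ) (h1 : κ ≤ 1 / 4) (hK : 4 ≤ K) (hKn : 4 * n ≤ K) (hr : 1 ≤ r) (k : ℕ)
    (hk : k < K) : qs κ n r K k / 2 ≤ qs κ n r K (k + 1) := by
  have hb := bs_bound (n := n) (r := r) h0 h1 hK k hk.le
  have hq := qs_bound (n := n) (r := r) h0 h1 hK k hk.le
  have h := (qs_step (n := n) h0 h1 hK hr k hk).2
  have hK' : (4 : ℝ) ≤ K := by exact_mod_cast hK
  have hKn' : (4 : ℝ) * n ≤ K := by exact_mod_cast hKn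
  have hqr : qs κ n r K k ^ r ≤ qs κ n r K k := pow_le_of_le_one hq.1.le hq.2 (by omega)
  have : n * (κ * qs κ n r K k ^ r / K) / (1 - bs κ n r K k) ≤ qs κ n r K k / 2 := by
    rw [div_le_iff₀ (by linarith)]
    have h2 : n * (κ * qs κ n r K k ^ r / K) ≤ qs κ n r K k / 4 := by
      have e : n * (κ * qs κ n r K k ^ r / K) = (n * (κ * qs κ n r K k ^ r)) / K := by ring
      rw [e, div_le_iff₀ (by linarith)]
      have hq0 := hq.1
      have h3 : κ * qs κ n r K k ^ r ≤ 1 * qs κ n r K k := by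
        apply mul_le_mul (by linarith) hqr (by positivity) (by norm_num)
      have h4 : (n : ℝ) * (κ * qs κ n r K k ^ r) ≤ n * (1 * qs κ n r K k) :=
        mul_le_mul_of_nonneg_left h3 (by positivity)
      nlinarith
    nlinarith [hq.1]
  linarith

lemma sum_upper (h0 : 0 ≤ κ) (h1 : κ ≤ 1 / 4) (hK : 4 ≤ K) (hn : 1 ≤ n) (hKn : 4 * n ≤ K)
    (hr : 1 ≤ r) (k : ℕ) (hk : k ≤ K) :
    ∑ j ∈ Finset.range k, κ * qs κ n r K j ^ r / K ≤ 2 / n := by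
  have hn' : (0 : ℝ) < n := by exact_mod_cast hn
  have key : ∑ j ∈ Finset.range k, κ * qs κ n r K j ^ r / K ≤
      ∑ j ∈ Finset.range k, (2 / n * (qs κ n r K j - qs κ n r K (j + 1))) := by
    apply Finset.sum_le_sum
    intro j hj
    have hj : j < K := by have := Finset.mem_range.1 hj; omega
    have a := (qs_step (n := n) h0 h1 hK hr j hj).1
    have b := qs_half (n := n) h0 h1 hK hKn hr j hj
    have hq := (qs_bound (n := n) (r := r) h0 h1 hK j hj.le).1
    have hxr : κ * qs κ n r K j ^ r / K = κ * qs κ n r K j ^ (r - 1) / K * qs κ n r K j := by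
      have : qs κ n r K j ^ r = qs κ n r K j ^ (r - 1) * qs κ n r K j := by
        rw [← pow_succ]; congr 1; omega
      rw [this]; ring
    have hx0 : 0 ≤ κ * qs κ n r K j ^ (r - 1) / K := by positivity
    rw [hxr]
    have e : 2 / (n : ℝ) * (qs κ n r K j - qs κ n r K (j + 1)) =
      (2 * (qs κ n r K j - qs κ n r K (j + 1))) / n := by ring
    rw [e, le_div_iff₀ hn']
    have := mul_le_mul_of_nonneg_left b (mul_nonneg hn'.le hx0)
    nlinarith
  refine key.trans ?_
  rw [← Finset.mul_sum, Finset.sum_range_sub']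
  have hq := (qs_bound (n := n) (r := r) h0 h1 hK k hk).1
  have hq0 := (qs_bound (n := n) (r := r) h0 h1 hK 0 (by omega)).2
  have : (0 : ℝ) < 2 / n := by positivity
  nlinarith

lemma bs_mono (h0 : 0 ≤ κ) (h1 : κ ≤ 1 / 4) (hK : 4 ≤ K) (i j : ℕ) (hij : i ≤ j) (hj : j ≤ K) :
    bs κ n r K i ≤ bs κ n r K j := by
  induction j, hij using Nat.le_induction with
  | base => rfl
  | succ j hij ih =>
    have := ih (by omega)
    rw [bs_succ]
    have hq := (qs_bound (n := n) (r := r) h0 h1 hK j (by omega)).1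
    have : 0 ≤ κ * (qs κ n r K j) ^ (r - 1) / K := by positivity
    linarith

lemma sum_lower (h0 : 0 ≤ κ) (h1 : κ ≤ 1 / 4) (hK : 4 ≤ K) (hn : 1 ≤ n)
    (hr : 1 ≤ r) : (1 - bs κ n r K K) * (qs κ n r K 0 - qs κ n r K K) / n ≤
    ∑ j ∈ Finset.range K, κ * qs κ n r K j ^ r / K := by
  have hn' : (0 : ℝ) < n := by exact_mod_cast hn
  have key : ∑ j ∈ Finset.range K, ((1 - bs κ n r K K) / n * (qs κ n r K j - qs κ n r K (j + 1))) ≤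
      ∑ j ∈ Finset.range K, κ * qs κ n r K j ^ r / K := by
    apply Finset.sum_le_sum
    intro j hj
    have hj : j < K := Finset.mem_range.1 hj
    have a := (qs_step (n := n) h0 h1 hK hr j hj).2
    have hb := bs_mono (n := n) (r := r) h0 h1 hK j K hj.le le_rfl
    have hbK := bs_bound (n := n) (r := r) h0 h1 hK K le_rfl
    have hq := (qs_bound (n := n) (r := r) h0 h1 hK j hj.le).1
    rw [le_div_iff₀ (by linarith)] at a
    have e : (1 - bs κ n r K K) / n * (qs κ n r K j - qs κ n r K (j + 1)) =
      ((1 - bs κ n r K K) * (qs κ n r K j - qs κ n r K (j + 1))) / n := by ring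
    rw [e, div_le_iff₀ hn']
    have hd : 0 ≤ qs κ n r K j - qs κ n r K (j + 1) := by
      have := (qs_step (n := n) h0 h1 hK hr j hj).1
      have hq' := (qs_bound (n := n) (r := r) h0 h1 hK (j+1) hj).1
      have : 0 ≤ n * (κ * qs κ n r K j ^ (r - 1) / K) * qs κ n r K (j + 1) := by positivity
      linarith
    nlinarith
  refine le_trans (le_of_eq ?_) key
  rw [← Finset.mul_sum, Finset.sum_range_sub']
  ring

lemma seq_final (η : ℝ) (hη : 0 < η) (hη1 : η < 1) (h0 : 0 < κ) (h1 : κ ≤ 1 / 4) (hκη : κ ≤ η / 8)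
    (r : ℕ) (hr : 1 ≤ r) : ∃ D0 : ℕ, ∀ D ≥ D0, ∃ K0 : ℕ, ∀ K ≥ K0,
      (1 - η) / D ≤ ∑ j ∈ Finset.range K, κ * qs κ (D - 1) r K j ^ r / K := by
  set θ := η / 4 with hθ
  have hθ0 : 0 < θ := by positivity
  have hlt : 1 - κ * θ ^ (r - 1) < 1 := by have : 0 < κ * θ ^ (r - 1) := by positivity
                                           linarith
  have hθ1 : θ ^ (r - 1) ≤ 1 := pow_le_one₀ hθ0.le (by linarith)
  have hge : 0 ≤ 1 - κ * θ ^ (r - 1) := by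
    have : 0 ≤ θ ^ (r - 1) := by positivity
    nlinarith
  obtain ⟨m, hm⟩ := exists_pow_lt_of_lt_one hθ0 hlt
  refine ⟨m + 2, fun D hD => ?_⟩
  obtain ⟨n, rfl⟩ : ∃ n, D = n + 1 := ⟨D - 1, by omega⟩
  simp only [Nat.add_sub_cancel]
  obtain ⟨K1, hK1⟩ := exists_nat_gt (8 * (n + 1) / η)
  refine ⟨max K1 4, fun K hK => ?_⟩
  have hn : 1 ≤ n := by omega
  have hn' : (1 : ℝ) ≤ n := by exact_mod_cast hn
  have hK4 : 4 ≤ K := le_trans (le_max_right _ _) hK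
  have hK4' : (4 : ℝ) ≤ K := by exact_mod_cast hK4
  have hKK : 8 * ((n : ℝ) + 1) / η < K := lt_of_lt_of_le hK1 (by exact_mod_cast le_trans (le_max_left _ _) hK)
  rw [div_lt_iff₀ hη] at hKK
  have hsum := sum_lower (κ := κ) (n := n) (r := r) (K := K) h0.le h1 hK4 hn hr
  refine le_trans ?_ hsum
  have hqK : qs κ n r K K ≤ θ := by
    by_contra hcon
    push Not at hcon
    have hmono : ∀ k ≤ K, θ ≤ qs κ n r K k := by
      intro k hk
      refine hcon.le.trans ?_
      have hb := bs_mono (n := n) (r := r) h0.le h1 hK4 k K hk le_rfl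
      have := bs_bound (n := n) (r := r) h0.le h1 hK4 K le_rfl
      exact pow_le_pow_left₀ (by linarith) (by linarith) _
    have hbk : ∀ k ≤ K, 1 / K + k * (κ * θ ^ (r - 1) / K) ≤ bs κ n r K k := by
      intro k
      induction k with
      | zero => intro _; simp [bs]
      | succ k ih =>
        intro hk
        have h2 := ih (by omega)
        rw [bs_succ]
        have : κ * θ ^ (r - 1) / K ≤ κ * qs κ n r K k ^ (r - 1) / K := by
          have := hmono k (by omega)
          gcongr
        push_cast
        linarith
    have h2 := hbk K le_rfl
    have h3 : (K : ℝ) * (κ * θ ^ (r - 1) / K) = κ * θ ^ (r - 1) := by field_simp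
    have h4 : (0 : ℝ) ≤ 1 / K := by positivity
    have h5 : qs κ n r K K ≤ (1 - κ * θ ^ (r - 1)) ^ n := by
      have := bs_bound (n := n) (r := r) h0.le h1 hK4 K le_rfl
      exact pow_le_pow_left₀ (by linarith) (by linarith) _
    have h6 : (1 - κ * θ ^ (r - 1)) ^ n ≤ (1 - κ * θ ^ (r - 1)) ^ m :=
      pow_le_pow_of_le_one hge hlt.le (by omega)
    linarith
  have hq0 : 1 - n / K ≤ qs κ n r K 0 := by
    have := one_add_mul_le_pow (a := -(1 / (K : ℝ))) (by
      have : (1 : ℝ) / K ≤ 1 := by rw [div_le_one (by linarith)]; linarith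
      linarith) n
    unfold qs bs
    have e : (1 : ℝ) - n / K = 1 + n * -(1 / K) := by ring
    rw [e]
    simpa [sub_eq_add_neg] using this
  have hnK : (n : ℝ) / K ≤ η / 8 := by
    rw [div_le_iff₀ (by linarith)]; nlinarith
  have h1K : (1 : ℝ) / K ≤ η / 8 := by
    rw [div_le_iff₀ (by linarith)]; nlinarith
  have hbK : bs κ n r K K ≤ η / 4 := by
    have := (bs_bound (n := n) (r := r) h0.le h1 hK4 K le_rfl).2.1
    have e : κ * K / K = κ := by field_simp
    linarith
  have hprod : (1 - η) ≤ (1 - bs κ n r K K) * (qs κ n r K 0 - qs κ n r K K) := by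
    have : (1 - η / 4) * (1 - η / 8 - η / 4) ≤ (1 - bs κ n r K K) * (qs κ n r K 0 - qs κ n r K K) := by
      apply mul_le_mul <;> linarith
    nlinarith
  have : (1 - η) / ((n + 1 : ℕ) : ℝ) ≤ (1 - η) / n := by
    push_cast
    apply div_le_div_of_nonneg_left <;> linarith
  exact this.trans (div_le_div_of_nonneg_right hprod (by linarith))

end Seq
end BES

set_option linter.unusedSectionVars false
namespace BES
section Pads
variable {E C : Type*} [Fintype E] [DecidableEq E] [Fintype C] [DecidableEq C]

noncomputable def NBc (mem : C → Finset E) (K : ℕ) (Y : E → C → ℝ) (c : C) (e : E) : ℝ :=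
  1 - ∏ e' ∈ (mem c).erase e, (1 / K + Y e' c)

noncomputable def YY (mem : C → Finset E) (κ : ℝ) (n r K : ℕ) : ℕ → E → C → ℝ
  | 0 => fun _ _ => 0
  | k + 1 => fun e c => YY mem κ n r K k e c +
      1 / K * (κ * qs κ n r K k ^ r / NBc mem K (YY mem κ n r K k) c e)

noncomputable def padF (mem : C → Finset E) (isP : C → Bool) (κ : ℝ) (n r K : ℕ) (k : ℕ) (e : E) :
    Option C → ℝ
  | none => κ / ∏ c ∈ (cons mem e).filter (fun c => isP c = false), NBc mem K (YY mem κ n r K k) c e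
  | some c => if isP c then (1 - bs κ n r K k) ^ (n + 1 - (mem c).card) else 1

variable {mem : C → Finset E} {isP : C → Bool} {κ : ℝ} {n r K : ℕ}

structure Hyp (mem : C → Finset E) (isP : C → Bool) (κ : ℝ) (n r K : ℕ) (Cc : ℝ) : Prop where
  r1 : 1 ≤ r
  hn : 24 ≤ n
  k0 : 0 < κ
  k1 : κ ≤ 1 / 4
  kC : κ ≤ Real.exp (-(2 * 10 ^ 7 * Cc))
  hK : 4 * (n + 1) ≤ K
  pcard : ∀ c, isP c = true → (mem c).card ≤ n + 1
  preg : ∀ e, ((cons mem e).filter fun c => isP c = true).card = r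
  ccard : ∀ c, isP c = false → (mem c).Nonempty → 2 ≤ (mem c).card ∧ (mem c).card ≤ 8
  csum : ∀ e, ∑ c ∈ (cons mem e).filter (fun c => isP c = false),
    (1 / (n + 1 : ℝ)) ^ ((mem c).card - 1) ≤ Cc

variable {Cc : ℝ}

lemma NBc_bound (H : Hyp mem isP κ n r K Cc) (Y : E → C → ℝ) (c : C) (hc : isP c = false) (e : E)
    (he : e ∈ mem c) (hY : ∀ e' ∈ mem c, 0 ≤ Y e' c ∧ Y e' c ≤ 4 / n) :
    1 / 2 ≤ NBc mem K Y c e ∧ NBc mem K Y c e ≤ 1 ∧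
    Real.exp (-(2 * 10 ^ 7 * (1 / (n + 1 : ℝ)) ^ ((mem c).card - 1))) ≤ NBc mem K Y c e := by
  have hn : (24 : ℝ) ≤ n := by exact_mod_cast H.hn
  have hK : 4 * ((n : ℝ) + 1) ≤ K := by exact_mod_cast H.hK
  have hcard := H.ccard c hc ⟨e, he⟩
  have hx : ∀ e' ∈ mem c, 0 ≤ 1 / (K : ℝ) + Y e' c ∧ 1 / (K : ℝ) + Y e' c ≤ 10 * (1 / (n + 1)) := by
    intro e' he'
    have := hY e' he'
    have h1 : 0 ≤ 1 / (K : ℝ) := by positivity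
    have h2 : 1 / (K : ℝ) ≤ 1 / (n + 1) := one_div_le_one_div_of_le (by linarith) (by linarith)
    have h3 : 4 / (n : ℝ) ≤ 8 * (1 / (n + 1)) := by
      rw [mul_one_div, div_le_div_iff₀ (by linarith) (by linarith)]; linarith
    have h4 : (0 : ℝ) ≤ 1 / (n + 1) := by positivity
    constructor <;> linarith
  have hprod : ∏ e' ∈ (mem c).erase e, (1 / (K : ℝ) + Y e' c) ≤
      (10 * (1 / (n + 1 : ℝ))) ^ ((mem c).card - 1) := by
    rw [← Finset.card_erase_of_mem he, ← Finset.prod_const]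
    exact Finset.prod_le_prod (fun e' h => (hx e' (Finset.mem_of_mem_erase h)).1)
      (fun e' h => (hx e' (Finset.mem_of_mem_erase h)).2)
  have hprod0 : 0 ≤ ∏ e' ∈ (mem c).erase e, (1 / (K : ℝ) + Y e' c) :=
    Finset.prod_nonneg fun e' h => (hx e' (Finset.mem_of_mem_erase h)).1
  have hz : 10 * (1 / (n + 1 : ℝ)) ≤ 1 / 2 := by
    rw [mul_one_div, div_le_div_iff₀ (by linarith) (by norm_num)]; linarith
  have hz0 : 0 ≤ 10 * (1 / (n + 1 : ℝ)) := by positivity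
  have hhalf : (10 * (1 / (n + 1 : ℝ))) ^ ((mem c).card - 1) ≤ 1 / 2 :=
    (pow_le_of_le_one hz0 (by linarith) (by omega)).trans hz
  have hseven : (10 * (1 / (n + 1 : ℝ))) ^ ((mem c).card - 1) ≤
      10 ^ 7 * (1 / (n + 1 : ℝ)) ^ ((mem c).card - 1) := by
    rw [mul_pow]
    apply mul_le_mul_of_nonneg_right _ (by positivity)
    exact pow_le_pow_right₀ (by norm_num) (by omega)
  unfold NBc
  refine ⟨by linarith, by linarith, ?_⟩
  set y := ∏ e' ∈ (mem c).erase e, (1 / (K : ℝ) + Y e' c)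
  have h1 : Real.exp (-(2 * y)) ≤ 1 - y := by
    have hy : y ≤ 1 / 2 := by linarith
    have h2 := Real.add_one_le_exp (2 * y)
    rw [Real.exp_neg, inv_le_comm₀ (Real.exp_pos _) (by linarith)]
    refine le_trans ?_ h2
    rw [inv_le_iff_one_le_mul₀ (by linarith)]
    nlinarith
  refine le_trans ?_ h1
  apply Real.exp_le_exp.2
  linarith

lemma YY_bound (H : Hyp mem isP κ n r K Cc) (k : ℕ) (hk : k ≤ K) (c : C) (hc : isP c = false)
    (e : E) (he : e ∈ mem c) : 0 ≤ YY mem κ n r K k e c ∧ YY mem κ n r K k e c ≤ 4 / n := by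
  have hn : 1 ≤ n := by have := H.hn; omega
  have hK4 : 4 ≤ K := by have := H.hK; omega
  have hKn : 4 * n ≤ K := by have := H.hK; omega
  suffices h : ∀ e ∈ mem c, 0 ≤ YY mem κ n r K k e c ∧ YY mem κ n r K k e c ≤
      2 * ∑ j ∈ Finset.range k, κ * qs κ n r K j ^ r / K by
    refine ⟨(h e he).1, (h e he).2.trans ?_⟩
    have := sum_upper (κ := κ) (n := n) (r := r) (K := K) H.k0.le H.k1 hK4 hn hKn H.r1 k hk
    have e : (4 : ℝ) / n = 2 * (2 / n) := by ring
    linarith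
  induction k with
  | zero => intro e he; simp [YY]
  | succ k ih =>
    have ih := ih (by omega)
    have hsum := sum_upper (κ := κ) (n := n) (r := r) (K := K) H.k0.le H.k1 hK4 hn hKn H.r1 k
      (by omega)
    intro e he
    have hb := NBc_bound H (YY mem κ n r K k) c hc e he (fun e' he' => ⟨(ih e' he').1, by
      have e : (4 : ℝ) / n = 2 * (2 / n) := by ring
      linarith [(ih e' he').2]⟩)
    have hq := (qs_bound (n := n) (r := r) H.k0.le H.k1 hK4 k (by omega)).1
    have hk0 := H.k0
    have hpos : 0 ≤ κ * qs κ n r K k ^ r := by positivity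
    have h1 : κ * qs κ n r K k ^ r / NBc mem K (YY mem κ n r K k) c e ≤ 2 * (κ * qs κ n r K k ^ r) := by
      rw [div_le_iff₀ (by linarith)]
      nlinarith
    have h2 : 0 ≤ κ * qs κ n r K k ^ r / NBc mem K (YY mem κ n r K k) c e :=
      div_nonneg hpos (by linarith)
    have hK0 : (0 : ℝ) ≤ 1 / K := by positivity
    have h3 := mul_le_mul_of_nonneg_left h1 hK0
    have h4 := mul_nonneg hK0 h2
    simp only [YY]
    rw [Finset.sum_range_succ]
    have e2 : κ * qs κ n r K k ^ r / K = 1 / K * (κ * qs κ n r K k ^ r) := by ring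
    rw [e2]
    have := ih e he
    constructor
    · linarith
    · linarith

lemma NBc_ok (H : Hyp mem isP κ n r K Cc) (k : ℕ) (hk : k ≤ K) (c : C) (hc : isP c = false) (e : E)
    (he : e ∈ mem c) :
    1 / 2 ≤ NBc mem K (YY mem κ n r K k) c e ∧ NBc mem K (YY mem κ n r K k) c e ≤ 1 ∧
    Real.exp (-(2 * 10 ^ 7 * (1 / (n + 1 : ℝ)) ^ ((mem c).card - 1))) ≤
      NBc mem K (YY mem κ n r K k) c e :=
  NBc_bound H _ c hc e he fun e' he' => YY_bound H k hk c hc e' he'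

lemma prod_NBc (H : Hyp mem isP κ n r K Cc) (k : ℕ) (hk : k ≤ K) (e : E) :
    κ ≤ ∏ c ∈ (cons mem e).filter (fun c => isP c = false), NBc mem K (YY mem κ n r K k) c e := by
  calc κ ≤ Real.exp (-(2 * 10 ^ 7 * Cc)) := H.kC
    _ ≤ Real.exp (∑ c ∈ (cons mem e).filter (fun c => isP c = false),
        (-(2 * 10 ^ 7 * (1 / (n + 1 : ℝ)) ^ ((mem c).card - 1)))) := by
        apply Real.exp_le_exp.2
        rw [Finset.sum_neg_distrib, ← Finset.mul_sum]
        have := H.csum e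
        linarith
    _ ≤ _ := by
        rw [Real.exp_sum]
        apply Finset.prod_le_prod
        · intro c _; positivity
        · intro c hc
          simp only [Finset.mem_filter, mem_cons] at hc
          exact (NBc_ok H k hk c hc.2 e hc.1).2.2

lemma pad_ok (H : Hyp mem isP κ n r K Cc) (k : ℕ) (hk : k < K) (e : E) (o : Option C) :
    0 ≤ padF mem isP κ n r K k e o ∧ padF mem isP κ n r K k e o ≤ 1 := by
  have hk0 := H.k0
  rcases o with _ | c
  · have := prod_NBc H k hk.le e
    simp only [padF]
    exact ⟨div_nonneg hk0.le (by linarith), (div_le_one (by linarith)).2 this⟩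
  · simp only [padF]
    have hK4 : 4 ≤ K := by have := H.hK; omega
    have := bs_bound (n := n) (r := r) H.k0.le H.k1 hK4 k hk.le
    split_ifs
    · exact ⟨pow_nonneg (by linarith) _, pow_le_one₀ (by linarith) (by linarith)⟩
    · norm_num

lemma factor_eq (H : Hyp mem isP κ n r K Cc) (k : ℕ) (hk : k < K) (e : E) (c : C) (he : e ∈ mem c)
    (X : E → C → ℝ)
    (hX : ∀ e', e' ∈ mem c → X e' c = if isP c then bs κ n r K k - 1 / K else YY mem κ n r K k e' c) :
    padF mem isP κ n r K k e (some c) * NB mem isP c e (fun e' => 1 / K + X e' c) =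
      if isP c then qs κ n r K k else NBc mem K (YY mem κ n r K k) c e := by
  simp only [padF, NB]
  by_cases hc : isP c = true
  · simp only [hc, if_true] at hX ⊢
    have : ∏ e' ∈ (mem c).erase e, (1 - (1 / K + X e' c)) =
        (1 - bs κ n r K k) ^ ((mem c).card - 1) := by
      rw [← Finset.card_erase_of_mem he, ← Finset.prod_const]
      refine Finset.prod_congr rfl fun e' he' => ?_
      rw [hX e' (Finset.mem_of_mem_erase he')]; ring
    rw [this, ← pow_add, qs]
    congr 1
    have := H.pcard c hc
    have : 0 < (mem c).card := Finset.card_pos.2 ⟨e, he⟩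
    omega
  · simp only [hc, Bool.false_eq_true, if_false, one_mul] at hX ⊢
    simp only [NBc]
    congr 1
    refine Finset.prod_congr rfl fun e' he' => ?_
    rw [hX e' (Finset.mem_of_mem_erase he')]

lemma prod_factor (H : Hyp mem isP κ n r K Cc) (k : ℕ) (hk : k < K) (e : E) :
    padF mem isP κ n r K k e none * ∏ c ∈ cons mem e,
      (if isP c = true then qs κ n r K k else NBc mem K (YY mem κ n r K k) c e) =
    κ * qs κ n r K k ^ r := by
  have hpos : 0 < ∏ c ∈ (cons mem e).filter (fun c => isP c = false),
      NBc mem K (YY mem κ n r K k) c e := lt_of_lt_of_le H.k0 (prod_NBc H k hk.le e)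
  rw [Finset.prod_ite, Finset.prod_const, H.preg e]
  simp only [padF, Bool.not_eq_true]
  field_simp

lemma BL_num (H : Hyp mem isP κ n r K Cc) (k : ℕ) (hk : k ≤ K) : ∀ e c, e ∈ mem c →
    BL mem isP (padF mem isP κ n r K) (fun _ _ => 1 / K) k e c =
      if isP c then bs κ n r K k - 1 / K else YY mem κ n r K k e c := by
  have hK4 : 4 ≤ K := by have := H.hK; omega
  induction k with
  | zero => intro e c _; simp [BL, bs, YY]
  | succ k ih =>
    have ih := ih (by omega)
    intro e c hec
    have hq := (qs_bound (n := n) (r := r) H.k0.le H.k1 hK4 k (by omega)).1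
    have hfac := prod_factor H k (by omega) e
    rw [← Finset.mul_prod_erase _ _ (mem_cons.2 hec)] at hfac
    have hst : step mem isP (padF mem isP κ n r K k) (fun _ => 1 / K)
        (BL mem isP (padF mem isP κ n r K) (fun _ _ => 1 / K) k) ((cons mem e).erase c) e =
        padF mem isP κ n r K k e none * ∏ c ∈ (cons mem e).erase c,
      (if isP c = true then qs κ n r K k else NBc mem K (YY mem κ n r K k) c e) := by
      unfold step
      congr 1
      refine Finset.prod_congr rfl fun c' hc' => ?_
      exact factor_eq H k (by omega) e c' (mem_cons.1 (Finset.mem_of_mem_erase hc')) _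
        (fun e' he' => ih e' c' he')
    simp only [BL]
    rw [hst, ih e c hec]
    set P := padF mem isP κ n r K k e none * ∏ c ∈ (cons mem e).erase c,
      (if isP c = true then qs κ n r K k else NBc mem K (YY mem κ n r K k) c e)
    by_cases hc : isP c = true
    · simp only [hc, if_true] at hfac ⊢
      have : P * qs κ n r K k = κ * qs κ n r K k ^ r := by rw [← hfac]; ring
      have h2 : P = κ * qs κ n r K k ^ (r - 1) := by
        have e1 : qs κ n r K k ^ r = qs κ n r K k ^ (r - 1) * qs κ n r K k := by
          rw [← pow_succ]; congr 1; have := H.r1; omega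
        rw [e1, ← mul_assoc] at this
        exact mul_right_cancel₀ hq.ne' this
      rw [h2, bs_succ]; ring
    · have hc' : isP c = false := by simpa using hc
      simp only [hc', Bool.false_eq_true, if_false] at hfac ⊢
      have hN := (NBc_ok H k (by omega) c hc' e hec).1
      have : P * NBc mem K (YY mem κ n r K k) c e = κ * qs κ n r K k ^ r := by rw [← hfac]; ring
      have h2 : P = κ * qs κ n r K k ^ r / NBc mem K (YY mem κ n r K k) c e := by
        rw [eq_div_iff (by linarith)]; exact this
      rw [h2]; simp only [YY]

lemma full_num (H : Hyp mem isP κ n r K Cc) (k : ℕ) (hk : k < K) (e : E) :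
    full mem isP (padF mem isP κ n r K) (fun _ _ => 1 / K) k e = κ * qs κ n r K k ^ r := by
  rw [← prod_factor H k hk e]
  unfold full step
  congr 1
  refine Finset.prod_congr rfl fun c' hc' => ?_
  exact factor_eq H k hk e c' (mem_cons.1 hc') _ (fun e' he' => BL_num H k hk.le e' c' he')

end Pads

/-- Core nibble theorem. -/
theorem core (r : ℕ) (hr : 1 ≤ r) (Cc η : ℝ) (hη : 0 < η) (hη1 : η < 1) :
    ∃ D0 : ℕ, ∀ D ≥ D0, ∃ K : ℕ, ∀ (E C : Type) [Fintype E] [DecidableEq E] [Fintype C]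
      [DecidableEq C] (mem : C → Finset E) (isP : C → Bool) (T : ℕ → E → C → Set E),
      TreeLike mem K T → (∀ c, isP c = true → (mem c).card ≤ D) →
      (∀ e, ((cons mem e).filter fun c => isP c = true).card = r) →
      (∀ c, isP c = false → (mem c).Nonempty → 2 ≤ (mem c).card ∧ (mem c).card ≤ 8) →
      (∀ e, ∑ c ∈ (cons mem e).filter (fun c => isP c = false),
        (1 / (D : ℝ)) ^ ((mem c).card - 1) ≤ Cc) →
      ∃ M : Finset E, (∀ c, isP c = true → ∀ e ∈ M, ∀ e' ∈ M, e ∈ mem c → e' ∈ mem c → e = e') ∧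
        (∀ c, isP c = false → (mem c).Nonempty → ¬ mem c ⊆ M) ∧
        (1 - η) * Fintype.card E / D ≤ M.card := by
  set κ := min (min (1 / 4) (η / 8)) (Real.exp (-(2 * 10 ^ 7 * Cc))) with hκ
  have k0 : 0 < κ := lt_min (lt_min (by norm_num) (by positivity)) (Real.exp_pos _)
  have k1 : κ ≤ 1 / 4 := (min_le_left _ _).trans (min_le_left _ _)
  have k2 : κ ≤ η / 8 := (min_le_left _ _).trans (min_le_right _ _)
  have k3 : κ ≤ Real.exp (-(2 * 10 ^ 7 * Cc)) := min_le_right _ _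
  obtain ⟨D0, hD0⟩ := seq_final η hη hη1 k0 k1 k2 r hr
  refine ⟨max D0 25, fun D hD => ?_⟩
  obtain ⟨K0, hK0⟩ := hD0 D (le_trans (le_max_left _ _) hD)
  have hD25 : 25 ≤ D := le_trans (le_max_right _ _) hD
  refine ⟨max K0 (4 * D), ?_⟩
  intro E C _ _ _ _ mem isP T hT hp hpr hc hcs
  set K := max K0 (4 * D)
  have H : Hyp mem isP κ (D - 1) r K Cc := by
    refine ⟨hr, by omega, k0, k1, k3, ?_, ?_, hpr, hc, ?_⟩
    · have : 4 * D ≤ K := le_max_right _ _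
      omega
    · intro c h; have := hp c h; omega
    · intro e
      have : ((D - 1 : ℕ) : ℝ) + 1 = D := by
        have : D - 1 + 1 = D := by omega
        exact_mod_cast this
      rw [this]; exact hcs e
  have hKpos : 0 < K := by have := H.hK; omega
  obtain ⟨M, h1, h2, h3⟩ := exists_matching (isP := isP) hKpos (padF mem isP κ (D - 1) r K)
    (fun k hk e o => pad_ok H k hk e o) hT
  refine ⟨M, h1, h2, le_trans ?_ h3⟩
  have e1 : ∀ e : E, ∑ k ∈ Finset.range K, 1 / (K : ℝ) *
      full mem isP (padF mem isP κ (D - 1) r K) (fun _ _ => 1 / (K : ℝ)) k e =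
      ∑ j ∈ Finset.range K, κ * qs κ (D - 1) r K j ^ r / K := by
    intro e
    refine Finset.sum_congr rfl fun k hk => ?_
    rw [full_num H k (Finset.mem_range.1 hk) e]; ring
  rw [Finset.sum_congr rfl fun e _ => e1 e]
  rw [Finset.sum_const, Finset.card_univ, nsmul_eq_mul]
  have := hK0 K (le_max_left _ _)
  calc (1 - η) * Fintype.card E / D = Fintype.card E * ((1 - η) / D) := by ring
    _ ≤ _ := mul_le_mul_of_nonneg_left this (by positivity)
end BES

set_option linter.unusedSectionVars false
namespace BES
section Tight
variable {E X : Type*} [Fintype E] [DecidableEq E] [DecidableEq X]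

/-- system of blocks -/
def vv (V : E → Finset X) (A : Finset E) : ℕ := (A.biUnion V).card

def Sparse (V : E → Finset X) (N s0 : ℕ) : Prop :=
  ∀ A : Finset E, A.Nonempty → A.card ≤ s0 → N * A.card + 2 ≤ vv V A + 2 * A.card

def Tight (V : E → Finset X) (N : ℕ) (A : Finset E) : Prop :=
  A.Nonempty ∧ vv V A + 2 * A.card ≤ N * A.card + 2

lemma tight_union {V : E → Finset X} {N s0 : ℕ} (hS : Sparse V N s0) {A B : Finset E}
    (hA : Tight V N A) (hB : Tight V N B) (hAB : (A ∩ B).Nonempty) (hs : (A ∪ B).card ≤ s0) :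
    Tight V N (A ∪ B) ∧ Tight V N (A ∩ B) ∧
      A.biUnion V ∩ B.biUnion V = (A ∩ B).biUnion V := by
  have h1 := Finset.card_union_add_card_inter A B
  have h2 := Finset.card_union_add_card_inter (A.biUnion V) (B.biUnion V)
  have hsub : (A ∩ B).biUnion V ⊆ A.biUnion V ∩ B.biUnion V := by
    intro x
    simp only [Finset.mem_biUnion, Finset.mem_inter]
    rintro ⟨e, ⟨h1, h2⟩, h3⟩
    exact ⟨⟨e, h1, h3⟩, ⟨e, h2, h3⟩⟩
  have hsub' := Finset.card_le_card hsub
  have hu : vv V (A ∪ B) = (A.biUnion V ∪ B.biUnion V).card := by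
    rw [vv, Finset.union_biUnion]
  have s1 := hS (A ∪ B) (hA.1.mono Finset.subset_union_left) hs
  have s2 := hS (A ∩ B) hAB (le_trans (Finset.card_le_card
    (Finset.inter_subset_left.trans Finset.subset_union_left)) hs)
  have h4 : N * (A ∪ B).card + N * (A ∩ B).card = N * A.card + N * B.card := by
    rw [← mul_add, h1, mul_add]
  have hA2 := hA.2
  have hB2 := hB.2
  unfold vv at *
  refine ⟨⟨hA.1.mono Finset.subset_union_left, ?_⟩, ⟨hAB, ?_⟩, ?_⟩
  · unfold vv; omega
  · unfold vv; omega
  · exact (Finset.eq_of_subset_of_card_le hsub (by omega)).symm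

/-- conflicts: minimal tight sets of at least three blocks -/
def Conf (V : E → Finset X) (N : ℕ) (c : Finset E) : Prop :=
  3 ≤ c.card ∧ c.card ≤ 8 ∧ Tight V N c ∧ ∀ A ⊆ c, 2 ≤ A.card → Tight V N A → A = c

open Classical in
noncomputable def cmem (V : E → Finset X) (N : ℕ) (Jp : E → Finset (Finset X)) :
    Finset X ⊕ Finset E → Finset E
  | .inl π => Finset.univ.filter fun e => π ∈ Jp e
  | .inr c => if Conf V N c then c else ∅

structure Sys (V : E → Finset X) (N s0 D : ℕ) (Jp : E → Finset (Finset X)) : Prop where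
  card : ∀ e, (V e).card = N
  sparse : Sparse V N s0
  jcard : ∀ e, ∀ π ∈ Jp e, π.card = 2
  jsub : ∀ e, ∀ π ∈ Jp e, π ⊆ V e
  closed : ∀ e e' π, π ∈ Jp e → π ⊆ V e' → π ∈ Jp e'
  deg : ∀ π, (cmem V N Jp (.inl π)).card ≤ D

variable {V : E → Finset X} {N s0 D : ℕ} {Jp : E → Finset (Finset X)}

lemma cmem_inl {π : Finset X} {e : E} : e ∈ cmem V N Jp (.inl π) ↔ π ∈ Jp e := by simp [cmem]

lemma cmem_inr {c : Finset E} {e : E} (h : e ∈ cmem V N Jp (.inr c)) :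
    Conf V N c ∧ cmem V N Jp (.inr c) = c := by
  simp only [cmem] at h ⊢
  split_ifs at h ⊢ with h1
  · exact ⟨h1, rfl⟩
  · simp at h

lemma cmem_card (H : Sys V N s0 D Jp) (hD : 8 ≤ D) (c) : (cmem V N Jp c).card ≤ D := by
  rcases c with π | c
  · exact H.deg π
  · simp only [cmem]
    split_ifs with h
    · exact h.2.1.trans hD
    · simp

lemma tight_of_common (H : Sys V N s0 D Jp) (hN : 2 ≤ N) (A : Finset E) (hA : A.Nonempty)
    (π : Finset X) (hπ : π.card = 2) (h : ∀ e ∈ A, π ⊆ V e) : Tight V N A := by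
  refine ⟨hA, ?_⟩
  have h1 : A.biUnion V ⊆ π ∪ A.biUnion (fun e => V e \ π) := by
    intro x
    simp only [Finset.mem_union, Finset.mem_biUnion, Finset.mem_sdiff]
    rintro ⟨e, he, hx⟩
    by_cases hxπ : x ∈ π
    · exact Or.inl hxπ
    · exact Or.inr ⟨e, he, hx, hxπ⟩
  have h2 : (A.biUnion (fun e => V e \ π)).card ≤ A.card * (N - 2) := by
    apply Finset.card_biUnion_le_card_mul
    intro e he
    rw [Finset.card_sdiff_of_subset (h e he), H.card, hπ]
  have h3 := (Finset.card_le_card h1).trans (Finset.card_union_le _ _)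
  have h4 : A.card * (N - 2) + 2 * A.card = N * A.card := by
    have : N = N - 2 + 2 := by omega
    conv_rhs => rw [this]
    ring
  unfold vv
  omega

lemma cmem_tight (H : Sys V N s0 D Jp) (hN : 2 ≤ N) (c) (hc : (cmem V N Jp c).Nonempty) :
    Tight V N (cmem V N Jp c) := by
  obtain ⟨e, he⟩ := hc
  rcases c with π | c
  · exact tight_of_common H hN _ ⟨e, he⟩ π (H.jcard e π (cmem_inl.1 he))
      (fun e' he' => H.jsub e' π (cmem_inl.1 he'))
  · obtain ⟨h1, h2⟩ := cmem_inr he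
    rw [h2]; exact h1.2.2.1

lemma share_pair (H : Sys V N s0 D Jp) (hs0 : 2 ≤ s0) {x y : E} (hxy : x ≠ y) :
    (V x ∩ V y).card ≤ 2 := by
  have h1 := H.sparse {x, y} ⟨x, by simp⟩ (by rw [Finset.card_pair hxy]; exact hs0)
  rw [Finset.card_pair hxy] at h1
  have h2 := Finset.card_union_add_card_inter (V x) (V y)
  rw [H.card, H.card] at h2
  have h3 : vv V {x, y} = (V x ∪ V y).card := by simp [vv, Finset.biUnion_insert]
  omega

/-- two distinct constraints share at most one block -/
lemma share_one (H : Sys V N s0 D Jp) (hN : 2 ≤ N) (hs0 : 16 ≤ s0) {c d : Finset X ⊕ Finset E}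
    {x y : E} (hxy : x ≠ y) (hxc : x ∈ cmem V N Jp c) (hyc : y ∈ cmem V N Jp c)
    (hxd : x ∈ cmem V N Jp d) (hyd : y ∈ cmem V N Jp d) : c = d := by
  have pc : ∀ (π : Finset X) (d : Finset E), x ∈ cmem V N Jp (.inl π) → y ∈ cmem V N Jp (.inl π) →
      x ∈ cmem V N Jp (.inr d) → y ∈ cmem V N Jp (.inr d) → False := by
    intro π d h1 h2 h3 h4
    have ht := tight_of_common H hN {x, y} ⟨x, by simp⟩ π (H.jcard x π (cmem_inl.1 h1)) (by
      intro e he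
      rcases Finset.mem_insert.1 he with rfl | he
      · exact H.jsub _ π (cmem_inl.1 h1)
      · rw [Finset.mem_singleton.1 he]; exact H.jsub _ π (cmem_inl.1 h2))
    obtain ⟨hc, he⟩ := cmem_inr h3
    rw [he] at h3 h4
    have := hc.2.2.2 {x, y} (by
      intro e he
      rcases Finset.mem_insert.1 he with rfl | he
      · exact h3
      · rw [Finset.mem_singleton.1 he]; exact h4) (by rw [Finset.card_pair hxy]) ht
    have h5 := hc.1
    rw [← this, Finset.card_pair hxy] at h5
    omega
  rcases c with π | c <;> rcases d with ρ | d
  · congr 1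
    by_contra hne
    have h1 := H.jcard x π (cmem_inl.1 hxc)
    have h2 := H.jcard x ρ (cmem_inl.1 hxd)
    have h3 : π ∪ ρ ⊆ V x ∩ V y := by
      apply Finset.union_subset <;> apply Finset.subset_inter
      · exact H.jsub _ _ (cmem_inl.1 hxc)
      · exact H.jsub _ _ (cmem_inl.1 hyc)
      · exact H.jsub _ _ (cmem_inl.1 hxd)
      · exact H.jsub _ _ (cmem_inl.1 hyd)
    have h4 := (Finset.card_le_card h3).trans (share_pair H (by omega) hxy)
    apply hne
    have h5 : π = π ∪ ρ := Finset.eq_of_subset_of_card_le Finset.subset_union_left (by omega)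
    have h6 : ρ = π ∪ ρ := Finset.eq_of_subset_of_card_le Finset.subset_union_right (by omega)
    rw [h5, ← h6]
  · exact (pc π d hxc hyc hxd hyd).elim
  · exact (pc ρ c hxd hyd hxc hyc).elim
  · congr 1
    obtain ⟨hc, he⟩ := cmem_inr hxc
    obtain ⟨hd, he'⟩ := cmem_inr hxd
    rw [he] at hxc hyc
    rw [he'] at hxd hyd
    have hu : (c ∪ d).card ≤ s0 := by
      have := Finset.card_union_le c d
      have := hc.2.1
      have := hd.2.1
      omega
    have ht := (tight_union H.sparse hc.2.2.1 hd.2.2.1 ⟨x, Finset.mem_inter.2 ⟨hxc, hxd⟩⟩ hu).2.1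
    have h2 : 2 ≤ (c ∩ d).card := by
      rw [← Finset.card_pair hxy]
      apply Finset.card_le_card
      intro e he
      rcases Finset.mem_insert.1 he with rfl | he
      · exact Finset.mem_inter.2 ⟨hxc, hxd⟩
      · rw [Finset.mem_singleton.1 he]; exact Finset.mem_inter.2 ⟨hyc, hyd⟩
    rw [← hc.2.2.2 _ Finset.inter_subset_left h2 ht]
    exact hd.2.2.2 _ Finset.inter_subset_right h2 ht

/-- invariants of a tree-like union of constraints -/
structure Inv (V : E → Finset X) (N : ℕ) (Jp : E → Finset (Finset X))
    (F : Set (Finset X ⊕ Finset E)) (U : Finset E) : Prop where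
  tight : Tight V N U
  sub : ∀ c ∈ F, cmem V N Jp c ⊆ U
  two : ∀ c, ∀ x ∈ U, ∀ y ∈ U, x ≠ y → x ∈ cmem V N Jp c → y ∈ cmem V N Jp c → c ∈ F

lemma inv_single (H : Sys V N s0 D Jp) (hN : 2 ≤ N) (hs0 : 16 ≤ s0) (c)
    (hc : (cmem V N Jp c).Nonempty) : Inv V N Jp {c} (cmem V N Jp c) := by
  refine ⟨cmem_tight H hN c hc, ?_, ?_⟩
  · intro d hd; rw [Set.mem_singleton_iff.1 hd]
  · intro d x hx y hy hxy hxd hyd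
    exact share_one H hN hs0 hxy hxd hyd hx hy

lemma inv_inter {F : Set (Finset X ⊕ Finset E)} {U : Finset E} (h : Inv V N Jp F U) {c} (hc : c ∉ F)
    {x : E} (hx : x ∈ U) (hxc : x ∈ cmem V N Jp c) : ∀ y ∈ cmem V N Jp c, y ∈ U → y = x := by
  intro y hy hyU
  by_contra hne
  exact hc (h.two c y hyU x hx hne hy hxc)

lemma inv_attach (H : Sys V N s0 D Jp) (hN : 2 ≤ N) (hD : 8 ≤ D) (hs0 : 16 ≤ s0)
    {F : Set (Finset X ⊕ Finset E)}
    {U : Finset E} (h : Inv V N Jp F U) {c} (hc : c ∉ F) {x : E} (hx : x ∈ U)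
    (hxc : x ∈ cmem V N Jp c) (hs : U.card + 2 * D ≤ s0) :
    Inv V N Jp (insert c F) (U ∪ cmem V N Jp c) := by
  have hinter := inv_inter h hc hx hxc
  have hcc := cmem_card H hD c
  have hu := Finset.card_union_le U (cmem V N Jp c)
  have hne : (U ∩ cmem V N Jp c).Nonempty := ⟨x, Finset.mem_inter.2 ⟨hx, hxc⟩⟩
  obtain ⟨t1, t2, t3⟩ := tight_union H.sparse h.tight (cmem_tight H hN c ⟨x, hxc⟩) hne (by omega)
  have hsing : U ∩ cmem V N Jp c = {x} := by
    ext y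
    simp only [Finset.mem_inter, Finset.mem_singleton]
    exact ⟨fun hy => hinter y hy.2 hy.1, fun hy => hy ▸ ⟨hx, hxc⟩⟩
  rw [hsing, Finset.singleton_biUnion] at t3
  refine ⟨t1, ?_, ?_⟩
  · rintro d (rfl | hd)
    · exact Finset.subset_union_right
    · exact (h.sub d hd).trans Finset.subset_union_left
  · have key : ∀ d, ∀ y ∈ U, ∀ z ∈ cmem V N Jp c, y ≠ z → y ∈ cmem V N Jp d →
        z ∈ cmem V N Jp d → d ∈ insert c F := by
      intro d y hy z hz hyz hyd hzd
      by_cases hyc : y ∈ cmem V N Jp c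
      · exact Or.inl (share_one H hN hs0 hyz hyd hzd hyc hz)
      by_cases hzU : z ∈ U
      · exact Or.inr (h.two d y hy z hzU hyz hyd hzd)
      have hxz : x ≠ z := by rintro rfl; exact hzU hx
      rcases d with π | d
      · have h1 : π ⊆ V x := by
          rw [← t3]
          apply Finset.subset_inter
          · exact (H.jsub y π (cmem_inl.1 hyd)).trans (Finset.subset_biUnion_of_mem V hy)
          · exact (H.jsub z π (cmem_inl.1 hzd)).trans (Finset.subset_biUnion_of_mem V hz)
        have h2 := H.closed y x π (cmem_inl.1 hyd) h1
        exact Or.inl (share_one H hN hs0 hxz (cmem_inl.2 h2) hzd hxc hz)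
      · exfalso
        obtain ⟨hd, he⟩ := cmem_inr hyd
        rw [he] at hyd hzd
        have hd8 := hd.2.1
        have a1 := tight_union H.sparse hd.2.2.1 t1 ⟨y, Finset.mem_inter.2
          ⟨hyd, Finset.mem_union_left _ hy⟩⟩ (by
            have := Finset.card_union_le d (U ∪ cmem V N Jp c); omega)
        have a2 := tight_union H.sparse hd.2.2.1 h.tight ⟨y, Finset.mem_inter.2 ⟨hyd, hy⟩⟩ (by
            have := Finset.card_union_le d U; omega)
        have a3 := tight_union H.sparse hd.2.2.1 (cmem_tight H hN c ⟨x, hxc⟩)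
          ⟨z, Finset.mem_inter.2 ⟨hzd, hz⟩⟩ (by
            have := Finset.card_union_le d (cmem V N Jp c); omega)
        have b1 : d ∩ (U ∪ cmem V N Jp c) = d := by
          apply hd.2.2.2 _ Finset.inter_subset_left _ a1.2.1
          rw [← Finset.card_pair hyz]
          apply Finset.card_le_card
          intro e he
          rcases Finset.mem_insert.1 he with rfl | he
          · exact Finset.mem_inter.2 ⟨hyd, Finset.mem_union_left _ hy⟩
          · rw [Finset.mem_singleton.1 he]
            exact Finset.mem_inter.2 ⟨hzd, Finset.mem_union_right _ hz⟩
        have b2 : (d ∩ U).card < 2 := by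
          by_contra hcon
          have := hd.2.2.2 _ Finset.inter_subset_left (by omega) a2.2.1
          rw [← this] at hzd
          exact hzU (Finset.mem_inter.1 hzd).2
        have b3 : (d ∩ cmem V N Jp c).card < 2 := by
          by_contra hcon
          have := hd.2.2.2 _ Finset.inter_subset_left (by omega) a3.2.1
          rw [← this] at hyd
          exact hyc (Finset.mem_inter.1 hyd).2
        rw [Finset.inter_union_distrib_left] at b1
        have b4 := Finset.card_union_le (d ∩ U) (d ∩ cmem V N Jp c)
        rw [b1] at b4
        have := hd.1
        omega
    intro d y hy z hz hyz hyd hzd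
    rcases Finset.mem_union.1 hy with hy | hy <;> rcases Finset.mem_union.1 hz with hz | hz
    · exact Or.inr (h.two d y hy z hz hyz hyd hzd)
    · exact key d y hy z hz hyz hyd hzd
    · exact key d z hz y hy hyz.symm hzd hyd
    · exact Or.inl (share_one H hN hs0 hyz hyd hzd hy hz)

/-- non-backtracking neighbourhoods -/
def TT (mem : Finset X ⊕ Finset E → Finset E) : ℕ → E → (Finset X ⊕ Finset E) → Set E
  | 0 => fun e _ => {e}
  | n + 1 => fun e c => {e} ∪ {g | ∃ c' e', c' ≠ c ∧ e ∈ mem c' ∧ e' ∈ mem c' ∧ e' ≠ e ∧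
      g ∈ TT mem n e' c'}

lemma run (H : Sys V N s0 D Jp) (hN : 2 ≤ N) (hD : 8 ≤ D) (hs0 : 16 ≤ s0) (n : ℕ) :
    ∀ (F : Set (Finset X ⊕ Finset E)) (U : Finset E) (x : E) (c : Finset X ⊕ Finset E) (g : E),
    Inv V N Jp F U → x ∈ U →
    (∀ c1, c1 ≠ c → x ∈ cmem V N Jp c1 → c1 ∉ F) → U.card + (n + 2) * D ≤ s0 →
    g ∈ TT (cmem V N Jp) n x c →
    ∃ F1 U1, F ⊆ F1 ∧ U ⊆ U1 ∧ Inv V N Jp F1 U1 ∧ g ∈ U1 ∧ (g = x ∨ g ∉ U) ∧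
      U1.card ≤ U.card + n * D ∧ ∀ d ∈ F1, d ∉ F → ∀ y ∈ cmem V N Jp d, y ∈ U → y = x := by
  induction n with
  | zero =>
    intro F U x c g hI hx hc hs hg
    have : g = x := hg
    subst this
    exact ⟨F, U, subset_rfl, subset_rfl, hI, hx, Or.inl rfl, by simp, fun d h1 h2 => absurd h1 h2⟩
  | succ n ih =>
    intro F U x c g hI hx hc hs hg
    rcases hg with hg | ⟨c', e', hcc, hxc, hec, hne, hg⟩
    · have : g = x := hg
      subst this
      exact ⟨F, U, subset_rfl, subset_rfl, hI, hx, Or.inl rfl, by omega,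
        fun d h1 h2 => absurd h1 h2⟩
    · have hc'F := hc c' hcc hxc
      have hinter := inv_inter hI hc'F hx hxc
      have hs2 : U.card + 2 * D ≤ s0 := by nlinarith
      have hI' := inv_attach H hN hD hs0 hI hc'F hx hxc hs2
      have he'U : e' ∉ U := fun h => hne (hinter e' hec h)
      have hcard : (U ∪ cmem V N Jp c').card ≤ U.card + D :=
        (Finset.card_union_le _ _).trans (by have := cmem_card H hD c'; omega)
      obtain ⟨F1, U1, a1, a2, a3, a4, a5, a6, a7⟩ := ih (insert c' F) (U ∪ cmem V N Jp c') e' c' g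
        hI' (Finset.mem_union_right _ hec) (by
          intro c1 hne1 hc1 hmem
          rcases hmem with h | h
          · exact hne1 h
          · exact he'U (hI.sub c1 h hc1)) (by
          have : (n + 1 + 2) * D = (n + 2) * D + D := by ring
          omega) hg
      refine ⟨F1, U1, (Set.subset_insert _ _).trans a1, Finset.subset_union_left.trans a2, a3, a4,
        ?_, ?_, ?_⟩
      · right
        rcases a5 with rfl | h
        · exact he'U
        · exact fun hgU => h (Finset.mem_union_left _ hgU)
      · have : (n + 1) * D = n * D + D := by ring
        omega
      · intro d hd hdF y hy hyU
        by_cases hdc : d = c'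
        · subst hdc; exact hinter y hy hyU
        · have := a7 d hd (by rintro (h | h); exacts [hdc h, hdF h]) y hy
            (Finset.mem_union_left _ hyU)
          subst this
          exact absurd hyU he'U

theorem treeLike (H : Sys V N s0 D Jp) (hN : 2 ≤ N) (hD : 8 ≤ D) (K : ℕ)
    (hs : (2 * K + 8) * D ≤ s0) : TreeLike (cmem V N Jp) K (TT (cmem V N Jp)) := by
  have hs0 : 16 ≤ s0 := by nlinarith
  have hself : ∀ n e c, e ∈ TT (cmem V N Jp) n e c := by
    intro n e c
    cases n with
    | zero => rfl
    | succ n => exact Or.inl rfl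
  have hb : ∀ n, n < K → ∀ m, m ≤ 2 * D + n * D → m + (n + 2) * D ≤ s0 := by
    intro n hn m hm
    have h2 : (2 * n + 4) * D ≤ (2 * K + 8) * D := Nat.mul_le_mul_right _ (by omega)
    nlinarith
  refine ⟨hself, ?_, ?_, ?_, ?_⟩
  · intro n
    induction n with
    | zero =>
      intro e c g hg
      exact Or.inl hg
    | succ n ih =>
      intro e c g hg
      rcases hg with hg | ⟨c', e', h1, h2, h3, h4, h5⟩
      · exact Or.inl hg
      · exact Or.inr ⟨c', e', h1, h2, h3, h4, ih e' c' h5⟩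
  · intro n e c c' e' _ hec hec' hcc he' hne g hg
    exact Or.inr ⟨c', e', hcc.symm, hec', he', hne, hg⟩
  · intro n e c' e' hn he he' hne hmem
    have hcard := cmem_card H hD c'
    obtain ⟨F1, U1, -, -, -, -, h, -⟩ := run H hN hD hs0 n {c'} (cmem V N Jp c') e' c' e
      (inv_single H hN hs0 c' ⟨e, he⟩) he' (fun c1 h _ h' => h h') (hb n hn _ (by omega)) hmem
    rcases h with h | h
    · exact hne h.symm
    · exact h he
  · intro n e c' c'' e' e'' hn hec' hec'' he' he'' hne' hne'' hor
    rw [Set.disjoint_left]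
    intro g hg hg'
    have hcard := cmem_card H hD c'
    have hcard'' := cmem_card H hD c''
    -- common argument
    have main : ∀ (F : Set (Finset X ⊕ Finset E)) (U : Finset E), Inv V N Jp F U → U.card ≤ 2 * D →
        e' ∈ U → e'' ∈ U → e' ≠ e'' →
        (∀ c1, c1 ≠ c' → e' ∈ cmem V N Jp c1 → c1 ∉ F) →
        (∀ c1, c1 ≠ c'' → e'' ∈ cmem V N Jp c1 → c1 ∉ F) → False := by
      intro F U hI hU h1 h2 hee h3 h4
      obtain ⟨F1, U1, a1, a2, a3, a4, a5, a6, a7⟩ := run H hN hD hs0 n F U e' c' g hI h1 h3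
        (hb n hn _ (by omega)) hg
      obtain ⟨F2, U2, -, -, -, -, b5, -⟩ := run H hN hD hs0 n F1 U1 e'' c'' g a3 (a2 h2) (by
        intro c1 hc1 hm hF1
        exact hee (a7 c1 hF1 (h4 c1 hc1 hm) e'' hm h2).symm) (hb n hn _ (by omega)) hg'
      rcases b5 with rfl | h
      · rcases a5 with h | h
        · exact hee h.symm
        · exact h h2
      · exact h a4
    by_cases hcc : c' = c''
    · subst hcc
      exact main {c'} _ (inv_single H hN hs0 c' ⟨e, hec'⟩) (by omega) he' he''
        (hor.resolve_left (by simp)) (fun c1 h _ h' => h h') (fun c1 h _ h' => h h')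
    · have hI := inv_single H hN hs0 c' ⟨e, hec'⟩
      have hc''F : c'' ∉ ({c'} : Set (Finset X ⊕ Finset E)) := fun h => hcc h.symm
      have hinter := inv_inter hI hc''F hec' hec''
      have hDs : D + 2 * D ≤ s0 := by nlinarith
      have hI2 := inv_attach H hN hD hs0 hI hc''F hec' hec'' (by omega)
      refine main _ _ hI2 ((Finset.card_union_le _ _).trans (by omega))
        (Finset.mem_union_left _ he') (Finset.mem_union_right _ he'') ?_ ?_ ?_
      · rintro rfl; exact hne'' (hinter e' he'' he')
      · rintro c1 h1 h2 (h3 | h3)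
        · subst h3; exact hne' (hinter e' h2 he')
        · exact h1 h3
      · rintro c1 h1 h2 (h3 | h3)
        · exact h1 h3
        · have : c1 = c' := h3
          subst this
          exact hne'' (hinter e'' he'' h2)
end Tight
end BES

set_option linter.unusedSectionVars false
namespace BES
section Template
abbrev Tv (m : ℕ) := Option (Fin m ⊕ (Fin m ⊕ ((Fin m × Fin m) ⊕ (Fin m × Fin m))))
abbrev IX (m : ℕ) := (Fin m × Fin m) × Fin 3

variable {m : ℕ}
abbrev tf : Tv m := none
abbrev tb (i : Fin m) : Tv m := some (.inl i)
abbrev tc (i : Fin m) : Tv m := some (.inr (.inl i))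
abbrev ta (p : Fin m × Fin m) : Tv m := some (.inr (.inr (.inl p)))
abbrev td (p : Fin m × Fin m) : Tv m := some (.inr (.inr (.inr p)))

def tedge (x : IX m) : Finset (Tv m) :=
  if x.2 = 0 then {ta x.1, tb x.1.1, tc x.1.2}
  else if x.2 = 1 then {td x.1, tb x.1.1, tc x.1.2}
  else {ta x.1, td x.1, tf}

/-- vertices of an object -/
def ov (p : Fin m × Fin m) : Fin 5 → Tv m := ![tf, tb p.1, tc p.2, ta p, td p]

def JJ (x y : Tv m) : Prop := x ≠ y ∧ ∃ p i j, x = ov p i ∧ y = ov p j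

lemma JJ_symm {x y : Tv m} (h : JJ x y) : JJ y x := by
  obtain ⟨h, p, i, j, h1, h2⟩ := h
  exact ⟨h.symm, p, j, i, h2, h1⟩

lemma ov_inj (p : Fin m × Fin m) : Function.Injective (ov p) := by
  intro i j h
  fin_cases i <;> fin_cases j <;> simp_all [ov]

lemma tedge_ov (x : IX m) : ∀ v ∈ tedge x, ∃ i, v = ov x.1 i := by
  intro v hv
  unfold tedge at hv
  split_ifs at hv <;> simp only [Finset.mem_insert, Finset.mem_singleton] at hv <;>
    rcases hv with rfl | rfl | rfl
  exacts [⟨3, rfl⟩, ⟨1, rfl⟩, ⟨2, rfl⟩, ⟨4, rfl⟩, ⟨1, rfl⟩, ⟨2, rfl⟩, ⟨3, rfl⟩, ⟨4, rfl⟩, ⟨0, rfl⟩]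

lemma tedge_card (x : IX m) : (tedge x).card = 3 := by
  unfold tedge
  split_ifs <;> rw [Finset.card_eq_three]
  · exact ⟨_, _, _, by simp, by simp, by simp, rfl⟩
  · exact ⟨_, _, _, by simp, by simp, by simp, rfl⟩
  · exact ⟨_, _, _, by simp, by simp, by simp, rfl⟩

lemma tedge_JJ (x : IX m) : ∀ u ∈ tedge x, ∀ v ∈ tedge x, u ≠ v → JJ u v := by
  intro u hu v hv h
  obtain ⟨i, hi⟩ := tedge_ov x u hu
  obtain ⟨j, hj⟩ := tedge_ov x v hv
  exact ⟨h, x.1, i, j, hi, hj⟩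

open Classical in
noncomputable def Jset (m : ℕ) : Finset (Tv m × Tv m) := Finset.univ.filter fun x => JJ x.1 x.2

lemma Jset_card : (Jset m).card ≤ 16 * m ^ 2 + 4 * m := by
  classical
  let P : Finset (Fin 5 × Fin 5) := Finset.univ.filter fun x => x.1 ≠ x.2 ∧
    x ≠ (0, 1) ∧ x ≠ (1, 0) ∧ x ≠ (0, 2) ∧ x ≠ (2, 0)
  have hP : P.card = 16 := by decide
  let A : Finset (Tv m × Tv m) := ((Finset.univ : Finset (Fin m × Fin m)) ×ˢ P).image
    fun x => (ov x.1 x.2.1, ov x.1 x.2.2)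
  have hA : A.card ≤ 16 * m ^ 2 := by
    refine Finset.card_image_le.trans ?_
    rw [Finset.card_product, hP]
    simp [pow_two, mul_comm]
  let g : Fin m × Fin 4 → Tv m × Tv m := fun x =>
    ![(tf, tb x.1), (tb x.1, tf), (tf, tc x.1), (tc x.1, tf)] x.2
  let B : Finset (Tv m × Tv m) := Finset.univ.image g
  have hB : B.card ≤ 4 * m := by
    refine Finset.card_image_le.trans ?_
    simp [mul_comm]
  have hsub : Jset m ⊆ A ∪ B := by
    rintro ⟨x, y⟩ hxy
    simp only [Jset, Finset.mem_filter, Finset.mem_univ, true_and] at hxy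
    obtain ⟨hne, p, i, j, rfl, rfl⟩ := hxy
    have hij : i ≠ j := fun h => hne (by rw [h])
    rw [Finset.mem_union]
    by_cases h : (i, j) ∈ P
    · left
      exact Finset.mem_image.2 ⟨(p, (i, j)), by simp [h], rfl⟩
    · right
      simp only [P, Finset.mem_filter, Finset.mem_univ, true_and, not_and, ne_eq] at h
      by_cases h1 : (i, j) = (0, 1)
      · simp only [Prod.mk.injEq] at h1; obtain ⟨rfl, rfl⟩ := h1
        exact Finset.mem_image.2 ⟨(p.1, 0), by simp, rfl⟩
      by_cases h2 : (i, j) = (1, 0)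
      · simp only [Prod.mk.injEq] at h2; obtain ⟨rfl, rfl⟩ := h2
        exact Finset.mem_image.2 ⟨(p.1, 1), by simp, rfl⟩
      by_cases h3 : (i, j) = (0, 2)
      · simp only [Prod.mk.injEq] at h3; obtain ⟨rfl, rfl⟩ := h3
        exact Finset.mem_image.2 ⟨(p.2, 2), by simp, rfl⟩
      by_cases h4 : (i, j) = (2, 0)
      · simp only [Prod.mk.injEq] at h4; obtain ⟨rfl, rfl⟩ := h4
        exact Finset.mem_image.2 ⟨(p.2, 3), by simp, rfl⟩
      exact absurd (h hij h1 h2 h3) (by simpa using h4)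
  have := (Finset.card_le_card hsub).trans (Finset.card_union_le _ _)
  omega

lemma span_aux (S : Finset (IX m)) (hS : S.Nonempty) (h8 : S.card ≤ 8) :
    S.card + 2 ≤ (S.biUnion tedge).card ∧ (S.card = 8 → 11 ≤ (S.biUnion tedge).card) ∧
    ((S.biUnion tedge).card ≤ S.card + 2 → S.card ≤ 4 → ∃ p, ∀ x ∈ S, x.1 = p) := by
  classical
  let Sx : Fin 3 → Finset (Fin m × Fin m) := fun t => Finset.univ.filter fun p => (p, t) ∈ S
  have hmem : ∀ p t, p ∈ Sx t ↔ (p, t) ∈ S := by intro p t; simp [Sx]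
  have hScard : S.card = (Sx 0).card + (Sx 1).card + (Sx 2).card := by
    have h1 : S = (Sx 0).image (fun p => (p, (0 : Fin 3))) ∪ ((Sx 1).image (fun p => (p, (1 : Fin 3)))
        ∪ (Sx 2).image (fun p => (p, (2 : Fin 3)))) := by
      ext ⟨p, t⟩
      simp only [Finset.mem_union, Finset.mem_image, hmem, Prod.mk.injEq]
      constructor
      · intro h
        fin_cases t
        · exact Or.inl ⟨p, h, rfl, rfl⟩
        · exact Or.inr (Or.inl ⟨p, h, rfl, rfl⟩)
        · exact Or.inr (Or.inr ⟨p, h, rfl, rfl⟩)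
      · rintro (⟨p', h, rfl, rfl⟩ | ⟨p', h, rfl, rfl⟩ | ⟨p', h, rfl, rfl⟩) <;> exact h
    have hi : ∀ t : Fin 3, Function.Injective (fun p : Fin m × Fin m => (p, t)) := by
      intro t p q h
      exact (Prod.mk.injEq _ _ _ _ ▸ h).1
    conv_lhs => rw [h1]
    rw [Finset.card_union_of_disjoint, Finset.card_union_of_disjoint,
      Finset.card_image_of_injective _ (hi 0), Finset.card_image_of_injective _ (hi 1),
      Finset.card_image_of_injective _ (hi 2)]
    · ring
    · rw [Finset.disjoint_left]
      simp only [Finset.mem_image]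
      rintro _ ⟨p, _, rfl⟩ ⟨q, _, h⟩
      simp at h
    · rw [Finset.disjoint_left]
      simp only [Finset.mem_image, Finset.mem_union]
      rintro _ ⟨p, _, rfl⟩ (⟨q, _, h⟩ | ⟨q, _, h⟩) <;> simp at h
  set H := Sx 0 ∪ Sx 1 with hH
  set R := H.image Prod.fst with hR
  set Q := H.image Prod.snd with hQ
  let sp0 : Finset (Fin m ⊕ (Fin m ⊕ ((Fin m × Fin m) ⊕ (Fin m × Fin m)))) :=
    R.disjSum (Q.disjSum ((Sx 0 ∪ Sx 2).disjSum (Sx 1 ∪ Sx 2)))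
  have hsp0 : sp0.card = R.card + (Q.card + ((Sx 0 ∪ Sx 2).card + (Sx 1 ∪ Sx 2).card)) := by
    simp only [sp0, Finset.card_disjSum]
  have ha : ∀ p, p ∈ Sx 0 ∪ Sx 2 → ta p ∈ S.biUnion tedge := by
    intro p hp
    rw [Finset.mem_biUnion]
    rcases Finset.mem_union.1 hp with h | h
    · exact ⟨_, (hmem p 0).1 h, by simp [tedge]⟩
    · exact ⟨_, (hmem p 2).1 h, by simp [tedge]⟩
  have hd : ∀ p, p ∈ Sx 1 ∪ Sx 2 → td p ∈ S.biUnion tedge := by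
    intro p hp
    rw [Finset.mem_biUnion]
    rcases Finset.mem_union.1 hp with h | h
    · exact ⟨_, (hmem p 1).1 h, by simp [tedge]⟩
    · exact ⟨_, (hmem p 2).1 h, by simp [tedge]⟩
  have hbc : ∀ p, p ∈ H → tb p.1 ∈ S.biUnion tedge ∧ tc p.2 ∈ S.biUnion tedge := by
    intro p hp
    simp only [Finset.mem_biUnion]
    rcases Finset.mem_union.1 hp with h | h
    · exact ⟨⟨_, (hmem p 0).1 h, by simp [tedge]⟩, ⟨_, (hmem p 0).1 h, by simp [tedge]⟩⟩
    · exact ⟨⟨_, (hmem p 1).1 h, by simp [tedge]⟩, ⟨_, (hmem p 1).1 h, by simp [tedge]⟩⟩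
  have hsub : sp0.map Function.Embedding.some ⊆ S.biUnion tedge := by
    intro v hv
    rw [Finset.mem_map] at hv
    obtain ⟨x, hx, rfl⟩ := hv
    rcases x with i | i | p | p
    · have hi : i ∈ R := Finset.inl_mem_disjSum.1 hx
      obtain ⟨p, hp, rfl⟩ := Finset.mem_image.1 hi
      exact (hbc p hp).1
    · have hi : i ∈ Q := Finset.inl_mem_disjSum.1 (Finset.inr_mem_disjSum.1 hx)
      obtain ⟨p, hp, rfl⟩ := Finset.mem_image.1 hi
      exact (hbc p hp).2
    · exact ha p (Finset.inl_mem_disjSum.1 (Finset.inr_mem_disjSum.1 (Finset.inr_mem_disjSum.1 hx)))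
    · exact hd p (Finset.inr_mem_disjSum.1 (Finset.inr_mem_disjSum.1 (Finset.inr_mem_disjSum.1 hx)))
  have hv0 : sp0.card ≤ (S.biUnion tedge).card := by
    have := Finset.card_le_card hsub
    rwa [Finset.card_map] at this
  have hv1 : (Sx 2).Nonempty → sp0.card + 1 ≤ (S.biUnion tedge).card := by
    rintro ⟨p, hp⟩
    have h1 : insert tf (sp0.map Function.Embedding.some) ⊆ S.biUnion tedge := by
      rw [Finset.insert_subset_iff]
      refine ⟨?_, hsub⟩
      rw [Finset.mem_biUnion]
      exact ⟨_, (hmem p 2).1 hp, by simp [tedge]⟩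
    have h2 := Finset.card_le_card h1
    rw [Finset.card_insert_of_notMem (by simp), Finset.card_map] at h2
    exact h2
  -- inclusion-exclusion
  have i1 := Finset.card_union_add_card_inter (Sx 0) (Sx 2)
  have i2 := Finset.card_union_add_card_inter (Sx 1) (Sx 2)
  have i3 := Finset.card_union_add_card_inter (Sx 0 ∩ Sx 2) (Sx 1 ∩ Sx 2)
  have i4 : (Sx 0 ∩ Sx 2) ∪ (Sx 1 ∩ Sx 2) = H ∩ Sx 2 := by rw [hH, Finset.union_inter_distrib_right]
  rw [i4] at i3
  set P := (Sx 0 ∩ Sx 2) ∩ (Sx 1 ∩ Sx 2) with hP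
  have i5 := Finset.card_union_add_card_inter H (Sx 2)
  have p0 : P.card ≤ (Sx 0).card := Finset.card_le_card (by
    intro x hx; simp only [hP, Finset.mem_inter] at hx; exact hx.1.1)
  have p1 : P.card ≤ (Sx 1).card := Finset.card_le_card (by
    intro x hx; simp only [hP, Finset.mem_inter] at hx; exact hx.2.1)
  have p2 : P.card ≤ (Sx 2).card := Finset.card_le_card (by
    intro x hx; simp only [hP, Finset.mem_inter] at hx; exact hx.1.2)
  have hPH : P ⊆ H := by
    intro x hx; simp only [hP, Finset.mem_inter] at hx; exact Finset.mem_union_left _ hx.1.1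
  have hHc : H.card ≤ R.card * Q.card := by
    rw [← Finset.card_product]
    apply Finset.card_le_card
    intro p hp
    rw [Finset.mem_product]
    exact ⟨Finset.mem_image_of_mem _ hp, Finset.mem_image_of_mem _ hp⟩
  have hPHc := Finset.card_le_card hPH
  have hRH : R.card ≤ H.card := Finset.card_image_le
  have hQH : Q.card ≤ H.card := Finset.card_image_le
  have hS3 : ∀ t, (Sx t).card ≤ (H ∪ Sx 2).card := by
    intro t
    apply Finset.card_le_card
    intro p hp
    fin_cases t
    · exact Finset.mem_union_left _ (Finset.mem_union_left _ hp)
    · exact Finset.mem_union_left _ (Finset.mem_union_right _ hp)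
    · exact Finset.mem_union_right _ hp
  have s0 := hS3 0
  have s1 := hS3 1
  have hH01 := Finset.card_union_le (Sx 0) (Sx 1)
  rw [← hH] at hH01
  have hSpos := hS.card_pos
  have hS2 : (Sx 2).card = 0 ∨ (sp0.card + 1 ≤ (S.biUnion tedge).card) := by
    rcases (Sx 2).eq_empty_or_nonempty with h | h
    · left; simp [h]
    · right; exact hv1 h
  have hR0 : H.card = 0 ∨ (1 ≤ R.card ∧ 1 ≤ Q.card) := by
    rcases H.eq_empty_or_nonempty with h | h
    · left; simp [h]
    · right; exact ⟨(h.image _).card_pos, (h.image _).card_pos⟩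
  have hH2 : 2 ≤ H.card → 3 ≤ R.card + Q.card := by
    intro h
    by_contra hcon
    have h1 : R.card ≤ 1 ∨ 2 ≤ R.card := by omega
    have hq : R.card = 1 ∧ Q.card = 1 := by omega
    rw [hq.1, hq.2] at hHc
    omega
  have hH3 : R.card + Q.card = 3 → H.card ≤ 2 := by
    intro h
    have : (R.card = 1 ∧ Q.card = 2) ∨ (R.card = 2 ∧ Q.card = 1) := by
      rcases hR0 with h0 | h0
      · omega
      · omega
    rcases this with ⟨h1, h2⟩ | ⟨h1, h2⟩ <;> rw [h1, h2] at hHc <;> omega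
  have hi5' : (H ∩ Sx 2).card ≤ (Sx 2).card := Finset.card_le_card Finset.inter_subset_right
  have hi6 : (H ∩ Sx 2).card ≤ H.card := Finset.card_le_card Finset.inter_subset_left
  have hi7 : (Sx 0).card ≤ H.card := Finset.card_le_card Finset.subset_union_left
  have hi8 : (Sx 1).card ≤ H.card := Finset.card_le_card Finset.subset_union_right
  clear hHc
  refine ⟨?_, ?_, ?_⟩
  · rcases hR0 with h0 | h0
    · omega
    · omega
  · intro h8'
    rcases hR0 with h0 | h0
    · omega
    · by_contra hcon
      have hw : R.card + Q.card = 2 ∨ R.card + Q.card = 3 ∨ 4 ≤ R.card + Q.card := by omega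
      rcases hw with hw | hw | hw
      · have : ¬ 2 ≤ H.card := fun h => by have := hH2 h; omega
        omega
      · have := hH3 hw; omega
      · omega
  · intro hle h4
    have hone : (H ∪ Sx 2).card ≤ 1 := by
      rcases hR0 with h0 | h0
      · omega
      · have hw : R.card + Q.card = 2 ∨ R.card + Q.card = 3 ∨ 4 ≤ R.card + Q.card := by omega
        rcases hw with hw | hw | hw
        · have : ¬ 2 ≤ H.card := fun h => by have := hH2 h; omega
          omega
        · have := hH3 hw; omega
        · omega
    obtain ⟨x0, hx0⟩ := hS
    refine ⟨x0.1, fun x hx => ?_⟩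
    rw [Finset.card_le_one] at hone
    have hin : ∀ x ∈ S, x.1 ∈ H ∪ Sx 2 := by
      rintro ⟨p, t⟩ hx
      fin_cases t
      · exact Finset.mem_union_left _ (Finset.mem_union_left _ ((hmem _ _).2 hx))
      · exact Finset.mem_union_left _ (Finset.mem_union_right _ ((hmem _ _).2 hx))
      · exact Finset.mem_union_right _ ((hmem _ _).2 hx)
    exact hone _ (hin x hx) _ (hin x0 hx0)

lemma span_J (S : Finset (IX m)) (hS : S.Nonempty) (h4 : S.card ≤ 4)
    (h : (S.biUnion tedge).card ≤ S.card + 2) :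
    ∀ u ∈ S.biUnion tedge, ∀ v ∈ S.biUnion tedge, u ≠ v → JJ u v := by
  obtain ⟨p, hp⟩ := (span_aux S hS (by omega)).2.2 h h4
  intro u hu v hv hne
  obtain ⟨x, hx, hu⟩ := Finset.mem_biUnion.1 hu
  obtain ⟨y, hy, hv⟩ := Finset.mem_biUnion.1 hv
  obtain ⟨i, hi⟩ := tedge_ov x u hu
  obtain ⟨j, hj⟩ := tedge_ov y v hv
  rw [hp x hx] at hi
  rw [hp y hy] at hj
  exact ⟨hne, p, i, j, hi, hj⟩

lemma tedge_inj : Function.Injective (tedge (m := m)) := by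
  intro x y h
  by_contra hne
  have := (span_aux {x, y} ⟨x, by simp⟩ (by rw [Finset.card_pair hne]; omega)).1
  rw [Finset.card_pair hne, Finset.biUnion_insert, Finset.singleton_biUnion, ← h,
    Finset.union_self, tedge_card] at this
  omega
end Template
end BES

set_option linter.unusedSectionVars false
namespace BES
section Uniform
variable {I S : Type*} [Fintype I] [DecidableEq I] [Fintype S]

/-- uniform expectation -/
noncomputable def EU (f : (I → S) → ℝ) : ℝ := Ex (fun (_ : I) (_ : S) => (Fintype.card S : ℝ)⁻¹) f

lemma uw [Nonempty S] : ∀ _ : I, ∑ _s : S, (Fintype.card S : ℝ)⁻¹ = 1 := by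
  intro _
  have : (Fintype.card S : ℝ) ≠ 0 := by exact_mod_cast Fintype.card_ne_zero
  simp [this]

lemma EU_eq (f : (I → S) → ℝ) : EU f = (∑ ω, f ω) / (Fintype.card (I → S) : ℝ) := by
  simp only [EU, Ex, Finset.prod_const, ← Finset.mul_sum]
  rw [Fintype.card_fun, div_eq_inv_mul, Finset.card_univ]
  push_cast
  rw [inv_pow]

lemma EU_mono {f g : (I → S) → ℝ} (h : ∀ ω, f ω ≤ g ω) : EU f ≤ EU g :=
  Ex_mono (fun _ _ => by positivity) h

lemma EU_exists [Nonempty S] (f : (I → S) → ℝ) {c : ℝ} (h : EU f ≤ c) : ∃ ω, f ω ≤ c := by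
  obtain ⟨ω, hω⟩ := exists_ge_Ex (I := I) (fun _ _ => by positivity) (uw (S := S)) (fun ω => - f ω)
  refine ⟨ω, ?_⟩
  have h1 : Ex (fun (_ : I) (_ : S) => (Fintype.card S : ℝ)⁻¹) (fun ω => - f ω) = - EU f := by
    simp [EU, Ex]
  rw [h1] at hω
  linarith

lemma EU_add (f g : (I → S) → ℝ) : EU (fun ω => f ω + g ω) = EU f + EU g := Ex_add f g

lemma EU_sum {J : Type*} (s : Finset J) (F : J → (I → S) → ℝ) :
    EU (fun ω => ∑ j ∈ s, F j ω) = ∑ j ∈ s, EU (F j) := Ex_sum s F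

lemma EU_smul (c : ℝ) (f : (I → S) → ℝ) : EU (fun ω => c * f ω) = c * EU f := by
  simp only [EU, Ex, Finset.mul_sum]
  exact Finset.sum_congr rfl fun _ _ => by ring

/-- variance of a sum of independent centred variables -/
lemma EU_var [Nonempty S] (g : S → ℝ) (hg : ∑ s, g s = 0) :
    EU (fun ω : I → S => (∑ i, g (ω i)) ^ 2) =
      Fintype.card I * ((Fintype.card S : ℝ)⁻¹ * ∑ s, g s ^ 2) := by
  have h1 : (fun ω : I → S => (∑ i, g (ω i)) ^ 2) = fun ω => ∑ i, ∑ j, g (ω i) * g (ω j) := by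
    funext ω
    rw [pow_two, Finset.sum_mul_sum]
  rw [h1, EU_sum]
  have h2 : ∀ i : I, EU (fun ω : I → S => ∑ j, g (ω i) * g (ω j)) =
      (Fintype.card S : ℝ)⁻¹ * ∑ s, g s ^ 2 := by
    intro i
    rw [EU_sum, Finset.sum_eq_single i]
    · have := Ex_single (I := I) (uw (S := S)) i (fun s => g s * g s)
      unfold EU
      rw [this, Finset.mul_sum]
      exact Finset.sum_congr rfl fun _ _ => by ring
    · intro j _ hj
      have h3 := Ex_mul (I := I) (uw (S := S)) {i} (f := fun ω => g (ω i)) (g := fun ω => g (ω j))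
        (fun x y h => by simp only; rw [h i (by simp)])
        (fun x y h => by simp only; rw [h j (by simpa using hj)])
      unfold EU
      rw [h3]
      have := Ex_single (I := I) (uw (S := S)) i (fun s => g s)
      rw [this, ← Finset.mul_sum, hg]
      simp
    · simp
  simp [h2]
end Uniform

section Host
variable {τ Ω B I : Type} [Fintype τ] [DecidableEq τ] [Fintype Ω] [DecidableEq Ω]
  [Fintype B] [DecidableEq B] [Fintype I] [DecidableEq I] {q : ℕ}

def phi (ψ : Ω → τ → B) (o : Ω × (τ → Fin q)) (v : τ) : B × Fin q := (ψ o.1 v, o.2 v)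

def Vb (ψ : Ω → τ → B) (o : Ω × (τ → Fin q)) : Finset (B × Fin q) := Finset.univ.image (phi ψ o)

def Jb (ψ : Ω → τ → B) (J : Finset (τ × τ)) (o : Ω × (τ → Fin q)) : Finset (Finset (B × Fin q)) :=
  J.image fun p => {phi ψ o p.1, phi ψ o p.2}

lemma overwrite (ψ : Ω → τ → B) (A : Finset I) (ρ : {x : I × τ // x ∈ A ×ˢ (Finset.univ : Finset τ)} →
      {x : I × τ // x ∈ A ×ˢ (Finset.univ : Finset τ)}) (hid : ∀ σ, ρ (ρ σ) = ρ σ) :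
    (Finset.univ.filter fun ω : I → Ω × (τ → Fin q) => ∀ σ,
      phi ψ (ω (ρ σ).1.1) (ρ σ).1.2 = phi ψ (ω σ.1.1) σ.1.2).card *
      q ^ (Finset.univ.filter fun σ => ρ σ ≠ σ).card ≤ Fintype.card (I → Ω × (τ → Fin q)) := by
  classical
  set F := (Finset.univ.filter fun ω : I → Ω × (τ → Fin q) => ∀ σ,
      phi ψ (ω (ρ σ).1.1) (ρ σ).1.2 = phi ψ (ω σ.1.1) σ.1.2) with hF
  set R := (Finset.univ.filter fun σ => ρ σ ≠ σ) with hR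
  have h1 : F.card * q ^ R.card = Fintype.card ({ω // ω ∈ F} × ({σ // σ ∈ R} → Fin q)) := by
    simp
  rw [h1]
  let G : ({ω // ω ∈ F} × ({σ // σ ∈ R} → Fin q)) → (I → Ω × (τ → Fin q)) := fun p i =>
    ((p.1.1 i).1, fun v => if h : ∃ h : (i, v) ∈ A ×ˢ (Finset.univ : Finset τ), (⟨(i, v), h⟩ :
      {x : I × τ // x ∈ A ×ˢ (Finset.univ : Finset τ)}) ∈ R then p.2 ⟨⟨(i, v), h.1⟩, h.2⟩ else (p.1.1 i).2 v)
  apply Fintype.card_le_of_injective G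
  rintro ⟨⟨ω, hω⟩, z⟩ ⟨⟨ω', hω'⟩, z'⟩ h
  have hz : z = z' := by
    funext ⟨⟨⟨i, v⟩, hx⟩, hσ⟩
    have := congrFun (congrArg Prod.snd (congrFun h i)) v
    simp only [G] at this
    rw [dif_pos ⟨hx, hσ⟩, dif_pos ⟨hx, hσ⟩] at this
    exact this
  have hfst : ∀ i, (ω i).1 = (ω' i).1 := by
    intro i
    have := congrArg Prod.fst (congrFun h i)
    exact this
  have hout : ∀ i v, (¬ ∃ h : (i, v) ∈ A ×ˢ (Finset.univ : Finset τ), (⟨(i, v), h⟩ :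
      {x : I × τ // x ∈ A ×ˢ (Finset.univ : Finset τ)}) ∈ R) → (ω i).2 v = (ω' i).2 v := by
    intro i v hn
    have := congrFun (congrArg Prod.snd (congrFun h i)) v
    simp only [G] at this
    rw [dif_neg hn, dif_neg hn] at this
    exact this
  have hωω : ω = ω' := by
    funext i
    refine Prod.ext (hfst i) ?_
    funext v
    by_cases hx : ∃ h : (i, v) ∈ A ×ˢ (Finset.univ : Finset τ), (⟨(i, v), h⟩ :
      {x : I × τ // x ∈ A ×ˢ (Finset.univ : Finset τ)}) ∈ R
    · obtain ⟨hx, hσ⟩ := hx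
      rw [hF, Finset.mem_filter] at hω hω'
      have e1 := congrArg Prod.snd (hω.2 ⟨(i, v), hx⟩)
      have e2 := congrArg Prod.snd (hω'.2 ⟨(i, v), hx⟩)
      simp only [phi] at e1 e2
      rw [← e1, ← e2]
      apply hout
      rintro ⟨h1, h2⟩
      rw [hR, Finset.mem_filter] at h2
      exact h2.2 (hid ⟨(i, v), hx⟩)
    · exact hout i v hx
  subst hz; subst hωω; rfl

lemma union_bound (ψ : Ω → τ → B) (A : Finset I) (k : ℕ) (hq : 0 < q) :
    (Finset.univ.filter fun ω : I → Ω × (τ → Fin q) =>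
      (A.biUnion fun i => Vb ψ (ω i)).card + k ≤ A.card * Fintype.card τ).card * q ^ k ≤
      (A.card * Fintype.card τ) ^ (A.card * Fintype.card τ) * Fintype.card (I → Ω × (τ → Fin q)) := by
  classical
  let Sg := {x : I × τ // x ∈ A ×ˢ (Finset.univ : Finset τ)}
  have hSg : Fintype.card Sg = A.card * Fintype.card τ := by
    rw [Fintype.card_coe, Finset.card_product, Finset.card_univ]
  let Rs : Finset (Sg → Sg) := Finset.univ.filter fun ρ => (∀ σ, ρ (ρ σ) = ρ σ) ∧
    k ≤ (Finset.univ.filter fun σ => ρ σ ≠ σ).card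
  let F : (Sg → Sg) → Finset (I → Ω × (τ → Fin q)) := fun ρ => Finset.univ.filter fun ω => ∀ σ,
      phi ψ (ω (ρ σ).1.1) (ρ σ).1.2 = phi ψ (ω σ.1.1) σ.1.2
  have hsub : (Finset.univ.filter fun ω : I → Ω × (τ → Fin q) =>
      (A.biUnion fun i => Vb ψ (ω i)).card + k ≤ A.card * Fintype.card τ) ⊆ Rs.biUnion F := by
    intro ω hω
    rw [Finset.mem_filter] at hω
    rw [Finset.mem_biUnion]
    let f : Sg → B × Fin q := fun σ => phi ψ (ω σ.1.1) σ.1.2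
    rcases isEmpty_or_nonempty Sg with hE | hE
    · refine ⟨id, ?_, ?_⟩
      · simp only [Rs, Finset.mem_filter, Finset.mem_univ, true_and, id]
        have := Fintype.card_eq_zero_iff.2 hE
        refine ⟨fun _ => trivial, ?_⟩
        omega
      · simp [F]
    · refine ⟨fun σ => Function.invFun f (f σ), ?_, ?_⟩
      · have hinv : ∀ σ, f (Function.invFun f (f σ)) = f σ := fun σ =>
          Function.invFun_eq ⟨σ, rfl⟩
        simp only [Rs, Finset.mem_filter, Finset.mem_univ, true_and]
        refine ⟨fun σ => by rw [hinv], ?_⟩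
        have h1 := Finset.card_filter_add_card_filter_not (s := (Finset.univ : Finset Sg))
          (fun σ => Function.invFun f (f σ) = σ)
        have h2 : (Finset.univ.filter fun σ => Function.invFun f (f σ) = σ).card ≤
            (A.biUnion fun i => Vb ψ (ω i)).card := by
          apply Finset.card_le_card_of_injOn f
          · intro σ _
            rw [Finset.mem_coe, Finset.mem_biUnion]
            exact ⟨σ.1.1, (Finset.mem_product.1 σ.2).1, Finset.mem_image_of_mem _ (Finset.mem_univ _)⟩
          · intro σ hσ σ' hσ' h
            rw [Finset.mem_coe, Finset.mem_filter] at hσ hσ'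
            rw [← hσ.2, ← hσ'.2, h]
        rw [Finset.card_univ, hSg] at h1
        have := hω.2
        simp only [ne_eq]
        omega
      · simp only [F, Finset.mem_filter, Finset.mem_univ, true_and]
        intro σ
        exact Function.invFun_eq (f := f) ⟨σ, rfl⟩
  calc _ ≤ (∑ ρ ∈ Rs, (F ρ).card) * q ^ k :=
        Nat.mul_le_mul_right _ ((Finset.card_le_card hsub).trans Finset.card_biUnion_le)
    _ = ∑ ρ ∈ Rs, (F ρ).card * q ^ k := by rw [Finset.sum_mul]
    _ ≤ ∑ ρ ∈ Rs, Fintype.card (I → Ω × (τ → Fin q)) := by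
        apply Finset.sum_le_sum
        intro ρ hρ
        simp only [Rs, Finset.mem_filter, Finset.mem_univ, true_and] at hρ
        refine le_trans ?_ (overwrite ψ A ρ hρ.1)
        exact Nat.mul_le_mul_left _ (Nat.pow_le_pow_right hq hρ.2)
    _ = Rs.card * Fintype.card (I → Ω × (τ → Fin q)) := by simp
    _ ≤ _ := by
        apply Nat.mul_le_mul_right
        refine (Finset.card_le_univ _).trans ?_
        rw [Fintype.card_fun, hSg]

end Host
end BES

set_option linter.unusedSectionVars false
namespace BES
section Host2
variable {τ Ω B I : Type} [Fintype τ] [DecidableEq τ] [Fintype Ω] [DecidableEq Ω]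
  [Fintype B] [DecidableEq B] [Fintype I] [DecidableEq I] {q : ℕ}

structure HostS (ψ : Ω → τ → B) (J : Finset (τ × τ)) (adj : B → B → Prop) : Prop where
  inj : ∀ a, Function.Injective (ψ a)
  jne : ∀ p ∈ J, p.1 ≠ p.2
  jnon : J.Nonempty
  adj_iff : ∀ a v w, v ≠ w → (adj (ψ a v) (ψ a w) ↔ (v, w) ∈ J)
  uniq : ∀ p ∈ J, ∀ b b', adj b b' → ∃! a, ψ a p.1 = b ∧ ψ a p.2 = b'

variable {ψ : Ω → τ → B} {J : Finset (τ × τ)} {adj : B → B → Prop}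

lemma phi_inj (H : HostS ψ J adj) (o : Ω × (τ → Fin q)) : Function.Injective (phi ψ o) := by
  intro v w h
  exact H.inj o.1 (congrArg Prod.fst h)

def Ev (ψ : Ω → τ → B) (J : Finset (τ × τ)) (o : Ω × (τ → Fin q)) (U W : B × Fin q) : Prop :=
  ∃ p ∈ J, phi ψ o p.1 = U ∧ phi ψ o p.2 = W

lemma fun_card {v w : τ} (h : v ≠ w) (a b : Fin q) :
    (Finset.univ.filter fun y : τ → Fin q => y v = a ∧ y w = b).card * q ^ 2 =
      q ^ Fintype.card τ := by
  classical
  have h1 : (Finset.univ.filter fun y : τ → Fin q => y v = a ∧ y w = b) =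
      Fintype.piFinset (fun x => if x = v then {a} else if x = w then {b} else Finset.univ) := by
    ext y
    simp only [Finset.mem_filter, Finset.mem_univ, true_and, Fintype.mem_piFinset]
    constructor
    · rintro ⟨rfl, rfl⟩ x
      split_ifs with h1 h2
      · simp [h1]
      · simp [h2]
      · simp
    · intro hy
      have e1 := hy v
      have e2 := hy w
      rw [if_pos rfl] at e1
      rw [if_neg h.symm, if_pos rfl] at e2
      exact ⟨by simpa using e1, by simpa using e2⟩
  rw [h1, Fintype.card_piFinset]
  have h2 : q ^ Fintype.card τ = ∏ _x : τ, q := by simp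
  rw [h2, ← Finset.mul_prod_erase _ _ (Finset.mem_univ v),
    ← Finset.mul_prod_erase _ _ (Finset.mem_erase.2 ⟨h.symm, Finset.mem_univ w⟩),
    ← Finset.mul_prod_erase Finset.univ (fun _ => q) (Finset.mem_univ v),
    ← Finset.mul_prod_erase _ (fun _ => q) (Finset.mem_erase.2 ⟨h.symm, Finset.mem_univ w⟩)]
  have h3 : ∏ x ∈ (Finset.univ.erase v).erase w,
      (if x = v then ({a} : Finset (Fin q)) else if x = w then {b} else Finset.univ).card =
      ∏ x ∈ (Finset.univ.erase v).erase w, q := by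
    apply Finset.prod_congr rfl
    intro x hx
    simp only [Finset.mem_erase] at hx
    rw [if_neg hx.2.1, if_neg hx.1]
    simp
  rw [h3]
  simp [h.symm]
  ring

open Classical in
lemma ev_card (H : HostS ψ J adj) (U W : B × Fin q) (hUW : adj U.1 W.1) :
    (Finset.univ.filter fun o : Ω × (τ → Fin q) => Ev ψ J o U W).card * (Fintype.card Ω * q ^ 2) =
      J.card * Fintype.card (Ω × (τ → Fin q)) := by
  have h1 : (Finset.univ.filter fun o : Ω × (τ → Fin q) => Ev ψ J o U W) =
      J.biUnion fun p => Finset.univ.filter fun o => phi ψ o p.1 = U ∧ phi ψ o p.2 = W := by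
    ext o
    simp [Ev]
  rw [h1, Finset.card_biUnion]
  · have h2 : ∀ p ∈ J, (Finset.univ.filter fun o : Ω × (τ → Fin q) =>
        phi ψ o p.1 = U ∧ phi ψ o p.2 = W).card * q ^ 2 = q ^ Fintype.card τ := by
      intro p hp
      obtain ⟨a, ha, hu⟩ := H.uniq p hp _ _ hUW
      rw [← fun_card (H.jne p hp) U.2 W.2]
      congr 1
      symm
      apply Finset.card_bij (fun y _ => (a, y))
      · intro y hy
        simp only [Finset.mem_filter, Finset.mem_univ, true_and] at hy ⊢
        exact ⟨Prod.ext ha.1 hy.1, Prod.ext ha.2 hy.2⟩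
      · intro y _ y' _ h
        exact congrArg Prod.snd h
      · rintro ⟨a', y⟩ ho
        simp only [Finset.mem_filter, Finset.mem_univ, true_and] at ho
        refine ⟨y, ?_, ?_⟩
        · simp only [Finset.mem_filter, Finset.mem_univ, true_and]
          exact ⟨congrArg Prod.snd ho.1, congrArg Prod.snd ho.2⟩
        · rw [hu a' ⟨congrArg Prod.fst ho.1, congrArg Prod.fst ho.2⟩]
    calc _ = Fintype.card Ω * ∑ p ∈ J, (Finset.univ.filter fun o : Ω × (τ → Fin q) =>
        phi ψ o p.1 = U ∧ phi ψ o p.2 = W).card * q ^ 2 := by rw [← Finset.sum_mul]; ring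
      _ = _ := by
        rw [Finset.sum_congr rfl h2]
        simp
        ring
  · intro p _ p' _ hne
    rw [Function.onFun, Finset.disjoint_left]
    intro o ho ho'
    simp only [Finset.mem_filter, Finset.mem_univ, true_and] at ho ho'
    exact hne (Prod.ext (phi_inj H o (ho.1.trans ho'.1.symm)) (phi_inj H o (ho.2.trans ho'.2.symm)))

open Classical in
noncomputable def adjP (adj : B → B → Prop) (q : ℕ) : Finset ((B × Fin q) × (B × Fin q)) :=
  Finset.univ.filter fun x => adj x.1.1 x.2.1

lemma adjP_card (H : HostS ψ J adj) : (adjP adj q).card ≤ Fintype.card Ω * q ^ 2 := by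
  classical
  obtain ⟨p, hp⟩ := H.jnon
  have h1 : (adjP adj q) ⊆ (Finset.univ : Finset (Ω × Fin q × Fin q)).image
      fun x => ((ψ x.1 p.1, x.2.1), (ψ x.1 p.2, x.2.2)) := by
    rintro ⟨U, W⟩ h
    simp only [adjP, Finset.mem_filter, Finset.mem_univ, true_and] at h
    obtain ⟨a, ha, _⟩ := H.uniq p hp _ _ h
    rw [Finset.mem_image]
    refine ⟨(a, U.2, W.2), Finset.mem_univ _, ?_⟩
    simp only [ha.1, ha.2]
  refine (Finset.card_le_card h1).trans (Finset.card_image_le.trans ?_)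
  rw [Finset.card_univ]
  simp [pow_two]

open Classical in
noncomputable def dg (ψ : Ω → τ → B) (J : Finset (τ × τ)) (ω : I → Ω × (τ → Fin q))
    (U W : B × Fin q) : ℕ := (Finset.univ.filter fun i => Ev ψ J (ω i) U W).card

lemma cheb [Nonempty Ω] (H : HostS ψ J adj) (hq : 0 < q) (t : ℕ)
    (hI : Fintype.card I = Fintype.card Ω * t * q ^ 2) (U W : B × Fin q) (hUW : adj U.1 W.1) :
    EU (fun ω : I → Ω × (τ → Fin q) => ((dg ψ J ω U W : ℝ) - t * J.card) ^ 2) ≤ t * J.card := by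
  classical
  have : Nonempty (Fin q) := ⟨⟨0, hq⟩⟩
  have hΩ : (0 : ℝ) < Fintype.card Ω := by exact_mod_cast Fintype.card_pos
  have hq' : (0 : ℝ) < q := by exact_mod_cast hq
  have hSc : (0 : ℝ) < Fintype.card (Ω × (τ → Fin q)) := by exact_mod_cast Fintype.card_pos
  let pr : ℝ := J.card / (Fintype.card Ω * q ^ 2)
  let g : (Ω × (τ → Fin q)) → ℝ := fun o => (if Ev ψ J o U W then 1 else 0) - pr
  have hev := ev_card (q := q) H U W hUW
  have hev' : ((Finset.univ.filter fun o : (Ω × (τ → Fin q)) => Ev ψ J o U W).card : ℝ) = pr * Fintype.card (Ω × (τ → Fin q)) := by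
    have : ((Finset.univ.filter fun o : (Ω × (τ → Fin q)) => Ev ψ J o U W).card : ℝ) * (Fintype.card Ω * q ^ 2) =
      J.card * Fintype.card (Ω × (τ → Fin q)) := by exact_mod_cast hev
    simp only [pr]
    field_simp
    linarith
  have hs1 : ∑ o, (if Ev ψ J o U W then (1 : ℝ) else 0) = pr * Fintype.card (Ω × (τ → Fin q)) := by
    rw [← hev', Finset.sum_boole]
  have hg0 : ∑ o, g o = 0 := by
    simp only [g, Finset.sum_sub_distrib, hs1]
    simp; ring
  have hg2 : ∑ o, g o ^ 2 ≤ pr * Fintype.card (Ω × (τ → Fin q)) := by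
    have : ∀ o, g o ^ 2 = (if Ev ψ J o U W then (1 : ℝ) else 0) - 2 * pr * (if Ev ψ J o U W then (1 : ℝ) else 0)
        + pr ^ 2 := by
      intro o
      simp only [g]
      split_ifs <;> ring
    simp only [this, Finset.sum_add_distrib, Finset.sum_sub_distrib, ← Finset.mul_sum, hs1]
    simp only [Finset.sum_const, Finset.card_univ, nsmul_eq_mul]
    have : 0 ≤ pr ^ 2 * Fintype.card (Ω × (τ → Fin q)) := by positivity
    nlinarith
  have hTp : (Fintype.card I : ℝ) * pr = t * J.card := by
    rw [hI]
    simp only [pr]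
    push_cast
    field_simp
  have hd : ∀ ω : I → (Ω × (τ → Fin q)), (dg ψ J ω U W : ℝ) - t * J.card = ∑ i, g (ω i) := by
    intro ω
    simp only [g, Finset.sum_sub_distrib, Finset.sum_boole, dg]
    simp [← hTp]
  simp only [hd]
  rw [EU_var g hg0, ← hTp]
  apply mul_le_mul_of_nonneg_left _ (by positivity)
  rw [inv_mul_le_iff₀ hSc]
  linarith

lemma cheb_real {δ D0 y : ℝ} (hδ : 0 < δ) (hD0 : 0 < D0) (hx : (1 + δ) * D0 < y) :
    y ≤ (1 / δ + 1) / (δ * D0) * (y - D0) ^ 2 := by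
  rw [div_mul_eq_mul_div, le_div_iff₀ (by positivity)]
  have hz : δ * D0 ≤ y - D0 := by linarith
  have hz' : y ≤ (1 / δ + 1) * (y - D0) := by
    have : D0 ≤ 1 / δ * (y - D0) := by
      rw [one_div, ← div_eq_inv_mul, le_div_iff₀ hδ]; linarith
    linarith
  have h0 : 0 ≤ y - D0 := le_trans (by positivity) hz
  calc y * (δ * D0) ≤ ((1 / δ + 1) * (y - D0)) * (y - D0) :=
        mul_le_mul hz' hz (by positivity) (by positivity)
    _ = _ := by ring

/-- indices in overloaded pairs -/
lemma bad_deg [Nonempty Ω] (H : HostS ψ J adj) (hq : 0 < q) (t : ℕ) (ht : 0 < t)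
    (hI : Fintype.card I = Fintype.card Ω * t * q ^ 2) (δ : ℝ) (hδ : 0 < δ) :
    ∃ f : (I → Ω × (τ → Fin q)) → Finset I,
      EU (fun ω => ((f ω).card : ℝ)) ≤ Fintype.card Ω * q ^ 2 * ((1 / δ + 1) / δ) ∧
      ∀ ω, ∀ i, i ∉ f ω → ∀ U W, Ev ψ J (ω i) U W → (dg ψ J ω U W : ℝ) ≤ (1 + δ) * (t * J.card) := by
  classical
  have hJ : (0 : ℝ) < J.card := by exact_mod_cast H.jnon.card_pos
  have ht' : (0 : ℝ) < t := by exact_mod_cast ht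
  set D0 : ℝ := t * J.card with hD0
  have hD0p : 0 < D0 := mul_pos ht' hJ
  clear_value D0
  have hc0 : 0 ≤ (1 / δ + 1) / (δ * D0) := by positivity
  refine ⟨fun ω => Finset.univ.filter fun i => ∃ U W, Ev ψ J (ω i) U W ∧
    (1 + δ) * D0 < dg ψ J ω U W, ?_, ?_⟩
  · have key : ∀ ω : I → Ω × (τ → Fin q), ((Finset.univ.filter fun i => ∃ U W, Ev ψ J (ω i) U W ∧
        (1 + δ) * D0 < dg ψ J ω U W).card : ℝ) ≤
        ((1 / δ + 1) / (δ * D0)) * ∑ x ∈ adjP adj q, ((dg ψ J ω x.1 x.2 : ℝ) - D0) ^ 2 := by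
      intro ω
      have h1 : (Finset.univ.filter fun i => ∃ U W, Ev ψ J (ω i) U W ∧
          (1 + δ) * D0 < dg ψ J ω U W) ⊆ ((adjP adj q).filter fun x => (1 + δ) * D0 < dg ψ J ω x.1 x.2).biUnion
            fun x => Finset.univ.filter fun i => Ev ψ J (ω i) x.1 x.2 := by
        intro i hi
        simp only [Finset.mem_filter, Finset.mem_univ, true_and] at hi
        obtain ⟨U, W, hev, hd⟩ := hi
        rw [Finset.mem_biUnion]
        refine ⟨(U, W), ?_, by simpa using hev⟩
        simp only [adjP, Finset.mem_filter, Finset.mem_univ, true_and]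
        refine ⟨?_, hd⟩
        obtain ⟨p, hp, rfl, rfl⟩ := hev
        exact (H.adj_iff _ _ _ (H.jne p hp)).2 hp
      have h2 : ((Finset.univ.filter fun i => ∃ U W, Ev ψ J (ω i) U W ∧
          (1 + δ) * D0 < dg ψ J ω U W).card : ℝ) ≤
          ∑ x ∈ (adjP adj q).filter fun x => (1 + δ) * D0 < dg ψ J ω x.1 x.2, (dg ψ J ω x.1 x.2 : ℝ) := by
        have h := (Finset.card_le_card h1).trans Finset.card_biUnion_le
        have h' := (Nat.cast_le (α := ℝ)).2 h
        rw [Nat.cast_sum] at h'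
        exact h'
      refine h2.trans ?_
      rw [Finset.mul_sum]
      refine le_trans ?_ (Finset.sum_le_sum_of_subset_of_nonneg (Finset.filter_subset
        (fun x => (1 + δ) * D0 < dg ψ J ω x.1 x.2) _)
        (fun _ _ _ => mul_nonneg hc0 (sq_nonneg _)))
      apply Finset.sum_le_sum
      intro x hx
      have hx := (Finset.mem_filter.1 hx).2
      exact cheb_real hδ hD0p hx
    refine (EU_mono key).trans ?_
    rw [EU_smul, EU_sum]
    have h3 : ∑ x ∈ adjP adj q, EU (fun ω : I → Ω × (τ → Fin q) => ((dg ψ J ω x.1 x.2 : ℝ) - D0) ^ 2) ≤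
        Fintype.card Ω * q ^ 2 * D0 := by
      calc _ ≤ ∑ x ∈ adjP adj q, D0 := by
            apply Finset.sum_le_sum
            intro x hx
            simp only [adjP, Finset.mem_filter, Finset.mem_univ, true_and] at hx
            rw [hD0]; exact cheb H hq t hI x.1 x.2 hx
        _ = (adjP adj q).card * D0 := by simp
        _ ≤ _ := by
            apply mul_le_mul_of_nonneg_right _ hD0p.le
            exact_mod_cast adjP_card H
    refine (mul_le_mul_of_nonneg_left h3 hc0).trans (le_of_eq ?_)
    field_simp
  · intro ω i hi U W hev
    simp only [Finset.mem_filter, Finset.mem_univ, true_and, not_exists, not_and, not_lt] at hi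
    exact hi U W hev
end Host2
end BES

set_option linter.unusedSectionVars false
namespace BES
section Host3
variable {τ Ω B I : Type} [Fintype τ] [DecidableEq τ] [Fintype Ω] [DecidableEq Ω]
  [Fintype B] [DecidableEq B] [Fintype I] [DecidableEq I] {q : ℕ}

def badS (ψ : Ω → τ → B) (lo hi : ℕ) (k : ℕ → ℕ) (ω : I → Ω × (τ → Fin q)) : Finset (Finset I) :=
  Finset.univ.filter fun A => (lo ≤ A.card ∧ A.card ≤ hi) ∧
    (A.biUnion fun i => Vb ψ (ω i)).card + k A.card ≤ A.card * Fintype.card τ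

lemma EU_ind (P : (I → Ω × (τ → Fin q)) → Prop) [DecidablePred P] :
    EU (fun ω => if P ω then (1 : ℝ) else 0) =
      ((Finset.univ.filter P).card : ℝ) / Fintype.card (I → Ω × (τ → Fin q)) := by
  rw [EU_eq, Finset.sum_boole]

lemma badS_exp [Nonempty Ω] (ψ : Ω → τ → B) (lo hi : ℕ) (k : ℕ → ℕ) (wt : ℕ → ℝ)
    (hwt : ∀ a, 0 ≤ wt a) (hq : 0 < q) :
    EU (fun ω : I → Ω × (τ → Fin q) => ∑ A ∈ badS ψ lo hi k ω, wt A.card) ≤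
      ∑ a ∈ Finset.Icc lo hi, (Fintype.card I : ℝ) ^ a *
        (wt a * (((a * Fintype.card τ : ℕ) : ℝ) ^ (a * Fintype.card τ) / (q : ℝ) ^ k a)) := by
  classical
  have : Nonempty (Fin q) := ⟨⟨0, hq⟩⟩
  have hq' : (0 : ℝ) < q := by exact_mod_cast hq
  have h1 : (fun ω : I → Ω × (τ → Fin q) => ∑ A ∈ badS ψ lo hi k ω, wt A.card) =
      fun ω => ∑ A ∈ Finset.univ.filter (fun A : Finset I => lo ≤ A.card ∧ A.card ≤ hi), wt A.card *
        (if (A.biUnion fun i => Vb ψ (ω i)).card + k A.card ≤ A.card * Fintype.card τ then 1 else 0) := by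
    funext ω
    rw [badS, Finset.sum_filter, Finset.sum_filter]
    apply Finset.sum_congr rfl
    intro A _
    by_cases h1 : lo ≤ A.card ∧ A.card ≤ hi
    · by_cases h2 : (A.biUnion fun i => Vb ψ (ω i)).card + k A.card ≤ A.card * Fintype.card τ
      · rw [if_pos ⟨h1, h2⟩, if_pos h1, if_pos h2, mul_one]
      · rw [if_neg (fun h => h2 h.2), if_pos h1, if_neg h2, mul_zero]
    · rw [if_neg (fun h => h1 h.1), if_neg h1]
  rw [h1, EU_sum]
  have h2 : ∀ A : Finset I, EU (fun ω : I → Ω × (τ → Fin q) => wt A.card *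
      (if (A.biUnion fun i => Vb ψ (ω i)).card + k A.card ≤ A.card * Fintype.card τ then 1 else 0)) ≤
      wt A.card * (((A.card * Fintype.card τ : ℕ) : ℝ) ^ (A.card * Fintype.card τ) /
        (q : ℝ) ^ k A.card) := by
    intro A
    rw [EU_smul]
    apply mul_le_mul_of_nonneg_left _ (hwt _)
    rw [EU_ind, div_le_div_iff₀ (by exact_mod_cast Fintype.card_pos) (by positivity)]
    exact_mod_cast union_bound ψ A (k A.card) hq
  refine (Finset.sum_le_sum fun A _ => h2 A).trans ?_
  have h3 : (Finset.univ.filter (fun A : Finset I => lo ≤ A.card ∧ A.card ≤ hi)) =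
      (Finset.Icc lo hi).biUnion fun a => Finset.powersetCard a Finset.univ := by
    ext A
    simp only [Finset.mem_filter, Finset.mem_univ, true_and, Finset.mem_biUnion, Finset.mem_Icc,
      Finset.mem_powersetCard, Finset.subset_univ]
    constructor
    · intro h; exact ⟨_, h, rfl⟩
    · rintro ⟨a, h, rfl⟩; exact h
  rw [h3, Finset.sum_biUnion]
  · apply Finset.sum_le_sum
    intro a _
    have h4 : ∀ A ∈ Finset.powersetCard a (Finset.univ : Finset I), wt A.card *
        (((A.card * Fintype.card τ : ℕ) : ℝ) ^ (A.card * Fintype.card τ) / (q : ℝ) ^ k A.card) =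
        wt a * (((a * Fintype.card τ : ℕ) : ℝ) ^ (a * Fintype.card τ) / (q : ℝ) ^ k a) := by
      intro A hA
      rw [(Finset.mem_powersetCard.1 hA).2]
    rw [Finset.sum_congr rfl h4, Finset.sum_const, nsmul_eq_mul]
    apply mul_le_mul_of_nonneg_right _ (mul_nonneg (hwt a) (by positivity))
    rw [Finset.card_powersetCard, Finset.card_univ]
    exact_mod_cast Nat.choose_le_pow _ _
  · intro a _ b _ hab
    rw [Function.onFun, Finset.disjoint_left]
    intro A hA hB
    exact hab ((Finset.mem_powersetCard.1 hA).2.symm.trans (Finset.mem_powersetCard.1 hB).2)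

/-- expected number of over-dense sets -/
lemma bad1_exp [Nonempty Ω] (ψ : Ω → τ → B) (t s0 : ℕ) (hq : 0 < q)
    (hI : Fintype.card I = Fintype.card Ω * t * q ^ 2) :
    EU (fun ω : I → Ω × (τ → Fin q) => ((badS ψ 2 s0 (fun a => 2 * a - 1) ω).card : ℝ)) ≤
      (∑ a ∈ Finset.Icc 2 s0, ((Fintype.card Ω : ℝ) * t) ^ a *
        ((a * Fintype.card τ : ℕ) : ℝ) ^ (a * Fintype.card τ)) * q := by
  have hq' : (0 : ℝ) < q := by exact_mod_cast hq
  have h := badS_exp (I := I) (q := q) ψ 2 s0 (fun a => 2 * a - 1) (fun _ => 1) (fun _ => zero_le_one) hq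
  simp only [Finset.sum_const, nsmul_eq_mul, mul_one] at h
  refine h.trans (le_of_eq ?_)
  rw [Finset.sum_mul]
  apply Finset.sum_congr rfl
  intro a ha
  have ha2 : 2 ≤ a := (Finset.mem_Icc.1 ha).1
  obtain ⟨b, rfl⟩ : ∃ b, a = b + 1 := ⟨a - 1, by omega⟩
  have e1 : 2 * (b + 1) - 1 = 2 * b + 1 := by omega
  rw [hI, e1]
  push_cast
  rw [one_mul, mul_pow ((Fintype.card Ω : ℝ) * t), ← pow_mul, mul_div_assoc', div_eq_iff (by positivity)]
  have e2 : 2 * (b + 1) = (2 * b + 1) + 1 := by ring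
  rw [e2, pow_succ]
  ring

/-- expected conflict weight -/
lemma bad2_exp [Nonempty Ω] (ψ : Ω → τ → B) (t D : ℕ) (hq : 0 < q) (ht : 0 < t) (hD : t ≤ D)
    (hI : Fintype.card I = Fintype.card Ω * t * q ^ 2) :
    EU (fun ω : I → Ω × (τ → Fin q) => ∑ A ∈ badS ψ 3 8 (fun a => 2 * a - 2) ω,
        (A.card : ℝ) * (1 / (D : ℝ)) ^ (A.card - 1)) ≤
      (∑ a ∈ Finset.Icc 3 8, (Fintype.card Ω : ℝ) ^ (a - 1) * a *
        ((a * Fintype.card τ : ℕ) : ℝ) ^ (a * Fintype.card τ)) * Fintype.card I := by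
  have hq' : (0 : ℝ) < q := by exact_mod_cast hq
  have ht' : (0 : ℝ) < t := by exact_mod_cast ht
  have hD' : (t : ℝ) ≤ D := by exact_mod_cast hD
  have h := badS_exp (I := I) (q := q) ψ 3 8 (fun a => 2 * a - 2)
    (fun a => (a : ℝ) * (1 / (D : ℝ)) ^ (a - 1)) (fun _ => by positivity) hq
  refine h.trans ?_
  rw [Finset.sum_mul]
  apply Finset.sum_le_sum
  intro a ha
  have ha2 : 3 ≤ a := (Finset.mem_Icc.1 ha).1
  obtain ⟨b, rfl⟩ : ∃ b, a = b + 1 := ⟨a - 1, by omega⟩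
  have e1 : 2 * (b + 1) - 2 = 2 * b := by omega
  have e2 : b + 1 - 1 = b := by omega
  simp only [e1, e2]
  set Z : ℝ := (((b + 1) * Fintype.card τ : ℕ) : ℝ) ^ ((b + 1) * Fintype.card τ) with hZ
  have hZ0 : 0 ≤ Z := by positivity
  have h1 : (Fintype.card I : ℝ) ^ b * ((1 / (D : ℝ)) ^ b / (q : ℝ) ^ (2 * b)) ≤
      (Fintype.card Ω : ℝ) ^ b := by
    rw [pow_mul, ← div_pow, ← mul_pow]
    apply pow_le_pow_left₀ (by positivity)
    rw [hI]
    push_cast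
    have hDp : (0 : ℝ) < D := lt_of_lt_of_le ht' hD'
    have e3 : (Fintype.card Ω : ℝ) * t * q ^ 2 * (1 / (D : ℝ) / q ^ 2) = Fintype.card Ω * (t / D) := by
      field_simp
    rw [e3]
    have : (t : ℝ) / D ≤ 1 := (div_le_one hDp).2 hD'
    have h0 : (0 : ℝ) ≤ Fintype.card Ω := by positivity
    nlinarith
  calc (Fintype.card I : ℝ) ^ (b + 1) * (((b + 1 : ℕ) : ℝ) * (1 / (D : ℝ)) ^ b * (Z / (q : ℝ) ^ (2 * b)))
      = ((Fintype.card I : ℝ) ^ b * ((1 / (D : ℝ)) ^ b / (q : ℝ) ^ (2 * b))) *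
          (((b + 1 : ℕ) : ℝ) * Z * Fintype.card I) := by rw [pow_succ]; ring
    _ ≤ (Fintype.card Ω : ℝ) ^ b * (((b + 1 : ℕ) : ℝ) * Z * Fintype.card I) :=
        mul_le_mul_of_nonneg_right h1 (by positivity)
    _ = _ := by ring

lemma sum_W (ψ : Ω → τ → B) (ω : I → Ω × (τ → Fin q)) (w : ℕ → ℝ) (k : ℕ → ℕ) (lo hi : ℕ) :
    ∑ i, ∑ A ∈ (badS ψ lo hi k ω).filter (fun A => i ∈ A), w A.card =
      ∑ A ∈ badS ψ lo hi k ω, (A.card : ℝ) * w A.card := by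
  simp only [Finset.sum_filter]
  rw [Finset.sum_comm]
  apply Finset.sum_congr rfl
  intro A _
  rw [← Finset.sum_filter]
  simp
end Host3
end BES

set_option linter.unusedSectionVars false
namespace BES
section Host4
variable {τ Ω B : Type} [Fintype τ] [DecidableEq τ] [Fintype Ω] [DecidableEq Ω]
  [Fintype B] [DecidableEq B] {ψ : Ω → τ → B} {J : Finset (τ × τ)} {adj : B → B → Prop} {q : ℕ}

lemma Jb_iff (H : HostS ψ J adj) (o : Ω × (τ → Fin q)) (U W : B × Fin q) (hUW : U ≠ W)
    (ha : adj U.1 W.1) (hs : ({U, W} : Finset (B × Fin q)) ⊆ Vb ψ o) :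
    Ev ψ J o U W := by
  rw [Finset.insert_subset_iff, Finset.singleton_subset_iff] at hs
  obtain ⟨v, _, hv⟩ := Finset.mem_image.1 hs.1
  obtain ⟨w, _, hw⟩ := Finset.mem_image.1 hs.2
  refine ⟨(v, w), ?_, hv, hw⟩
  have hne : v ≠ w := fun h => hUW (by rw [← hv, ← hw, h])
  rw [← H.adj_iff o.1 v w hne]
  rw [← hv, ← hw] at ha
  exact ha

lemma Jb_sub (o : Ω × (τ → Fin q)) : ∀ π ∈ Jb ψ J o, π ⊆ Vb ψ o := by
  intro π hπ
  obtain ⟨p, _, rfl⟩ := Finset.mem_image.1 hπ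
  rw [Finset.insert_subset_iff, Finset.singleton_subset_iff]
  exact ⟨Finset.mem_image_of_mem _ (Finset.mem_univ _), Finset.mem_image_of_mem _ (Finset.mem_univ _)⟩

lemma Jb_closed (H : HostS ψ J adj) (o o' : Ω × (τ → Fin q)) (π) (h : π ∈ Jb ψ J o)
    (hs : π ⊆ Vb ψ o') : ∃ U W, π = {U, W} ∧ Ev ψ J o U W ∧ Ev ψ J o' U W := by
  obtain ⟨p, hp, rfl⟩ := Finset.mem_image.1 h
  refine ⟨_, _, rfl, ⟨p, hp, rfl, rfl⟩, ?_⟩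
  exact Jb_iff H o' _ _ (fun h => H.jne p hp (phi_inj H o h))
    ((H.adj_iff o.1 _ _ (H.jne p hp)).2 hp) hs

lemma Ev_Jb {o : Ω × (τ → Fin q)} {U W : B × Fin q} (h : Ev ψ J o U W) :
    ({U, W} : Finset _) ∈ Jb ψ J o := by
  obtain ⟨p, hp, rfl, rfl⟩ := h
  exact Finset.mem_image_of_mem _ hp

lemma sys_of (H : HostS ψ J adj) {I : Type} [Fintype I] [DecidableEq I] (ω : I → Ω × (τ → Fin q))
    (R : Finset I) (s0 D : ℕ)
    (h1 : ∀ A ⊆ R, A ∉ badS ψ 2 s0 (fun a => 2 * a - 1) ω)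
    (h3 : ∀ i ∈ R, ∀ U W, Ev ψ J (ω i) U W → dg ψ J ω U W ≤ D) :
    Sys (fun e : {i // i ∈ R} => Vb ψ (ω e.1)) (Fintype.card τ) s0 D (fun e => Jb ψ J (ω e.1)) := by
  classical
  have hcard : ∀ o : Ω × (τ → Fin q), (Vb ψ o).card = Fintype.card τ := by
    intro o
    rw [Vb, Finset.card_image_of_injective _ (phi_inj H o), Finset.card_univ]
  refine ⟨fun e => hcard _, ?_, ?_, fun e => Jb_sub _, ?_, ?_⟩
  · intro A hA hs
    by_cases h2 : 2 ≤ A.card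
    · have h := h1 (A.image Subtype.val) (by
        intro i hi
        obtain ⟨e, _, rfl⟩ := Finset.mem_image.1 hi
        exact e.2)
      have hc : (A.image Subtype.val).card = A.card :=
        Finset.card_image_of_injective _ Subtype.val_injective
      simp only [badS, Finset.mem_filter, Finset.mem_univ, true_and, hc, Finset.image_biUnion] at h
      by_contra hcon
      apply h
      refine ⟨⟨h2, hs⟩, ?_⟩
      unfold vv at hcon
      rw [mul_comm A.card]
      have hh : ∀ a : Finset (B × Fin q), ¬ (Fintype.card τ * A.card + 2 ≤ a.card + 2 * A.card) →
          a.card + (2 * A.card - 1) ≤ Fintype.card τ * A.card := by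
        intro a ha; omega
      exact hh _ hcon
    · have hp := hA.card_pos
      have : A.card = 1 := by omega
      obtain ⟨e, rfl⟩ := Finset.card_eq_one.1 this
      simp [vv, hcard]
  · intro e π hπ
    obtain ⟨p, hp, rfl⟩ := Finset.mem_image.1 hπ
    exact Finset.card_pair fun h => H.jne p hp (phi_inj H _ h)
  · intro e e' π hπ hs
    obtain ⟨U, W, rfl, _, h⟩ := Jb_closed H _ _ π hπ hs
    exact Ev_Jb h
  · intro π
    rcases (cmem (fun e : {i // i ∈ R} => Vb ψ (ω e.1)) (Fintype.card τ)
      (fun e => Jb ψ J (ω e.1)) (.inl π)).eq_empty_or_nonempty with h0 | ⟨e, he⟩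
    · rw [h0]; simp
    · have he := cmem_inl.1 he
      obtain ⟨U, W, rfl, _, h⟩ := Jb_closed H _ (ω e.1) π he (Jb_sub _ _ he)
      refine le_trans ?_ (h3 e.1 e.2 U W h)
      have hne : U ≠ W := by
        obtain ⟨p, hp, rfl, rfl⟩ := h
        exact fun h => H.jne p hp (phi_inj H _ h)
      have hadj : adj U.1 W.1 := by
        obtain ⟨p, hp, rfl, rfl⟩ := h
        exact (H.adj_iff _ _ _ (H.jne p hp)).2 hp
      unfold dg
      apply Finset.card_le_card_of_injOn Subtype.val
      · intro e' he'
        have he' := cmem_inl.1 (Finset.mem_coe.1 he')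
        rw [Finset.mem_coe, Finset.mem_filter]
        exact ⟨Finset.mem_univ _, Jb_iff H _ _ _ hne hadj (Jb_sub _ _ he')⟩
      · exact Subtype.val_injective.injOn

lemma weight_of {I : Type} [Fintype I] [DecidableEq I] (ω : I → Ω × (τ → Fin q))
    (R : Finset I) (D : ℕ) (e : {i // i ∈ R}) :
    ∑ c ∈ (cons (cmem (fun e : {i // i ∈ R} => Vb ψ (ω e.1)) (Fintype.card τ)
        (fun e => Jb ψ J (ω e.1))) e).filter (fun c => c.isLeft = false),
      (1 / (D : ℝ)) ^ ((cmem (fun e : {i // i ∈ R} => Vb ψ (ω e.1)) (Fintype.card τ)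
        (fun e => Jb ψ J (ω e.1)) c).card - 1) ≤
    ∑ A ∈ (badS ψ 3 8 (fun a => 2 * a - 2) ω).filter (fun A => e.1 ∈ A), (1 / (D : ℝ)) ^ (A.card - 1) := by
  classical
  set M := cmem (fun e : {i // i ∈ R} => Vb ψ (ω e.1)) (Fintype.card τ) (fun e => Jb ψ J (ω e.1)) with hM
  let g : Finset (B × Fin q) ⊕ Finset {i // i ∈ R} → Finset I := fun c => (M c).image Subtype.val
  have key : ∀ c ∈ (cons M e).filter (fun c => c.isLeft = false), ∃ c', c = .inr c' ∧ M c = c' ∧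
      Conf (fun e : {i // i ∈ R} => Vb ψ (ω e.1)) (Fintype.card τ) c' ∧ e ∈ c' := by
    intro c hc
    rw [Finset.mem_filter, mem_cons] at hc
    rcases c with π | c'
    · simp at hc
    · obtain ⟨h1, h2⟩ := cmem_inr hc.1
      exact ⟨c', rfl, h2, h1, h2 ▸ hc.1⟩
  have hinj : Set.InjOn g ((cons M e).filter (fun c => c.isLeft = false)) := by
    intro c hc d hd h
    obtain ⟨c', rfl, h1, _, _⟩ := key c hc
    obtain ⟨d', rfl, h2, _, _⟩ := key d hd
    have := Finset.image_injective Subtype.val_injective h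
    rw [h1, h2] at this
    rw [this]
  have hc2 : ∀ c, (g c).card = (M c).card := fun c =>
    Finset.card_image_of_injective _ Subtype.val_injective
  calc _ = ∑ c ∈ (cons M e).filter (fun c => c.isLeft = false), (1 / (D : ℝ)) ^ ((g c).card - 1) := by
        simp only [hc2]
    _ = ∑ A ∈ ((cons M e).filter (fun c => c.isLeft = false)).image g, (1 / (D : ℝ)) ^ (A.card - 1) := by
        rw [Finset.sum_image hinj]
    _ ≤ _ := by
        apply Finset.sum_le_sum_of_subset_of_nonneg
        · intro A hA
          obtain ⟨c, hc, rfl⟩ := Finset.mem_image.1 hA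
          obtain ⟨c', rfl, h1, h2, h3⟩ := key c hc
          obtain ⟨h3c, h8c, ht, _⟩ := h2
          have ht2 := ht.2
          unfold vv at ht2
          simp only [badS, Finset.mem_filter, Finset.mem_univ, true_and, hc2, h1]
          refine ⟨⟨⟨h3c, h8c⟩, ?_⟩, ?_⟩
          · simp only [g, h1, Finset.image_biUnion]
            rw [mul_comm c'.card]
            have hh : ∀ a : Finset (B × Fin q), (a.card + 2 * c'.card ≤ Fintype.card τ * c'.card + 2) →
              a.card + (2 * c'.card - 2) ≤ Fintype.card τ * c'.card := by
              intro a ha; omega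
            exact hh _ ht2
          · simp only [g, h1]
            exact Finset.mem_image_of_mem _ h3
        · intro _ _ _; positivity

theorem host [Nonempty Ω] (H : HostS ψ J adj) (δ : ℝ) (hδ : 0 < δ) :
    ∃ C : ℝ, ∃ t0 : ℕ, ∀ t ≥ t0, ∀ s0 : ℕ, ∃ q0 : ℕ, ∀ q ≥ q0,
      ∃ R : Finset (Fin (Fintype.card Ω * t * q ^ 2)),
      ∃ ω : Fin (Fintype.card Ω * t * q ^ 2) → Ω × (τ → Fin q),
      (1 - 3 * δ) * (Fintype.card Ω * t * q ^ 2) ≤ R.card ∧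
      Sys (fun e : {i // i ∈ R} => Vb ψ (ω e.1)) (Fintype.card τ) s0 ⌊(1 + δ) * (t * J.card)⌋₊
        (fun e => Jb ψ J (ω e.1)) ∧
      ∀ e : {i // i ∈ R}, ∑ c ∈ (cons (cmem (fun e : {i // i ∈ R} => Vb ψ (ω e.1)) (Fintype.card τ)
        (fun e => Jb ψ J (ω e.1))) e).filter (fun c => c.isLeft = false),
      (1 / ((⌊(1 + δ) * (t * J.card)⌋₊ : ℕ) : ℝ)) ^ ((cmem (fun e : {i // i ∈ R} => Vb ψ (ω e.1))
        (Fintype.card τ) (fun e => Jb ψ J (ω e.1)) c).card - 1) ≤ C := by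
  classical
  set C1 : ℝ := ∑ a ∈ Finset.Icc 3 8, (Fintype.card Ω : ℝ) ^ (a - 1) * a *
        ((a * Fintype.card τ : ℕ) : ℝ) ^ (a * Fintype.card τ) with hC1
  have hC10 : 0 ≤ C1 := Finset.sum_nonneg fun a _ => by positivity
  obtain ⟨t1, ht1⟩ := exists_nat_ge ((1 / δ + 1) / δ / δ)
  refine ⟨(C1 + 1) / δ, max 1 t1, fun t ht s0 => ?_⟩
  have ht0 : 0 < t := lt_of_lt_of_le Nat.one_pos ((le_max_left _ _).trans ht)
  have ht1' : ((1 / δ + 1) / δ / δ) ≤ t := ht1.trans (by exact_mod_cast (le_max_right _ _).trans ht)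
  set K1 : ℝ := ∑ a ∈ Finset.Icc 2 s0, ((Fintype.card Ω : ℝ) * t) ^ a *
        ((a * Fintype.card τ : ℕ) : ℝ) ^ (a * Fintype.card τ) with hK1
  obtain ⟨q1, hq1⟩ := exists_nat_ge (K1 / δ)
  refine ⟨max 1 q1, fun q hqq => ?_⟩
  have hq0 : 0 < q := lt_of_lt_of_le Nat.one_pos ((le_max_left _ _).trans hqq)
  have hq1' : K1 / δ ≤ q := hq1.trans (by exact_mod_cast (le_max_right _ _).trans hqq)
  have : Nonempty (Fin q) := ⟨⟨0, hq0⟩⟩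
  have hq' : (1 : ℝ) ≤ q := by exact_mod_cast hq0
  have ht' : (1 : ℝ) ≤ t := by exact_mod_cast ht0
  have hQ : (1 : ℝ) ≤ Fintype.card Ω := by exact_mod_cast Fintype.card_pos
  have hJ : (1 : ℝ) ≤ J.card := by exact_mod_cast H.jnon.card_pos
  set T : ℕ := Fintype.card Ω * t * q ^ 2 with hT
  have hTr : (T : ℝ) = Fintype.card Ω * t * q ^ 2 := by rw [hT]; push_cast; ring
  have hI : Fintype.card (Fin T) = Fintype.card Ω * t * q ^ 2 := by simp [hT]
  set D : ℕ := ⌊(1 + δ) * (t * J.card)⌋₊ with hD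
  have hDt : t ≤ D := by
    rw [hD]
    apply Nat.le_floor
    have h1 : (t : ℝ) * 1 ≤ t * J.card := by gcongr
    nlinarith
  -- the three bad sets
  let f1 : (Fin T → Ω × (τ → Fin q)) → ℝ := fun ω => ((badS ψ 2 s0 (fun a => 2 * a - 1) ω).card : ℝ)
  let W : (Fin T → Ω × (τ → Fin q)) → Fin T → ℝ := fun ω i =>
    ∑ A ∈ (badS ψ 3 8 (fun a => 2 * a - 2) ω).filter (fun A => i ∈ A), (1 / (D : ℝ)) ^ (A.card - 1)
  have hW0 : ∀ ω i, 0 ≤ W ω i := fun ω i => Finset.sum_nonneg fun _ _ => by positivity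
  let b2 : (Fin T → Ω × (τ → Fin q)) → Finset (Fin T) := fun ω =>
    Finset.univ.filter fun i => (C1 + 1) / δ < W ω i
  have e1 : EU f1 ≤ δ * T := by
    refine (bad1_exp (I := Fin T) ψ t s0 hq0 hI).trans ?_
    rw [← hK1, hTr]
    have h1 : K1 ≤ q * δ := by rwa [div_le_iff₀ hδ] at hq1'
    have h2 : (1 : ℝ) * 1 ≤ Fintype.card Ω * t := mul_le_mul hQ ht' zero_le_one (by linarith)
    calc K1 * q ≤ (q * δ) * q := by gcongr
      _ = δ * (1 * q ^ 2) := by ring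
      _ ≤ δ * (Fintype.card Ω * t * q ^ 2) := by gcongr; linarith
  have e2 : EU (fun ω => ((b2 ω).card : ℝ)) ≤ δ * T := by
    have h1 : ∀ ω, ((b2 ω).card : ℝ) ≤ (δ / (C1 + 1)) * ∑ A ∈ badS ψ 3 8 (fun a => 2 * a - 2) ω,
        (A.card : ℝ) * (1 / (D : ℝ)) ^ (A.card - 1) := by
      intro ω
      rw [← sum_W ψ ω (fun a => (1 / (D : ℝ)) ^ (a - 1))]
      have h2 : ((b2 ω).card : ℝ) * ((C1 + 1) / δ) ≤ ∑ i, W ω i := by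
        calc ((b2 ω).card : ℝ) * ((C1 + 1) / δ) = ∑ i ∈ b2 ω, ((C1 + 1) / δ) := by simp
          _ ≤ ∑ i ∈ b2 ω, W ω i := Finset.sum_le_sum fun i hi => (Finset.mem_filter.1 hi).2.le
          _ ≤ _ := Finset.sum_le_sum_of_subset_of_nonneg (Finset.subset_univ _) fun i _ _ => hW0 ω i
      have hpos : 0 < C1 + 1 := by linarith
      rw [mul_comm, ← div_le_iff₀ (by positivity)]
      rw [div_div_eq_mul_div, mul_div_assoc]
      exact h2
    refine (EU_mono h1).trans ?_
    rw [EU_smul]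
    have h3 := bad2_exp (I := Fin T) ψ t D hq0 ht0 hDt hI
    rw [← hC1] at h3
    have hpos : 0 < C1 + 1 := by linarith
    calc _ ≤ (δ / (C1 + 1)) * (C1 * Fintype.card (Fin T)) := mul_le_mul_of_nonneg_left h3 (by positivity)
      _ = δ * T * (C1 / (C1 + 1)) := by rw [Fintype.card_fin]; ring
      _ ≤ δ * T * 1 := by
        apply mul_le_mul_of_nonneg_left _ (by positivity)
        rw [div_le_one hpos]; linarith
      _ = _ := by ring
  obtain ⟨b3, e3, h3⟩ := bad_deg (I := Fin T) H hq0 t ht0 hI δ hδ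
  have e3' : EU (fun ω => ((b3 ω).card : ℝ)) ≤ δ * T := by
    refine e3.trans ?_
    rw [hTr]
    have h1 : ((1 / δ + 1) / δ) ≤ t * δ := by rwa [div_le_iff₀ hδ] at ht1'
    calc (Fintype.card Ω : ℝ) * q ^ 2 * ((1 / δ + 1) / δ) ≤ Fintype.card Ω * q ^ 2 * (t * δ) := by gcongr
      _ = _ := by ring
  obtain ⟨ω, hω⟩ := EU_exists (fun ω => f1 ω + ((b2 ω).card : ℝ) + ((b3 ω).card : ℝ))
    (c := 3 * δ * T) (by
      rw [EU_add, EU_add]; linarith)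
  -- pick one index in each over-dense set
  have hne : ∀ A : Finset (Fin T), ∃ i : Option (Fin T), A.Nonempty → ∃ j ∈ A, i = some j := by
    intro A
    rcases A.eq_empty_or_nonempty with h | ⟨j, hj⟩
    · exact ⟨none, fun h' => by simp [h] at h'⟩
    · exact ⟨some j, fun _ => ⟨j, hj, rfl⟩⟩
  choose pk hpk using hne
  let b1 : Finset (Fin T) := Finset.univ.filter fun i => some i ∈
    (badS ψ 2 s0 (fun a => 2 * a - 1) ω).image pk
  have hb1 : (b1.card : ℝ) ≤ f1 ω := by
    have h1 : b1.card ≤ ((badS ψ 2 s0 (fun a => 2 * a - 1) ω).image pk).card := by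
      apply Finset.card_le_card_of_injOn some
      · intro i hi
        exact (Finset.mem_filter.1 hi).2
      · exact (Option.some_injective _).injOn
    exact Nat.cast_le.2 (h1.trans Finset.card_image_le)
  set R : Finset (Fin T) := ((b1 ∪ b2 ω) ∪ b3 ω)ᶜ with hR
  have hmem : ∀ i ∈ R, i ∉ b1 ∧ i ∉ b2 ω ∧ i ∉ b3 ω := by
    intro i hi
    simp only [hR, Finset.mem_compl, Finset.mem_union, not_or] at hi
    exact ⟨hi.1.1, hi.1.2, hi.2⟩
  refine ⟨R, ω, ?_, ?_, ?_⟩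
  · rw [← hTr]
    have h1 : R.card + ((b1 ∪ b2 ω) ∪ b3 ω).card = T := by
      rw [hR, Finset.card_compl, Fintype.card_fin]
      have := Finset.card_le_univ ((b1 ∪ b2 ω) ∪ b3 ω)
      rw [Fintype.card_fin] at this
      omega
    have h2 := Finset.card_union_le (b1 ∪ b2 ω) (b3 ω)
    have h2' := Finset.card_union_le b1 (b2 ω)
    have h4 : (T : ℝ) ≤ R.card + (b1.card + (b2 ω).card + (b3 ω).card) := by
      have : T ≤ R.card + (b1.card + (b2 ω).card + (b3 ω).card) := by omega
      exact_mod_cast this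
    linarith
  · apply sys_of H
    · intro A hA hbad
      have h2 : A.Nonempty := by
        simp only [badS, Finset.mem_filter] at hbad
        exact Finset.card_pos.1 (by omega)
      obtain ⟨j, hj, hp⟩ := hpk A h2
      apply (hmem j (hA hj)).1
      simp only [b1, Finset.mem_filter, Finset.mem_univ, true_and]
      rw [← hp]
      exact Finset.mem_image_of_mem _ hbad
    · intro i hi U W' hev
      exact Nat.le_floor (h3 ω i (hmem i hi).2.2 U W' hev)
  · intro e
    refine (weight_of ω R D e).trans ?_
    have := (hmem e.1 e.2).2.1
    simp only [b2, Finset.mem_filter, Finset.mem_univ, true_and, not_lt] at this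
    exact this
end Host4
end BES

set_option linter.unusedSectionVars false
namespace BES
section Macro
variable {τ : Type} [Fintype τ] [DecidableEq τ]

abbrev Coo (J : Finset (τ × τ)) := Option {p : τ × τ // p.1 ≠ p.2 ∧ p ∉ J}

def AA {J : Finset (τ × τ)} {F : Type} (g : τ → F) (v : τ) : Coo J → F
  | none => g v
  | some p => g (if v = p.1.2 then p.1.1 else v)

lemma AA_iff {J : Finset (τ × τ)} (hs : ∀ p ∈ J, (p.2, p.1) ∈ J) {F : Type} {g : τ → F}
    (hg : Function.Injective g) {v w : τ} (hne : v ≠ w) :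
    (∀ i : Coo J, AA g v i ≠ AA g w i) ↔ (v, w) ∈ J := by
  constructor
  · intro h
    by_contra hn
    apply h (some ⟨(v, w), hne, hn⟩)
    simp [AA]
  · rintro hJ (_ | ⟨⟨x, y⟩, hxy, hn⟩)
    · simp only [AA]
      exact fun h => hne (hg h)
    · simp only [AA]
      intro h
      replace h := hg h
      split_ifs at h with h1 h2 h2
      · exact hne (h1.trans h2.symm)
      · subst h1; subst h
        exact hn (hs _ hJ)
      · subst h2; subst h
        exact hn hJ
      · exact hne h

lemma macro_exists (J : Finset (τ × τ)) (hne : ∀ p ∈ J, p.1 ≠ p.2) (hs : ∀ p ∈ J, (p.2, p.1) ∈ J)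
    (hJ : J.Nonempty) (ε : ℝ) (hε : 0 < ε) :
    ∃ (Ω B : Type) (_ : Fintype Ω) (_ : DecidableEq Ω) (_ : Fintype B) (_ : DecidableEq B)
      (ψ : Ω → τ → B) (adj : B → B → Prop), Nonempty Ω ∧ HostS ψ J adj ∧ 0 < Fintype.card B ∧
      (1 - ε) * (Fintype.card B : ℝ) ^ 2 ≤ Fintype.card Ω := by
  classical
  set s := Fintype.card (Coo J) with hsdef
  obtain ⟨L0, hL0⟩ := exists_nat_ge ((s : ℝ) / ε)
  obtain ⟨L, hL, hLp⟩ := Nat.exists_infinite_primes (max (max (Fintype.card τ) L0) 2)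
  have hfact : Fact L.Prime := ⟨hLp⟩
  have hL1 : Fintype.card τ ≤ L := (le_max_left _ _).trans ((le_max_left _ _).trans hL)
  have hL2 : L0 ≤ L := (le_max_right _ _).trans ((le_max_left _ _).trans hL)
  have hL3 : 2 ≤ L := (le_max_right _ _).trans hL
  have hLr : (0 : ℝ) < L := by exact_mod_cast hLp.pos
  obtain ⟨g⟩ : Nonempty (τ ↪ ZMod L) := Function.Embedding.nonempty_of_card_le (by rw [ZMod.card]; exact hL1)
  refine ⟨(Coo J → (ZMod L)ˣ) × (Coo J → ZMod L), Coo J → ZMod L, inferInstance, inferInstance,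
    inferInstance, inferInstance, fun o v i => (o.1 i : ZMod L) * AA g v i + o.2 i,
    fun b b' => ∀ i, b i ≠ b' i, inferInstance, ?_, ?_, ?_⟩
  · refine ⟨?_, hne, hJ, ?_, ?_⟩
    · intro o v w h
      have h := congrFun h none
      simp only [AA, add_left_inj, Units.mul_right_inj] at h
      exact g.injective h
    · intro o v w hvw
      rw [← AA_iff hs g.injective hvw]
      apply forall_congr'
      intro i
      simp
    · rintro ⟨v, w⟩ hp b b' hb
      have hA := (AA_iff hs g.injective (hne _ hp)).2 hp
      simp only at hA
      have hA' : ∀ i, AA (J := J) g v i - AA g w i ≠ 0 := fun i => sub_ne_zero.2 (hA i)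
      have hb' : ∀ i, b i - b' i ≠ 0 := fun i => sub_ne_zero.2 (hb i)
      refine ⟨(fun i => Units.mk0 ((b i - b' i) / (AA g v i - AA g w i)) (div_ne_zero (hb' i) (hA' i)),
        fun i => b i - (b i - b' i) / (AA g v i - AA g w i) * AA g v i), ⟨?_, ?_⟩, ?_⟩
      · funext i
        simp
      · funext i
        have := hA' i
        simp only [Units.val_mk0]
        field_simp
        ring
      · rintro ⟨u, t⟩ ⟨h1, h2⟩
        have e1 : ∀ i, (u i : ZMod L) * AA g v i + t i = b i := fun i => congrFun h1 i
        have e2 : ∀ i, (u i : ZMod L) * AA g w i + t i = b' i := fun i => congrFun h2 i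
        have eu : ∀ i, (u i : ZMod L) = (b i - b' i) / (AA g v i - AA g w i) := by
          intro i
          rw [eq_div_iff (hA' i), ← e1 i, ← e2 i]
          ring
        refine Prod.ext ?_ ?_
        · funext i
          apply Units.ext
          rw [Units.val_mk0]
          exact eu i
        · funext i
          simp only
          rw [← eu i, ← e1 i]
          ring
  · exact Fintype.card_pos
  · have hB : Fintype.card (Coo J → ZMod L) = L ^ s := by
      rw [Fintype.card_fun, ZMod.card]
    have hO : Fintype.card ((Coo J → (ZMod L)ˣ) × (Coo J → ZMod L)) = (L - 1) ^ s * L ^ s := by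
      rw [Fintype.card_prod, Fintype.card_fun, Fintype.card_fun, ZMod.card, ZMod.card_units]
    rw [hB, hO]
    push_cast [Nat.cast_sub hLp.one_le]
    have h1 : 1 + (s : ℝ) * (-(1 / L)) ≤ (1 + (-(1 / (L : ℝ)))) ^ s := by
      apply one_add_mul_le_pow
      have : 1 / (L : ℝ) ≤ 1 := by
        rw [div_le_one hLr]; exact_mod_cast hLp.one_le
      linarith
    have h2 : (s : ℝ) / L ≤ ε := by
      rw [div_le_iff₀ hLr]
      rw [div_le_iff₀ hε] at hL0
      have : (L0 : ℝ) ≤ L := by exact_mod_cast hL2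
      nlinarith
    have h3 : ((L : ℝ) - 1) ^ s = (1 + (-(1 / (L : ℝ)))) ^ s * (L : ℝ) ^ s := by
      rw [← mul_pow]
      congr 1
      field_simp
      ring
    rw [h3]
    have h4 : 1 - ε ≤ (1 + (-(1 / (L : ℝ)))) ^ s := by
      refine le_trans ?_ h1
      have : (s : ℝ) * (-(1 / L)) = - (s / L) := by ring
      linarith
    calc (1 - ε) * ((L : ℝ) ^ s) ^ 2 ≤ (1 + (-(1 / (L : ℝ)))) ^ s * ((L : ℝ) ^ s) ^ 2 := by gcongr
      _ = _ := by ring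
end Macro
end BES

set_option linter.unusedSectionVars false
namespace BES
section Assembly
variable {m q : ℕ} {Ω B E : Type} [Fintype Ω] [DecidableEq Ω]
  [Fintype B] [DecidableEq B] [Fintype E] [DecidableEq E]

def ed (ψ : Ω → Tv m → B) (o : E → Ω × (Tv m → Fin q)) (x : E × IX m) : Finset (B × Fin q) :=
  (tedge x.2).image (phi ψ (o x.1))

variable {ψ : Ω → Tv m → B} {adj : B → B → Prop} {o : E → Ω × (Tv m → Fin q)} {N s0 D : ℕ} {M : Finset E}

lemma mem_Jb_of_JJ (e : E) {u v : Tv m} (h : JJ u v) :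
    ({phi ψ (o e) u, phi ψ (o e) v} : Finset (B × Fin q)) ∈ Jb ψ (Jset m) (o e) := by
  classical
  exact Finset.mem_image.2 ⟨(u, v), by simp [Jset, h], rfl⟩

lemma ed_card (H : HostS ψ (Jset m) adj) (x : E × IX m) : (ed ψ o x).card = 3 := by
  rw [ed, Finset.card_image_of_injective _ (phi_inj H _), tedge_card]

lemma ed_inj (H : HostS ψ (Jset m) adj)
    (hS : Sys (fun e => Vb ψ (o e)) N s0 D (fun e => Jb ψ (Jset m) (o e)))
    (hM : ∀ π, ∀ e ∈ M, ∀ e' ∈ M, π ∈ Jb ψ (Jset m) (o e) → π ∈ Jb ψ (Jset m) (o e') → e = e') :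
    Set.InjOn (ed ψ o) (M ×ˢ (Finset.univ : Finset (IX m)) : Finset (E × IX m)) := by
  rintro ⟨e, x⟩ hx ⟨e', x'⟩ hx' h
  have hxM : e ∈ M := (Finset.mem_product.1 (Finset.mem_coe.1 hx)).1
  have hxM' : e' ∈ M := (Finset.mem_product.1 (Finset.mem_coe.1 hx')).1
  have hc : 1 < (tedge x).card := by rw [tedge_card]; omega
  obtain ⟨u, hu, v, hv, huv⟩ := Finset.one_lt_card.1 hc
  have hJ := mem_Jb_of_JJ (ψ := ψ) (o := o) e (tedge_JJ x u hu v hv huv)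
  have hsub : ({phi ψ (o e) u, phi ψ (o e) v} : Finset (B × Fin q)) ⊆ Vb ψ (o e') := by
    have h1 : ed ψ o (e', x') ⊆ Vb ψ (o e') := Finset.image_subset_image (Finset.subset_univ _)
    rw [← h] at h1
    rw [Finset.insert_subset_iff, Finset.singleton_subset_iff]
    exact ⟨h1 (Finset.mem_image_of_mem _ hu), h1 (Finset.mem_image_of_mem _ hv)⟩
  have hee : e = e' := hM _ e hxM e' hxM' hJ (hS.closed e e' _ hJ hsub)
  subst hee
  have := Finset.image_injective (phi_inj H (o e)) h
  exact congrArg (Prod.mk e) (tedge_inj this)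

lemma share_J (H : HostS ψ (Jset m) adj)
    (hS : Sys (fun e => Vb ψ (o e)) N s0 D (fun e => Jb ψ (Jset m) (o e)))
    (hM : ∀ π, ∀ e ∈ M, ∀ e' ∈ M, π ∈ Jb ψ (Jset m) (o e) → π ∈ Jb ψ (Jset m) (o e') → e = e')
    {x y : E} (hx : x ∈ M) (hy : y ∈ M) (Sx : Finset (IX m)) (hSx : Sx.Nonempty) (h4 : Sx.card ≤ 4)
    (hU : ((Sx.biUnion tedge).image (phi ψ (o x))).card = Sx.card + 2)
    {u v : B × Fin q} (huv : u ≠ v) (hu : u ∈ (Sx.biUnion tedge).image (phi ψ (o x)))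
    (hv : v ∈ (Sx.biUnion tedge).image (phi ψ (o x))) (huy : u ∈ Vb ψ (o y)) (hvy : v ∈ Vb ψ (o y)) :
    x = y := by
  rw [Finset.card_image_of_injective _ (phi_inj H _)] at hU
  obtain ⟨u', hu', rfl⟩ := Finset.mem_image.1 hu
  obtain ⟨v', hv', rfl⟩ := Finset.mem_image.1 hv
  have hJ := span_J Sx hSx h4 hU.le u' hu' v' hv' (fun h => huv (by rw [h]))
  have hJ' := mem_Jb_of_JJ (ψ := ψ) (o := o) x hJ
  refine hM _ x hx y hy hJ' (hS.closed x y _ hJ' ?_)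
  show _ ⊆ Vb ψ (o y)
  rw [Finset.insert_subset_iff, Finset.singleton_subset_iff]
  exact ⟨huy, hvy⟩

lemma no_config (H : HostS ψ (Jset m) adj)
    (hS : Sys (fun e => Vb ψ (o e)) N s0 D (fun e => Jb ψ (Jset m) (o e))) (hs0 : 8 ≤ s0)
    (hM : ∀ π, ∀ e ∈ M, ∀ e' ∈ M, π ∈ Jb ψ (Jset m) (o e) → π ∈ Jb ψ (Jset m) (o e') → e = e')
    (hC : ∀ c, Conf (fun e => Vb ψ (o e)) N c → ¬ c ⊆ M)
    (P : Finset (E × IX m)) (hP : ∀ z ∈ P, z.1 ∈ M) (h8 : P.card = 8) :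
    11 ≤ (P.biUnion (ed ψ o)).card := by
  classical
  by_contra hcon
  set A := P.image Prod.fst with hA
  let S : E → Finset (IX m) := fun e => Finset.univ.filter fun x => (e, x) ∈ P
  let U : E → Finset (B × Fin q) := fun e => ((S e).biUnion tedge).image (phi ψ (o e))
  have hAM : A ⊆ M := by
    intro e he
    obtain ⟨z, hz, rfl⟩ := Finset.mem_image.1 he
    exact hP z hz
  have hSne : ∀ e ∈ A, (S e).Nonempty := by
    intro e he
    obtain ⟨z, hz, rfl⟩ := Finset.mem_image.1 he
    exact ⟨z.2, by simp [S, hz]⟩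
  have hPS : ∑ e ∈ A, (S e).card = 8 := by
    rw [← h8, Finset.card_eq_sum_card_image Prod.fst P]
    apply Finset.sum_congr rfl
    intro e _
    apply Finset.card_bij (fun x _ => (e, x))
    · intro x hx
      simp only [S, Finset.mem_filter, Finset.mem_univ, true_and] at hx ⊢
      exact ⟨hx, trivial⟩
    · intro x _ y _ h
      exact congrArg Prod.snd h
    · rintro ⟨e', x⟩ hz
      rw [Finset.mem_filter] at hz
      obtain ⟨hz, rfl⟩ := hz
      exact ⟨x, by simp [S, hz], rfl⟩
  have hS8 : ∀ e ∈ A, (S e).card ≤ 8 := by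
    intro e he
    rw [← hPS]
    exact Finset.single_le_sum (f := fun e => (S e).card) (fun _ _ => Nat.zero_le _) he
  have hUc : ∀ e, (U e).card = ((S e).biUnion tedge).card := fun e =>
    Finset.card_image_of_injective _ (phi_inj H _)
  have hU2 : ∀ e ∈ A, (S e).card + 2 ≤ (U e).card := by
    intro e he
    rw [hUc]
    exact (span_aux (S e) (hSne e he) (hS8 e he)).1
  have hUV : ∀ e, U e ⊆ Vb ψ (o e) := fun e => Finset.image_subset_image (Finset.subset_univ _)
  have hUP : ∀ e, U e ⊆ P.biUnion (ed ψ o) := by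
    intro e u hu
    obtain ⟨w, hw, rfl⟩ := Finset.mem_image.1 hu
    obtain ⟨x, hx, hw⟩ := Finset.mem_biUnion.1 hw
    rw [Finset.mem_biUnion]
    exact ⟨(e, x), (Finset.mem_filter.1 hx).2, Finset.mem_image_of_mem _ hw⟩
  have hAne : A.Nonempty := by
    rw [hA, Finset.image_nonempty]
    exact Finset.card_pos.1 (by omega)
  have hA8 : A.card ≤ 8 := by rw [← h8]; exact Finset.card_image_le
  have hsp := hS.sparse A hAne (by omega)
  have hcard : ∀ e, (Vb ψ (o e)).card = N := hS.card
  -- covering bound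
  have cover : ∀ Z : E → Finset (B × Fin q), A.biUnion (fun e => Vb ψ (o e)) ⊆
      P.biUnion (ed ψ o) ∪ A.biUnion Z → vv (fun e => Vb ψ (o e)) A ≤ 10 + ∑ e ∈ A, (Z e).card := by
    intro Z hZ
    have h1 := (Finset.card_le_card hZ).trans (Finset.card_union_le _ _)
    have h2 : (A.biUnion Z).card ≤ ∑ e ∈ A, (Z e).card := Finset.card_biUnion_le
    unfold vv
    omega
  have hZsum : ∑ e ∈ A, (Vb ψ (o e) \ U e).card + ∑ e ∈ A, (U e).card = N * A.card := by
    rw [← Finset.sum_add_distrib, mul_comm, ← smul_eq_mul, ← Finset.sum_const]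
    apply Finset.sum_congr rfl
    intro e _
    rw [Finset.card_sdiff_add_card_eq_card (hUV e), hcard]
  have hUsum : 8 + 2 * A.card ≤ ∑ e ∈ A, (U e).card := by
    calc 8 + 2 * A.card = ∑ e ∈ A, ((S e).card + 2) := by
          rw [Finset.sum_add_distrib, hPS]; simp [mul_comm]
      _ ≤ _ := Finset.sum_le_sum hU2
  have hv1 := cover (fun e => Vb ψ (o e) \ U e) (by
    intro u hu
    obtain ⟨e, he, hu⟩ := Finset.mem_biUnion.1 hu
    rw [Finset.mem_union]
    by_cases h : u ∈ U e
    · exact Or.inl (hUP e h)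
    · exact Or.inr (Finset.mem_biUnion.2 ⟨e, he, Finset.mem_sdiff.2 ⟨hu, h⟩⟩))
  have hUeq : ∀ e ∈ A, (S e).card + 2 = (U e).card := by
    apply (Finset.sum_eq_sum_iff_of_le hU2).1
    rw [Finset.sum_add_distrib, hPS]
    simp only [Finset.sum_const, smul_eq_mul]
    omega
  have hcommon : ∀ x ∈ A, ∀ y ∈ A, x ≠ y → ∀ u, u ∈ Vb ψ (o x) → u ∈ Vb ψ (o y) → u ∈ U x := by
    intro x hx y hy hxy u hux huy
    by_contra hnu
    let Z : E → Finset (B × Fin q) := fun e => if e = x then (Vb ψ (o x) \ U x).erase u else Vb ψ (o e) \ U e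
    have hv2 := cover Z (by
      intro w hw
      obtain ⟨e, he, hw⟩ := Finset.mem_biUnion.1 hw
      rw [Finset.mem_union]
      by_cases hwu : w = u
      · subst hwu
        by_cases h : w ∈ U y
        · exact Or.inl (hUP y h)
        · refine Or.inr (Finset.mem_biUnion.2 ⟨y, hy, ?_⟩)
          simp only [Z, if_neg hxy.symm]
          exact Finset.mem_sdiff.2 ⟨huy, h⟩
      · by_cases h : w ∈ U e
        · exact Or.inl (hUP e h)
        · refine Or.inr (Finset.mem_biUnion.2 ⟨e, he, ?_⟩)
          simp only [Z]
          split_ifs with hex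
          · subst hex
            exact Finset.mem_erase.2 ⟨hwu, Finset.mem_sdiff.2 ⟨hw, h⟩⟩
          · exact Finset.mem_sdiff.2 ⟨hw, h⟩)
    have hlt : ∑ e ∈ A, (Z e).card < ∑ e ∈ A, (Vb ψ (o e) \ U e).card := by
      apply Finset.sum_lt_sum
      · intro e _
        simp only [Z]
        split_ifs with hex
        · subst hex
          exact Finset.card_le_card (Finset.erase_subset _ _)
        · exact le_rfl
      · refine ⟨x, hx, ?_⟩
        simp only [Z, if_true]
        exact Finset.card_erase_lt_of_mem (Finset.mem_sdiff.2 ⟨hux, hnu⟩)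
    omega
  have htA : Tight (fun e => Vb ψ (o e)) N A := ⟨hAne, by omega⟩
  by_cases h1 : A.card = 1
  · obtain ⟨e, he⟩ := Finset.card_eq_one.1 h1
    rw [he, Finset.sum_singleton] at hPS
    have heA : e ∈ A := by rw [he]; simp
    have := (span_aux (S e) (hSne e heA) (hS8 e heA)).2.1 hPS
    rw [← hUc] at this
    have h2 := Finset.card_le_card (hUP e)
    omega
  · have hA2 : 2 ≤ A.card := by
      have := hAne.card_pos
      omega
    obtain ⟨A', hA', hmin⟩ := Finset.exists_min_image
      (A.powerset.filter fun A' => 2 ≤ A'.card ∧ Tight (fun e => Vb ψ (o e)) N A') Finset.card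
      ⟨A, by simp [hA2, htA]⟩
    simp only [Finset.mem_filter, Finset.mem_powerset] at hA' hmin
    obtain ⟨hsub, h2, ht⟩ := hA'
    by_cases h3 : 3 ≤ A'.card
    · refine hC A' ⟨h3, (Finset.card_le_card hsub).trans hA8, ht, ?_⟩ (hsub.trans hAM)
      intro A'' hs'' h2'' ht''
      exact Finset.eq_of_subset_of_card_le hs'' (hmin A'' ⟨hs''.trans hsub, h2'', ht''⟩)
    · have h22 : A'.card = 2 := by omega
      obtain ⟨x, y, hxy, rfl⟩ := Finset.card_eq_two.1 h22
      have hx : x ∈ A := hsub (by simp)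
      have hy : y ∈ A := hsub (by simp)
      have ht2 := ht.2
      unfold vv at ht2
      rw [Finset.biUnion_insert, Finset.singleton_biUnion, h22] at ht2
      have hui := Finset.card_union_add_card_inter (Vb ψ (o x)) (Vb ψ (o y))
      rw [hcard, hcard] at hui
      have hinter : 1 < (Vb ψ (o x) ∩ Vb ψ (o y)).card := by omega
      obtain ⟨u, hu, v, hv, huv⟩ := Finset.one_lt_card.1 hinter
      rw [Finset.mem_inter] at hu hv
      have hsum2 : (S x).card + (S y).card ≤ 8 := by
        rw [← hPS, ← Finset.sum_pair (f := fun e => (S e).card) hxy]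
        exact Finset.sum_le_sum_of_subset hsub
      by_cases h4 : (S x).card ≤ 4
      · exact hxy (share_J H hS hM (hAM hx) (hAM hy) (S x) (hSne x hx) h4 (hUeq x hx).symm huv
          (hcommon x hx y hy hxy u hu.1 hu.2) (hcommon x hx y hy hxy v hv.1 hv.2) hu.2 hv.2)
      · exact hxy.symm (share_J H hS hM (hAM hy) (hAM hx) (S y) (hSne y hy) (by omega) (hUeq y hy).symm huv
          (hcommon y hy x hx hxy.symm u hu.2 hu.1) (hcommon y hy x hx hxy.symm v hv.2 hv.1) hu.1 hv.1)
end Assembly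
end BES

set_option linter.unusedSectionVars false
namespace BES
section Final

lemma free_card {n : ℕ} (G : Finset (Finset (Fin n))) (h3 : ∀ e ∈ G, e.card = 3)
    (hG : ¬ HasConfig G 10 8) : G.card ≤ 7 * n ^ 2 := by
  classical
  have hex : ∀ e ∈ G, ∃ p : Fin n × Fin n, p.1 ≠ p.2 ∧ p.1 ∈ e ∧ p.2 ∈ e := by
    intro e he
    obtain ⟨a, ha, b, hb, hab⟩ := Finset.one_lt_card.1 (by rw [h3 e he]; omega : 1 < e.card)
    exact ⟨(a, b), hab, ha, hb⟩
  by_contra hcon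
  have h0 : 0 < G.card := by omega
  obtain ⟨e0, he0⟩ := Finset.card_pos.1 h0
  obtain ⟨p0, -⟩ := hex e0 he0
  have hex' : ∀ e, ∃ p : Fin n × Fin n, e ∈ G → p.1 ≠ p.2 ∧ p.1 ∈ e ∧ p.2 ∈ e := by
    intro e
    by_cases he : e ∈ G
    · obtain ⟨p, hp⟩ := hex e he
      exact ⟨p, fun _ => hp⟩
    · exact ⟨p0, fun h => absurd h he⟩
  choose f hf using hex'
  obtain ⟨p, -, hp⟩ := Finset.exists_lt_card_fiber_of_mul_lt_card_of_maps_to (s := G)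
    (t := Finset.univ) (f := f) (n := 7) (fun _ _ => Finset.mem_univ _) (by
      simp only [Finset.card_univ, Fintype.card_prod, Fintype.card_fin]
      nlinarith)
  obtain ⟨S, hS, hS8⟩ := Finset.exists_subset_card_eq (n := 8) (Nat.succ_le_of_lt hp)
  refine hG ⟨S, hS.trans (Finset.filter_subset _ _), hS8, ?_⟩
  have hpe : ∀ e ∈ S, p.1 ≠ p.2 ∧ p.1 ∈ e ∧ p.2 ∈ e ∧ e.card = 3 := by
    intro e he
    obtain ⟨h1, h2⟩ := Finset.mem_filter.1 (hS he)
    obtain ⟨h4, h5, h6⟩ := hf e h1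
    rw [h2] at h4 h5 h6
    exact ⟨h4, h5, h6, h3 e h1⟩
  have hsub : S.sup id ⊆ {p.1, p.2} ∪ S.biUnion fun e => e \ {p.1, p.2} := by
    intro x hx
    obtain ⟨e, he, hxe⟩ := Finset.mem_sup.1 hx
    by_cases hxp : x ∈ ({p.1, p.2} : Finset (Fin n))
    · exact Finset.mem_union_left _ hxp
    · exact Finset.mem_union_right _ (Finset.mem_biUnion.2 ⟨e, he, Finset.mem_sdiff.2 ⟨hxe, hxp⟩⟩)
  have hb : (S.biUnion fun e => e \ {p.1, p.2}).card ≤ S.card * 1 := by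
    refine Finset.card_biUnion_le_card_mul _ _ _ fun e he => ?_
    obtain ⟨h1, h2, h4, h5⟩ := hpe e he
    rw [Finset.card_sdiff_of_subset (by
      rw [Finset.insert_subset_iff, Finset.singleton_subset_iff]; exact ⟨h2, h4⟩),
      Finset.card_pair h1, h5]
  have := (Finset.card_le_card hsub).trans (Finset.card_union_le _ _)
  have h2 := Finset.card_le_two (a := p.1) (b := p.2)
  omega

lemma fBES_bdd (n : ℕ) : 7 * n ^ 2 ∈ upperBounds {m : ℕ | ∃ G : Finset (Finset (Fin n)),
    (∀ e ∈ G, e.card = 3) ∧ ¬ HasConfig G 10 8 ∧ G.card = m} := by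
  rintro _ ⟨G, h1, h2, rfl⟩
  exact free_card G h1 h2

lemma fBES_le (n : ℕ) : fBES 3 n 10 8 ≤ 7 * n ^ 2 := by
  refine csSup_le ⟨0, ∅, by simp, ?_, rfl⟩ fun b hb => fBES_bdd n hb
  rintro ⟨S, hS, h8, -⟩
  rw [Finset.subset_empty.1 hS] at h8
  simp at h8

lemma fBES_ge {X : Type} [Fintype X] [DecidableEq X] (n : ℕ) (hX : Fintype.card X ≤ n)
    (G : Finset (Finset X)) (h3 : ∀ e ∈ G, e.card = 3)
    (hG : ∀ S ⊆ G, S.card = 8 → 11 ≤ (S.biUnion id).card) : G.card ≤ fBES 3 n 10 8 := by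
  classical
  obtain ⟨f⟩ := Function.Embedding.nonempty_of_card_le (α := X) (β := Fin n) (by simpa using hX)
  refine le_csSup ⟨_, fBES_bdd n⟩ ⟨G.map (Finset.mapEmbedding f).toEmbedding, ?_, ?_, by simp⟩
  · intro e he
    obtain ⟨e', he', rfl⟩ := Finset.mem_map.1 he
    simpa using h3 e' he'
  · rintro ⟨S, hS, h8, h10⟩
    obtain ⟨S', hS', rfl⟩ := Finset.subset_map_iff.1 hS
    rw [Finset.card_map] at h8
    have := hG S' hS' h8
    have he : ((S'.map (Finset.mapEmbedding f).toEmbedding).sup id) = (S'.biUnion id).map f := by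
      ext x
      simp only [Finset.mem_sup, Finset.mem_map, Finset.mem_biUnion, id]
      constructor
      · rintro ⟨_, ⟨e, he, rfl⟩, hx⟩
        obtain ⟨y, hy, rfl⟩ := Finset.mem_map.1 hx
        exact ⟨y, ⟨e, he, hy⟩, rfl⟩
      · rintro ⟨y, ⟨e, he, hy⟩, rfl⟩
        exact ⟨_, ⟨e, he, rfl⟩, Finset.mem_map_of_mem _ hy⟩
    rw [he, Finset.card_map] at h10
    omega

lemma Jb_card {m q : ℕ} {Ω B : Type} [Fintype Ω] [DecidableEq Ω]
    [Fintype B] [DecidableEq B] {ψ : Ω → Tv m → B} {adj : B → B → Prop}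
    (H : HostS ψ (Jset m) adj) (o : Ω × (Tv m → Fin q)) :
    (Jb ψ (Jset m) o).card =
      ((Jset m).image fun p => ({p.1, p.2} : Finset (Tv m))).card := by
  have : Jb ψ (Jset m) o = ((Jset m).image fun p => ({p.1, p.2} : Finset (Tv m))).image
      (fun s => s.image (phi ψ o)) := by
    rw [Finset.image_image, Jb]
    refine Finset.image_congr fun p _ => ?_
    simp [Finset.image_insert]
  rw [this, Finset.card_image_of_injective _ (Finset.image_injective (phi_inj H o))]

lemma build (m : ℕ) (hm : 1 ≤ m) (ε δ η : ℝ) (hε : 0 < ε) (hδ : 0 < δ)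
    (hδ1 : 3 * δ ≤ 1) (hη : 0 < η) (hη1 : η < 1) : ∃ b : ℕ, 0 < b ∧ ∃ q0 : ℕ, ∀ q ≥ q0, ∀ n ≥ b * q,
      (3 * m ^ 2 : ℝ) * ((1 - η) * ((1 - 3 * δ) * (1 - ε))) * (b * q : ℝ) ^ 2 ≤
        (1 + δ) * (16 * m ^ 2 + 4 * m) * fBES 3 n 10 8 := by
  classical
  have hTv : 2 ≤ Fintype.card (Tv m) := by
    simp; omega
  have hmem : ∀ p, p ∈ Jset m ↔ JJ p.1 p.2 := by intro p; simp [Jset]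
  have hJn : (Jset m).Nonempty := by
    let x : IX m := ((⟨0, hm⟩, ⟨0, hm⟩), 0)
    obtain ⟨u, hu, v, hv, huv⟩ := Finset.one_lt_card.1 (by rw [tedge_card]; omega : 1 < (tedge x).card)
    exact ⟨(u, v), (hmem _).2 (tedge_JJ x u hu v hv huv)⟩
  obtain ⟨Ω, B, _, _, _, _, ψ, adj, hΩ, H, hB, hcard⟩ := macro_exists (Jset m)
    (fun p hp => ((hmem p).1 hp).1) (fun p hp => (hmem _).2 (JJ_symm ((hmem p).1 hp))) hJn ε hε
  refine ⟨Fintype.card B, hB, ?_⟩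
  obtain ⟨C, t0, hhost⟩ := host H δ hδ
  set r := ((Jset m).image fun p => ({p.1, p.2} : Finset (Tv m))).card with hr
  have hr1 : 1 ≤ r := Finset.card_pos.2 (hJn.image _)
  obtain ⟨D0, hcore⟩ := core r hr1 C η hη hη1
  set t := max t0 (max D0 8) with ht
  set D := ⌊(1 + δ) * (t * (Jset m).card)⌋₊ with hD
  have hJ1 : 1 ≤ (Jset m).card := Finset.card_pos.2 hJn
  have hJ1' : (1 : ℝ) ≤ (Jset m).card := by exact_mod_cast hJ1
  have ht8 : 8 ≤ t := (le_max_right _ _).trans (le_max_right _ _)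
  have ht0 : (0 : ℝ) < t := by exact_mod_cast (by omega : 0 < t)
  have htD : t ≤ D := by
    refine Nat.le_floor ?_
    nlinarith [mul_le_mul_of_nonneg_left hJ1' ht0.le, mul_pos hδ ht0, mul_pos (mul_pos hδ ht0) (by linarith : (0:ℝ) < (Jset m).card)]
  have hD8 : 8 ≤ D := ht8.trans htD
  obtain ⟨K, hK⟩ := hcore D (((le_max_left _ _).trans (le_max_right _ _)).trans htD)
  obtain ⟨q0, hq⟩ := hhost t (le_max_left _ _) ((2 * K + 8) * D)
  refine ⟨q0, fun q hqq n hn => ?_⟩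
  obtain ⟨R, ω, hR, hS, hC⟩ := hq q hqq
  set V := fun e : {i // i ∈ R} => Vb ψ (ω e.1)
  set Jp := fun e : {i // i ∈ R} => Jb ψ (Jset m) (ω e.1)
  obtain ⟨M, hM1, hM2, hM3⟩ := hK {i // i ∈ R} (Finset (B × Fin q) ⊕ Finset {i // i ∈ R})
    (cmem V (Fintype.card (Tv m)) Jp) Sum.isLeft (TT (cmem V (Fintype.card (Tv m)) Jp))
    (treeLike hS hTv hD8 K le_rfl) (by
      rintro (π | c) h
      · exact hS.deg π
      · simp at h) (by
      intro e
      rw [hr, ← Jb_card H (ω e.1)]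
      have : (cons (cmem V (Fintype.card (Tv m)) Jp) e).filter (fun c => c.isLeft = true)
          = (Jp e).map Function.Embedding.inl := by
        ext c
        rcases c with π | c
        · simp [mem_cons, cmem_inl]
        · simp
      rw [this, Finset.card_map]) (by
      rintro (π | c) h hne
      · simp at h
      · obtain ⟨e, he⟩ := hne
        obtain ⟨h1, h2⟩ := cmem_inr he
        rw [h2]
        exact ⟨by have := h1.1; omega, h1.2.1⟩) hC
  have hM : ∀ π, ∀ e ∈ M, ∀ e' ∈ M, π ∈ Jb ψ (Jset m) (ω e.1) → π ∈ Jb ψ (Jset m) (ω e'.1) → e = e' := by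
    intro π e he e' he' h h'
    exact hM1 (.inl π) rfl e he e' he' (cmem_inl.2 h) (cmem_inl.2 h')
  have hCf : ∀ c, Conf V (Fintype.card (Tv m)) c → ¬ c ⊆ M := by
    intro c hc
    have h2 : cmem V (Fintype.card (Tv m)) Jp (.inr c) = c := by
      rw [cmem, if_pos hc]
    have := hM2 (.inr c) rfl (by
      rw [h2]; exact Finset.card_pos.1 (by have := hc.1; omega))
    rwa [h2] at this
  have hinj := ed_inj (o := fun e : {i // i ∈ R} => ω e.1) H hS hM
  have hge := fBES_ge (X := B × Fin q) n (by simpa using hn)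
    ((M ×ˢ (Finset.univ : Finset (IX m))).image (ed ψ fun e : {i // i ∈ R} => ω e.1)) (by
      intro e he
      obtain ⟨x, -, rfl⟩ := Finset.mem_image.1 he
      exact ed_card H x) (by
      intro S hS' h8
      obtain ⟨P, hP, rfl⟩ := Finset.subset_image_iff.1 hS'
      rw [Finset.card_image_of_injOn (hinj.mono hP)] at h8
      have := no_config H hS (by nlinarith) hM hCf P
        (fun z hz => (Finset.mem_product.1 (hP hz)).1) h8
      rwa [Finset.image_biUnion])
  rw [Finset.card_image_of_injOn hinj, Finset.card_product] at hge
  have hix : (Finset.univ : Finset (IX m)).card = 3 * m ^ 2 := by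
    simp; ring
  rw [hix] at hge
  have hge' : (M.card : ℝ) * (3 * m ^ 2) ≤ fBES 3 n 10 8 := by exact_mod_cast hge
  rw [Fintype.card_coe] at hM3
  have hDpos : (0 : ℝ) < D := by exact_mod_cast (by omega : 0 < D)
  rw [div_le_iff₀ hDpos] at hM3
  have hDle : (D : ℝ) ≤ (1 + δ) * (t * (16 * m ^ 2 + 4 * m)) := by
    refine (Nat.floor_le (by positivity)).trans ?_
    have : ((Jset m).card : ℝ) ≤ 16 * m ^ 2 + 4 * m := by exact_mod_cast Jset_card
    gcongr
  have e1 : (1 - η) * ((1 - 3 * δ) * (Fintype.card Ω * t * q ^ 2)) ≤ M.card * ((1 + δ) * (t * (16 * m ^ 2 + 4 * m))) :=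
    (mul_le_mul_of_nonneg_left hR (by linarith)).trans (hM3.trans (mul_le_mul_of_nonneg_left hDle (by positivity)))
  have e2 : (1 - η) * ((1 - 3 * δ) * (Fintype.card Ω * q ^ 2)) ≤ M.card * ((1 + δ) * (16 * m ^ 2 + 4 * m)) := by
    refine le_of_mul_le_mul_right ?_ ht0
    linarith
  have e3 : (1 - η) * ((1 - 3 * δ) * ((1 - ε) * (Fintype.card B : ℝ) ^ 2 * q ^ 2)) ≤
      M.card * ((1 + δ) * (16 * m ^ 2 + 4 * m)) := by
    refine le_trans ?_ e2
    have h1 : 0 ≤ 1 - η := by linarith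
    have h2 : 0 ≤ 1 - 3 * δ := by linarith
    gcongr
  calc _ = (1 - η) * ((1 - 3 * δ) * ((1 - ε) * (Fintype.card B : ℝ) ^ 2 * q ^ 2)) * (3 * m ^ 2) := by ring
    _ ≤ M.card * ((1 + δ) * (16 * m ^ 2 + 4 * m)) * (3 * m ^ 2) := by gcongr
    _ = (1 + δ) * (16 * m ^ 2 + 4 * m) * (M.card * (3 * m ^ 2)) := by ring
    _ ≤ _ := by gcongr

lemma eventually_ge (c : ℝ) (hc : c < 3 / 16) :
    ∀ᶠ n : ℕ in Filter.atTop, c ≤ (fBES 3 n 10 8 : ℝ) / (n : ℝ) ^ 2 := by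
  let g : ℝ → ℝ := fun x => 3 * ((1 - x) * ((1 - 3 * x) * (1 - x))) / ((1 + x) * (16 + 4 * x))
  have hg : ContinuousAt g 0 := by
    refine ContinuousAt.div (by fun_prop) (by fun_prop) (by norm_num)
  have hg0 : g 0 = 3 / 16 := by norm_num [g]
  have hlim : Filter.Tendsto (fun k : ℕ => g (1 / (k : ℝ))) Filter.atTop (nhds (3 / 16)) := by
    rw [← hg0]
    exact hg.tendsto.comp tendsto_one_div_atTop_nhds_zero_nat
  obtain ⟨k, hk, hk4⟩ := ((hlim.eventually (lt_mem_nhds hc)).and (Filter.eventually_ge_atTop 4)).exists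
  have hk4' : (4 : ℝ) ≤ k := by exact_mod_cast hk4
  have hk0 : (0 : ℝ) < k := by linarith
  set x : ℝ := 1 / (k : ℝ) with hx
  have hx0 : 0 < x := by positivity
  have hx4 : x ≤ 1 / 4 := one_div_le_one_div_of_le (by norm_num) hk4'
  obtain ⟨b, hb, q0, hq⟩ := build k (by omega) x x x hx0 hx0 (by linarith) hx0 (by linarith)
  have hb0 : (0 : ℝ) < b := by exact_mod_cast hb
  have hlim2 : Filter.Tendsto (fun n : ℕ => g x * (1 - 2 * b * (1 / (n : ℝ)))) Filter.atTop
      (nhds (g x)) := by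
    have := ((tendsto_one_div_atTop_nhds_zero_nat (𝕜 := ℝ)).const_mul (2 * b : ℝ)).const_sub 1
    simpa using this.const_mul (g x)
  filter_upwards [hlim2.eventually (lt_mem_nhds hk), Filter.eventually_ge_atTop (b * (q0 + 1))]
    with n hn hn2
  have hn0 : 0 < n := lt_of_lt_of_le (by positivity) hn2
  have hn0' : (0 : ℝ) < n := by exact_mod_cast hn0
  refine hn.le.trans ?_
  have hqq : q0 ≤ n / b := (Nat.le_div_iff_mul_le hb).2 (by nlinarith)
  have h1 := hq (n / b) hqq n (Nat.mul_div_le n b)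
  have h2 : (n : ℝ) - b ≤ b * (n / b : ℕ) := by
    have h3 := Nat.div_add_mod n b
    have h4 := Nat.mod_lt n hb
    have : n ≤ b * (n / b) + b := by omega
    have : (n : ℝ) ≤ b * (n / b : ℕ) + b := by exact_mod_cast this
    linarith
  have hbn : (b : ℝ) ≤ n := by
    have : b ≤ n := le_trans (by nlinarith) hn2
    exact_mod_cast this
  have h5 : (n : ℝ) ^ 2 - 2 * b * n ≤ (b * (n / b : ℕ) : ℝ) ^ 2 := by
    have := pow_le_pow_left₀ (by linarith) h2 2
    nlinarith [sq_nonneg (b : ℝ)]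
  have hkx : (k : ℝ) * x = 1 := by rw [hx]; field_simp
  have hden : 0 < (1 + x) * (16 + 4 * x) := by positivity
  have hnum : 0 ≤ 3 * ((1 - x) * ((1 - 3 * x) * (1 - x))) := by
    have h1 : 0 ≤ 1 - x := by linarith
    have h2 : 0 ≤ 1 - 3 * x := by linarith
    positivity
  have h6 : 3 * ((1 - x) * ((1 - 3 * x) * (1 - x))) * ((b * (n / b : ℕ) : ℝ) ^ 2) ≤
      (1 + x) * (16 + 4 * x) * fBES 3 n 10 8 := by
    refine le_of_mul_le_mul_left ?_ (by positivity : (0 : ℝ) < k ^ 2)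
    calc _ = (3 * k ^ 2 : ℝ) * ((1 - x) * ((1 - 3 * x) * (1 - x))) * (b * (n / b : ℕ) : ℝ) ^ 2 := by ring
      _ ≤ _ := h1
      _ = (1 + x) * (16 * k ^ 2 + 4 * k * (k * x)) * fBES 3 n 10 8 := by rw [hkx]; ring
      _ = _ := by ring
  rw [le_div_iff₀ (by positivity)]
  have h7 : g x * (1 - 2 * b * (1 / (n : ℝ))) * (n : ℝ) ^ 2 = g x * ((n : ℝ) ^ 2 - 2 * b * n) := by
    field_simp
  rw [h7]
  have hgx : 0 ≤ g x := div_nonneg hnum hden.le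
  refine (mul_le_mul_of_nonneg_left h5 hgx).trans ?_
  show 3 * ((1 - x) * ((1 - 3 * x) * (1 - x))) / ((1 + x) * (16 + 4 * x)) * _ ≤ _
  rw [div_mul_eq_mul_div, div_le_iff₀ hden]
  linarith

lemma main : (3 : ℝ) / 16 ≤
      Filter.liminf (fun n : ℕ => (fBES 3 n 10 8 : ℝ) / (n : ℝ) ^ 2) Filter.atTop := by
  refine le_of_forall_lt fun c hc => ?_
  obtain ⟨c', h1, h2⟩ := exists_between hc
  refine h1.trans_le (Filter.le_liminf_of_le ?_ (eventually_ge c' h2))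
  refine Filter.IsBoundedUnder.isCoboundedUnder_ge ⟨7, ?_⟩
  rw [Filter.eventually_map]
  filter_upwards with n
  have : (fBES 3 n 10 8 : ℝ) ≤ 7 * n ^ 2 := by exact_mod_cast fBES_le n
  exact div_le_of_le_mul₀ (by positivity) (by norm_num) this
end Final
end BES

/-- `liminf f^{(3)}(n;10,8)/n² ≥ 3/16`. -/
theorem lower_bound_pi_3_8 :
    (3 : ℝ) / 16 ≤
      Filter.liminf (fun n : ℕ => (fBES 3 n 10 8 : ℝ) / (n : ℝ) ^ 2) Filter.atTop :=
  BES.main
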